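/- Assume Hypotheses 1–3. For every non-negative function ψ : 𝕏 → ℝ, every a > 0, x ∈ 𝕏, y ∈ ℝ and z ≥ 0, lim_{n→∞} n^{3/2}·𝔼_x( ψ(X_n) ; y+S_n ∈ [z,z+a] , τ_y > n ) = (2V(x,y)/(√(2π)σ³)) · ∫_z^{z+a} 𝔼*_ν( ψ(X*₁)·V*(X*₁, z'+S*₁) ; τ*_{z'} > 1 ) dz'. -/

import Mathlib

open Finset Filter Real Topology MeasureTheory

namespace CLLT

variable {X : Type*}

/-- Product of the transition weights along a path. -/
noncomputable def wt (P : X → X → ℝ) : X → List X → ℝ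
  | _, [] => 1
  | x, y :: ys => P x y * wt P y ys

/-- Extension of a finite path `X₁, …, Xₙ` to a trajectory `ℕ → X` with `X₀ = x`
(values beyond time `n` are irrelevant and set to `x`). -/
def pathExt (x : X) {n : ℕ} (path : Fin n → X) : ℕ → X := fun k =>
  if h : 1 ≤ k ∧ k ≤ n then path ⟨k - 1, by omega⟩ else x

/-- Expectation `𝔼_x (F (X₀, X₁, …))` of a functional of the first `n` steps of the
Markov chain with transition kernel `P` started at `X₀ = x`. -/
noncomputable def Ex [Fintype X] (P : X → X → ℝ) (x : X) (n : ℕ)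
    (F : (ℕ → X) → ℝ) : ℝ :=
  ∑ path : Fin n → X, wt P x (List.ofFn path) * F (pathExt x path)

open Classical in
/-- Real-valued indicator of a proposition. -/
noncomputable def ind (p : Prop) : ℝ := if p then 1 else 0

/-- Partial sum `S_k = f(X₁) + ⋯ + f(X_k)` along a trajectory. -/
noncomputable def Spath (f : X → ℝ) (ω : ℕ → X) (k : ℕ) : ℝ :=
  ∑ i ∈ Finset.Icc 1 k, f (ω i)

/-- The event `τ_y > n`, i.e. `y + S_k > 0` for all `k = 1, …, n`. -/
def survives (f : X → ℝ) (y : ℝ) (n : ℕ) (ω : ℕ → X) : Prop :=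
  ∀ k ∈ Finset.Icc 1 n, 0 < y + Spath f ω k

/-- `n`-step transition kernel. -/
noncomputable def kpow [Fintype X] [DecidableEq X] (P : X → X → ℝ) : ℕ → X → X → ℝ
  | 0 => fun x x' => if x = x' then 1 else 0
  | n + 1 => fun x x' => ∑ y, P x y * kpow P n y x'

/-- Transition operator acting on functions. -/
noncomputable def Pop [Fintype X] (P : X → X → ℝ) (g : X → ℝ) (x : X) : ℝ :=
  ∑ x', P x x' * g x'

/-- Asymptotic variance `σ² = ν(f²) + 2 ∑_{n ≥ 1} ν(f ⬝ Pⁿ f)`. -/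
noncomputable def sigma2 [Fintype X] (P : X → X → ℝ) (ν f : X → ℝ) : ℝ :=
  (∑ x, f x ^ 2 * ν x) + 2 * ∑' n : ℕ, ∑ x, f x * ((Pop P)^[n + 1] f) x * ν x

/-- Hypothesis 1 (primitivity). -/
def Primitive [Fintype X] [DecidableEq X] (P : X → X → ℝ) : Prop :=
  ∃ k₀ : ℕ, 1 ≤ k₀ ∧ ∀ x x', 0 < kpow P k₀ x x'

/-- Hypothesis 3 (non-lattice condition). -/
def NonLattice [Fintype X] (P : X → X → ℝ) (f : X → ℝ) : Prop :=
  ∀ θ a : ℝ, ∃ (n : ℕ) (g : Fin (n + 1) → X),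
    (0 < ∏ i : Fin (n + 1), P (g i) (g (i + 1))) ∧
    ∀ m : ℤ, (∑ i, f (g i)) - (n + 1 : ℝ) * θ ≠ a * (m : ℝ)

/-- `P` is a stochastic matrix and `ν` is a positive invariant probability for it. -/
structure IsStochastic [Fintype X] (P : X → X → ℝ) (ν : X → ℝ) : Prop where
  nonneg : ∀ x x', 0 ≤ P x x'
  rowSum : ∀ x, ∑ x', P x x' = 1
  nuPos : ∀ x, 0 < ν x
  nuSum : ∑ x, ν x = 1
  nuInv : ∀ x', ∑ x, ν x * P x x' = ν x'

/-- Dual kernel `P*(x, x') = ν(x') P(x', x) / ν(x)`. -/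
noncomputable def dualK (P : X → X → ℝ) (ν : X → ℝ) (x x' : X) : ℝ :=
  ν x' * P x' x / ν x

/-- Sup norm of a function on a finite set. -/
noncomputable def supN [Fintype X] [Nonempty X] (ψ : X → ℝ) : ℝ := ⨆ x, |ψ x|

/-- Rayleigh density `φ₊(t) = t e^{-t²/2} 𝟙_{t ≥ 0}`. -/
noncomputable def rayleigh (t : ℝ) : ℝ := if 0 ≤ t then t * Real.exp (-t ^ 2 / 2) else 0

/-- Centred normal density with standard deviation `s`. -/
noncomputable def gauss (s u : ℝ) : ℝ :=
  Real.exp (-u ^ 2 / (2 * s ^ 2)) / (s * Real.sqrt (2 * π))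

/-- Perturbed transition operator `P_t`, as a complex matrix. -/
noncomputable def Pmat [Fintype X] (P : X → X → ℝ) (f : X → ℝ) (t : ℝ) : Matrix X X ℂ :=
  Matrix.of fun x x' => (P x x' : ℂ) * Complex.exp (Complex.I * (t : ℂ) * (f x' : ℂ))

/-- A complex matrix viewed as a continuous linear operator on `X → ℂ`
(equipped with the sup norm). -/
noncomputable def toCLM [Fintype X] (M : Matrix X X ℂ) : (X → ℂ) →L[ℂ] (X → ℂ) :=
  LinearMap.toContinuousLinearMap M.mulVecLin

/-- Fourier transform `ĥ(t) = ∫ e^{-i t u} h(u) du`. -/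
noncomputable def FT (h : ℝ → ℝ) (t : ℝ) : ℂ :=
  ∫ u : ℝ, Complex.exp (-(Complex.I * (t : ℂ) * (u : ℂ))) * (h u : ℂ)

/-- Convolution `(g ∗ k)(u) = ∫ g(v) k(u - v) dv`. -/
noncomputable def convR (g k : ℝ → ℝ) (u : ℝ) : ℝ := ∫ v : ℝ, g v * k (u - v)

/-- Stone's kernel `κ`. -/
noncomputable def kapp (u : ℝ) : ℝ :=
  if u = 0 then 1 / (2 * π) else (Real.sin (u / 2) / (u / 2)) ^ 2 / (2 * π)

/-- Scaled kernel `κ_δ(u) = κ(u/δ)/δ`. -/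
noncomputable def kappD (δ u : ℝ) : ℝ := kapp (u / δ) / δ

/-- Upper regularisation `h̄_ε(u) = sup_{v ∈ [u-ε, u+ε]} h(v)`. -/
noncomputable def upReg (h : ℝ → ℝ) (ε u : ℝ) : ℝ := sSup (h '' Set.Icc (u - ε) (u + ε))

/-- Lower regularisation `ẖ_ε(u) = inf_{v ∈ [u-ε, u+ε]} h(v)`. -/
noncomputable def loReg (h : ℝ → ℝ) (ε u : ℝ) : ℝ := sInf (h '' Set.Icc (u - ε) (u + ε))

/-- The class `𝓗_ε`: non-negative, locally bounded, with `h`, `h̄_ε`, `ẖ_ε`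
measurable and Lebesgue integrable. -/
def MemH (ε : ℝ) (h : ℝ → ℝ) : Prop :=
  (∀ u, 0 ≤ h u) ∧ (∀ K : Set ℝ, IsCompact K → BddAbove (h '' K)) ∧
  Measurable h ∧ Measurable (upReg h ε) ∧ Measurable (loReg h ε) ∧
  Integrable h ∧ Integrable (upReg h ε) ∧ Integrable (loReg h ε)

set_option linter.unusedSectionVars false
set_option linter.unusedDecidableInType false
set_option linter.unusedVariables false



section PartA
variable [Fintype X]

/-! Part A: operators on functions of (state, position) -/

/-- Averaging over the next state. -/
noncomputable def Pm (P : X → X → ℝ) : (X → ℝ → ℝ) →ₗ[ℝ] (X → ℝ → ℝ) where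
  toFun F := fun x u => ∑ x', P x x' * F x' u
  map_add' F G := by ext x u; simp [mul_add, Finset.sum_add_distrib]
  map_smul' c F := by
    ext x u; simp only [Pi.smul_apply, smul_eq_mul, RingHom.id_apply, Finset.mul_sum]
    exact Finset.sum_congr rfl fun _ _ => by ring

/-- Shift with killing. -/
noncomputable def Dm (f : X → ℝ) : (X → ℝ → ℝ) →ₗ[ℝ] (X → ℝ → ℝ) where
  toFun F := fun x u => if 0 < u + f x then F x (u + f x) else 0
  map_add' F G := by ext x u; simp only [Pi.add_apply]; split_ifs <;> simp
  map_smul' c F := by ext x u; simp only [Pi.smul_apply, RingHom.id_apply]; split_ifs <;> simp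

/-- Shift on the complement. -/
noncomputable def Em (f : X → ℝ) : (X → ℝ → ℝ) →ₗ[ℝ] (X → ℝ → ℝ) where
  toFun F := fun x u => if 0 < u + f x then 0 else F x (u + f x)
  map_add' F G := by ext x u; simp only [Pi.add_apply]; split_ifs <;> simp
  map_smul' c F := by ext x u; simp only [Pi.smul_apply, RingHom.id_apply]; split_ifs <;> simp

/-- Shift. -/
noncomputable def Sm (f : X → ℝ) : (X → ℝ → ℝ) →ₗ[ℝ] (X → ℝ → ℝ) where
  toFun F := fun x u => F x (u + f x)
  map_add' F G := by ext x u; simp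
  map_smul' c F := by ext x u; simp

/-- Killed one step operator. -/
noncomputable def KS (P : X → X → ℝ) (f : X → ℝ) : (X → ℝ → ℝ) →ₗ[ℝ] (X → ℝ → ℝ) := Pm P * Dm f

/-- Free one step operator. -/
noncomputable def FS (P : X → X → ℝ) (f : X → ℝ) : (X → ℝ → ℝ) →ₗ[ℝ] (X → ℝ → ℝ) := Pm P * Sm f

/-- Exit one step operator. -/
noncomputable def ES (P : X → X → ℝ) (f : X → ℝ) : (X → ℝ → ℝ) →ₗ[ℝ] (X → ℝ → ℝ) := Pm P * Em f

lemma KS_apply (P : X → X → ℝ) (f : X → ℝ) (F : X → ℝ → ℝ) (x : X) (u : ℝ) :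
    KS P f F x u = ∑ x', P x x' * (if 0 < u + f x' then F x' (u + f x') else 0) := rfl

lemma FS_apply (P : X → X → ℝ) (f : X → ℝ) (F : X → ℝ → ℝ) (x : X) (u : ℝ) :
    FS P f F x u = ∑ x', P x x' * F x' (u + f x') := rfl

lemma ES_apply (P : X → X → ℝ) (f : X → ℝ) (F : X → ℝ → ℝ) (x : X) (u : ℝ) :
    ES P f F x u = ∑ x', P x x' * (if 0 < u + f x' then 0 else F x' (u + f x')) := rfl

lemma KS_eq (P : X → X → ℝ) (f : X → ℝ) : KS P f = FS P f - ES P f := by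
  ext F x u
  simp only [LinearMap.sub_apply, Pi.sub_apply, KS_apply, FS_apply, ES_apply]
  rw [← Finset.sum_sub_distrib]
  refine Finset.sum_congr rfl fun _ _ => ?_
  split_ifs <;> simp

lemma KS_succ (P : X → X → ℝ) (f : X → ℝ) (n : ℕ) (F : X → ℝ → ℝ) (x : X) (u : ℝ) :
    (KS P f ^ (n + 1)) F x u =
      ∑ x', P x x' * (if 0 < u + f x' then (KS P f ^ n) F x' (u + f x') else 0) := by
  rw [pow_succ']; rfl

lemma FS_succ (P : X → X → ℝ) (f : X → ℝ) (n : ℕ) (F : X → ℝ → ℝ) (x : X) (u : ℝ) :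
    (FS P f ^ (n + 1)) F x u = ∑ x', P x x' * (FS P f ^ n) F x' (u + f x') := by
  rw [pow_succ']; rfl

lemma KS_add (P : X → X → ℝ) (f : X → ℝ) (m n : ℕ) (F : X → ℝ → ℝ) :
    (KS P f ^ (m + n)) F = (KS P f ^ m) ((KS P f ^ n) F) := by
  rw [pow_add]; rfl

/-- Duhamel formula. -/
lemma duhamel (P : X → X → ℝ) (f : X → ℝ) (m : ℕ) (F : X → ℝ → ℝ) :
    (KS P f ^ m) F = (FS P f ^ m) F -
      ∑ j ∈ range m, (KS P f ^ j) (ES P f ((FS P f ^ (m - 1 - j)) F)) := by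
  induction m generalizing F with
  | zero => simp
  | succ m ih =>
    have h1 : (KS P f ^ (m + 1)) F = (KS P f ^ m) (FS P f F) - (KS P f ^ m) (ES P f F) := by
      rw [pow_succ, Module.End.mul_apply, KS_eq, LinearMap.sub_apply, map_sub]
    rw [h1, ih, Finset.sum_range_succ, pow_succ (FS P f) m, Module.End.mul_apply]
    have h2 : ∀ j ∈ range m, (KS P f ^ j) (ES P f ((FS P f ^ (m - 1 - j)) (FS P f F))) =
        (KS P f ^ j) (ES P f ((FS P f ^ (m + 1 - 1 - j)) F)) := by
      intro j hj
      have hj' := Finset.mem_range.1 hj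
      have : m + 1 - 1 - j = (m - 1 - j) + 1 := by omega
      rw [this, pow_succ (FS P f), Module.End.mul_apply]
    rw [Finset.sum_congr rfl h2]
    simp only [add_tsub_cancel_right, tsub_self, pow_zero, Module.End.one_apply]
    abel

lemma KS_mono {P : X → X → ℝ} (hP : ∀ x x', 0 ≤ P x x') (f : X → ℝ) (n : ℕ) {F G : X → ℝ → ℝ}
    (x : X) (y : ℝ) (h : ∀ x u, (0 < u ∨ u = y) → F x u ≤ G x u) :
    (KS P f ^ n) F x y ≤ (KS P f ^ n) G x y := by
  induction n generalizing x y with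
  | zero => exact h x y (Or.inr rfl)
  | succ n ih =>
    rw [KS_succ, KS_succ]
    refine Finset.sum_le_sum fun x' _ => mul_le_mul_of_nonneg_left ?_ (hP _ _)
    split_ifs with hu
    · refine ih _ _ fun w v hv => h w v ?_
      rcases hv with hv | hv
      · exact Or.inl hv
      · exact Or.inl (hv ▸ hu)
    · exact le_rfl

lemma KS_nonneg {P : X → X → ℝ} (hP : ∀ x x', 0 ≤ P x x') (f : X → ℝ) (n : ℕ) {F : X → ℝ → ℝ}
    (x : X) (y : ℝ) (h : ∀ x u, (0 < u ∨ u = y) → 0 ≤ F x u) :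
    0 ≤ (KS P f ^ n) F x y := by
  have := KS_mono hP f n (F := 0) (G := F) x y h
  simpa using this

lemma KS_abs {P : X → X → ℝ} (hP : ∀ x x', 0 ≤ P x x') (f : X → ℝ) (n : ℕ) {F G : X → ℝ → ℝ}
    (x : X) (y : ℝ) (h : ∀ x u, (0 < u ∨ u = y) → |F x u| ≤ G x u) :
    |(KS P f ^ n) F x y| ≤ (KS P f ^ n) G x y := by
  rw [abs_le]
  constructor
  · have := KS_mono hP f n (F := -G) (G := F) x y fun x u hu => (abs_le.1 (h x u hu)).1
    simpa using this
  · exact KS_mono hP f n x y fun x u hu => (abs_le.1 (h x u hu)).2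

lemma KS_congr {P : X → X → ℝ} (hP : ∀ x x', 0 ≤ P x x') (f : X → ℝ) (n : ℕ) {F G : X → ℝ → ℝ}
    (x : X) (y : ℝ) (h : ∀ x u, (0 < u ∨ u = y) → F x u = G x u) :
    (KS P f ^ n) F x y = (KS P f ^ n) G x y :=
  le_antisymm (KS_mono hP f n x y fun x u hu => (h x u hu).le)
    (KS_mono hP f n x y fun x u hu => (h x u hu).ge)

lemma KS_mono_start {P : X → X → ℝ} (hP : ∀ x x', 0 ≤ P x x') (f : X → ℝ) (n : ℕ)
    {F G : X → ℝ → ℝ} (hF : ∀ x u, 0 ≤ G x u) (d : ℝ) (hd : 0 ≤ d)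
    (h : ∀ x u, F x u ≤ G x (u + d)) (x : X) (y : ℝ) :
    (KS P f ^ n) F x y ≤ (KS P f ^ n) G x (y + d) := by
  induction n generalizing x y with
  | zero => exact h x y
  | succ n ih =>
    rw [KS_succ, KS_succ]
    refine Finset.sum_le_sum fun x' _ => mul_le_mul_of_nonneg_left ?_ (hP _ _)
    have e : y + d + f x' = y + f x' + d := by ring
    rw [e]
    split_ifs with h1 h2 h2
    · exact ih _ _
    · linarith
    · exact KS_nonneg hP f n _ _ fun x u _ => hF x u
    · exact le_rfl

lemma KS_le_FS {P : X → X → ℝ} (hP : ∀ x x', 0 ≤ P x x') (f : X → ℝ) (n : ℕ)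
    {F : X → ℝ → ℝ} (hF : ∀ x u, 0 ≤ F x u) (x : X) (y : ℝ) :
    (KS P f ^ n) F x y ≤ (FS P f ^ n) F x y ∧ 0 ≤ (FS P f ^ n) F x y := by
  induction n generalizing x y with
  | zero => exact ⟨le_rfl, hF x y⟩
  | succ n ih =>
    rw [KS_succ, FS_succ]
    constructor
    · refine Finset.sum_le_sum fun x' _ => mul_le_mul_of_nonneg_left ?_ (hP _ _)
      split_ifs with h1
      · exact (ih _ _).1
      · exact (ih _ _).2
    · exact Finset.sum_nonneg fun x' _ => mul_nonneg (hP _ _) (ih _ _).2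

/-! Path representation -/

lemma ind_true {p : Prop} (h : p) : ind p = 1 := by simp [ind, h]
lemma ind_false {p : Prop} (h : ¬ p) : ind p = 0 := by simp [ind, h]

lemma pathExt_cons (x a : X) {n : ℕ} (p : Fin n → X) (k : ℕ) (hk : k ≤ n) :
    pathExt x (Fin.cons a p : Fin (n + 1) → X) (k + 1) = pathExt a p k := by
  unfold pathExt
  rw [dif_pos (by omega)]
  rcases k with _ | k
  · rw [dif_neg (by omega)]; rfl
  · rw [dif_pos (by omega)]; rfl

lemma Spath_cons (f : X → ℝ) (x a : X) {n : ℕ} (p : Fin n → X) (k : ℕ) (hk : k ≤ n) :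
    Spath f (pathExt x (Fin.cons a p : Fin (n + 1) → X)) (k + 1)
      = f a + Spath f (pathExt a p) k := by
  induction k with
  | zero =>
    have := pathExt_cons x a p 0 (Nat.zero_le _)
    simp only [zero_add] at this
    simp only [Spath, zero_add, Icc_self, sum_singleton]
    rw [this]; simp [pathExt]
  | succ k ih =>
    have h1 : ∀ (ω : ℕ → X) (j : ℕ), Spath f ω (j + 1) = Spath f ω j + f (ω (j + 1)) := by
      intro ω j; simp only [Spath]; rw [Finset.sum_Icc_succ_top (by omega)]
    rw [h1 (pathExt x (Fin.cons a p : Fin (n + 1) → X)) (k + 1), h1 (pathExt a p) k,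
      ih (by omega), pathExt_cons x a p (k + 1) hk]; ring

lemma survives_cons (f : X → ℝ) (y : ℝ) (x a : X) {n : ℕ} (p : Fin n → X) :
    survives f y (n + 1) (pathExt x (Fin.cons a p : Fin (n + 1) → X)) ↔
      0 < y + f a ∧ survives f (y + f a) n (pathExt a p) := by
  unfold survives
  constructor
  · intro h
    constructor
    · have := h 1 (by simp)
      have h0 := Spath_cons f x a p 0 (Nat.zero_le _)
      simp only [zero_add] at h0
      rw [h0] at this
      simpa [Spath] using this
    · intro k hk
      have hk' := Finset.mem_Icc.1 hk
      have := h (k + 1) (by rw [Finset.mem_Icc]; omega)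
      rw [Spath_cons f x a p k hk'.2] at this
      linarith
  · rintro ⟨h0, h⟩ k hk
    have hk' := Finset.mem_Icc.1 hk
    obtain ⟨j, rfl⟩ : ∃ j, k = j + 1 := ⟨k - 1, by omega⟩
    rw [Spath_cons f x a p j (by omega)]
    rcases j with _ | j
    · simpa [Spath] using h0
    · have := h (j + 1) (by rw [Finset.mem_Icc]; omega)
      linarith

lemma KS_repr (P : X → X → ℝ) (f : X → ℝ) (n : ℕ) (F : X → ℝ → ℝ) (x : X) (y : ℝ) :
    (KS P f ^ n) F x y =
      Ex P x n (fun ω => F (ω n) (y + Spath f ω n) * ind (survives f y n ω)) := by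
  induction n generalizing x y with
  | zero =>
    have h : ∀ ω : ℕ → X, ind (survives f y 0 ω) = 1 := fun ω => ind_true (by simp [survives])
    simp [Ex, wt, h, Spath, pathExt]
  | succ n ih =>
    rw [KS_succ]
    unfold Ex
    rw [← (Fin.consEquiv (fun _ : Fin (n + 1) => X)).sum_comp, Fintype.sum_prod_type]
    refine Finset.sum_congr rfl fun a _ => ?_
    rw [ih]
    unfold Ex
    have e : ∀ p : Fin n → X, (Fin.consEquiv fun _ : Fin (n + 1) => X) (a, p) =
      (Fin.cons a p : Fin (n + 1) → X) := fun _ => rfl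
    simp only [e, List.ofFn_cons, wt]
    by_cases h : 0 < y + f a
    · rw [if_pos h, Finset.mul_sum]
      refine Finset.sum_congr rfl fun p _ => ?_
      rw [pathExt_cons x a p n le_rfl, Spath_cons f x a p n le_rfl]
      have : survives f y (n + 1) (pathExt x (Fin.cons a p : Fin (n + 1) → X)) =
        survives f (y + f a) n (pathExt a p) := by
        rw [eq_iff_iff, survives_cons]; simp [h]
      rw [this, add_assoc]; ring
    · rw [if_neg h, mul_zero, eq_comm]
      refine Finset.sum_eq_zero fun p _ => ?_
      rw [ind_false, mul_zero, mul_zero]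
      rw [survives_cons]; simp [h]

/-- `KS ^ n` is a finite nonnegative combination of evaluations. -/
lemma KS_sum (P : X → X → ℝ) (f : X → ℝ) (n : ℕ) (x : X) (y : ℝ) :
    ∃ (c : (Fin n → X) → ℝ) (w : (Fin n → X) → X) (u : (Fin n → X) → ℝ),
      ∀ F : X → ℝ → ℝ, (KS P f ^ n) F x y = ∑ p, c p * F (w p) (u p) := by
  refine ⟨fun p => wt P x (List.ofFn p) * ind (survives f y n (pathExt x p)),
    fun p => pathExt x p n, fun p => y + Spath f (pathExt x p) n, fun F => ?_⟩
  rw [KS_repr]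
  unfold Ex
  refine Finset.sum_congr rfl fun p _ => by ring

lemma KS_meas (P : X → X → ℝ) (f : X → ℝ) (n : ℕ) (F : X → ℝ → ℝ) (hF : ∀ x, Measurable (F x))
    (x : X) : Measurable ((KS P f ^ n) F x) := by
  induction n generalizing x with
  | zero => exact hF x
  | succ n ih =>
    have : (KS P f ^ (n + 1)) F x = fun u =>
      ∑ x', P x x' * (if 0 < u + f x' then (KS P f ^ n) F x' (u + f x') else 0) := by
      ext u; rw [KS_succ]
    rw [this]
    refine Finset.measurable_sum _ fun x' _ => Measurable.const_mul ?_ _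
    refine Measurable.ite ?_ ((ih x').comp (measurable_id.add_const _)) measurable_const
    exact measurableSet_lt measurable_const (measurable_id.add_const _)

end PartA


section PartB
variable [Fintype X] [DecidableEq X] [Nonempty X]

/-- The standing assumptions. -/
structure Good (P : X → X → ℝ) (ν f : X → ℝ) : Prop where
  st : IsStochastic P ν
  pr : Primitive P
  ce : ∑ x, f x * ν x = 0
  nl : NonLattice P f

/-- Perturbed transition operator. -/
noncomputable def PT (P : X → X → ℝ) (f : X → ℝ) (t : ℝ) : (X → ℂ) →ₗ[ℂ] (X → ℂ) where
  toFun g := fun x => ∑ x', (P x x' : ℂ) * (Complex.exp ((t * f x' : ℝ) * Complex.I) * g x')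
  map_add' g h := by
    ext x; simp only [Pi.add_apply, mul_add, Finset.sum_add_distrib]
  map_smul' c F := by
    ext x; simp only [Pi.smul_apply, smul_eq_mul, RingHom.id_apply, Finset.mul_sum]
    exact Finset.sum_congr rfl fun _ _ => by ring

lemma PT_apply (P : X → X → ℝ) (f : X → ℝ) (t : ℝ) (g : X → ℂ) (x : X) :
    PT P f t g x = ∑ x', (P x x' : ℂ) * (Complex.exp ((t * f x' : ℝ) * Complex.I) * g x') := rfl

lemma PT_succ (P : X → X → ℝ) (f : X → ℝ) (t : ℝ) (n : ℕ) (g : X → ℂ) (x : X) :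
    (PT P f t ^ (n + 1)) g x =
      ∑ x', (P x x' : ℂ) * (Complex.exp ((t * f x' : ℝ) * Complex.I) * (PT P f t ^ n) g x') := by
  rw [pow_succ']; rfl

lemma PT_add (P : X → X → ℝ) (f : X → ℝ) (t : ℝ) (m n : ℕ) (g : X → ℂ) :
    (PT P f t ^ (m + n)) g = (PT P f t ^ m) ((PT P f t ^ n) g) := by
  rw [pow_add]; rfl

lemma PT_bound1 {P : X → X → ℝ} {ν : X → ℝ} (hS : IsStochastic P ν) (f : X → ℝ) (t : ℝ)
    {g : X → ℂ} {M : ℝ} (hg : ∀ x, ‖g x‖ ≤ M) (x : X) : ‖PT P f t g x‖ ≤ M := by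
  rw [PT_apply]
  calc _ ≤ ∑ x', ‖(P x x' : ℂ) * (Complex.exp ((t * f x' : ℝ) * Complex.I) * g x')‖ :=
        norm_sum_le _ _
    _ ≤ ∑ x', P x x' * M := by
        refine Finset.sum_le_sum fun x' _ => ?_
        rw [norm_mul, norm_mul, Complex.norm_exp_ofReal_mul_I, one_mul, Complex.norm_real,
          Real.norm_of_nonneg (hS.nonneg _ _)]
        exact mul_le_mul_of_nonneg_left (hg x') (hS.nonneg _ _)
    _ = M := by rw [← Finset.sum_mul, hS.rowSum, one_mul]

lemma PT_bound {P : X → X → ℝ} {ν : X → ℝ} (hS : IsStochastic P ν) (f : X → ℝ) (t : ℝ) (n : ℕ)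
    {g : X → ℂ} {M : ℝ} (hg : ∀ x, ‖g x‖ ≤ M) (x : X) : ‖(PT P f t ^ n) g x‖ ≤ M := by
  induction n generalizing x with
  | zero => exact hg x
  | succ n ih =>
    rw [pow_succ', Module.End.mul_apply]
    exact PT_bound1 hS f t ih x

/-- Positive probability paths. -/
inductive Reach (P : X → X → ℝ) (f : X → ℝ) : ℕ → X → X → ℝ → Prop
  | nil (x : X) : Reach P f 0 x x 0
  | cons {n : ℕ} {x a x' : X} {s : ℝ} : 0 < P x a → Reach P f n a x' s →
      Reach P f (n + 1) x x' (f a + s)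

lemma Reach.trans {P : X → X → ℝ} {f : X → ℝ} {n m : ℕ} {x y z : X} {s s' : ℝ}
    (h : Reach P f n x y s) (h' : Reach P f m y z s') : Reach P f (n + m) x z (s + s') := by
  induction h with
  | nil x => simpa using h'
  | cons hp _ ih =>
    have := Reach.cons hp (ih h')
    rw [add_assoc (f _), Nat.add_right_comm]
    exact this

lemma reach_of_kpow {P : X → X → ℝ} (hP : ∀ x x', 0 ≤ P x x') (f : X → ℝ) (n : ℕ) (x x' : X)
    (h : 0 < kpow P n x x') : ∃ s, Reach P f n x x' s := by
  induction n generalizing x with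
  | zero =>
    simp only [kpow] at h
    split_ifs at h with hx
    · subst hx; exact ⟨0, Reach.nil x⟩
    · exact absurd h (lt_irrefl _)
  | succ n ih =>
    simp only [kpow] at h
    have : ∃ y ∈ (Finset.univ : Finset X), 0 < P x y * kpow P n y x' := by
      by_contra hc
      push Not at hc
      exact absurd h (not_lt.2 (Finset.sum_nonpos hc))
    obtain ⟨y, -, hy⟩ := this
    have hp : 0 < P x y := by
      rcases (hP x y).lt_or_eq with h1 | h1
      · exact h1
      · rw [← h1, zero_mul] at hy; exact absurd hy (lt_irrefl _)
    obtain ⟨s, hs⟩ := ih y (pos_of_mul_pos_right hy hp.le)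
    exact ⟨_, Reach.cons hp hs⟩

lemma reach_bound {P : X → X → ℝ} {ν : X → ℝ} (hS : IsStochastic P ν) {f : X → ℝ} {N : ℕ}
    {x x' : X} {s : ℝ} (h : Reach P f N x x' s) :
    ∃ ε : ℝ, 0 < ε ∧ ∀ (t : ℝ) (g : X → ℂ) (M : ℝ), (∀ x, ‖g x‖ ≤ M) →
      ‖(PT P f t ^ N) g x - ε * (Complex.exp ((t * s : ℝ) * Complex.I) * g x')‖ ≤ (1 - ε) * M := by
  induction h with
  | nil x => exact ⟨1, one_pos, fun t g M hg => by simp⟩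
  | @cons n x a x' s hp _ ih =>
    obtain ⟨ε, hε, H⟩ := ih
    refine ⟨P x a * ε, mul_pos hp hε, fun t g M hg => ?_⟩
    have e1 : (PT P f t ^ (n + 1)) g x -
        ((P x a * ε : ℝ) : ℂ) * (Complex.exp ((t * (f a + s) : ℝ) * Complex.I) * g x') =
        (P x a : ℂ) * (Complex.exp ((t * f a : ℝ) * Complex.I) * ((PT P f t ^ n) g a -
          ε * (Complex.exp ((t * s : ℝ) * Complex.I) * g x'))) +
        ∑ b ∈ univ.erase a,
          (P x b : ℂ) * (Complex.exp ((t * f b : ℝ) * Complex.I) * (PT P f t ^ n) g b) := by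
      rw [PT_succ, ← Finset.add_sum_erase _ _ (Finset.mem_univ a)]
      have : Complex.exp ((t * (f a + s) : ℝ) * Complex.I) =
          Complex.exp ((t * f a : ℝ) * Complex.I) * Complex.exp ((t * s : ℝ) * Complex.I) := by
        rw [← Complex.exp_add]; push_cast; ring_nf
      rw [this]; push_cast; ring
    rw [e1]
    have e2 : ∑ b ∈ univ.erase a, P x b = 1 - P x a := by
      have := Finset.add_sum_erase univ (P x) (Finset.mem_univ a)
      rw [hS.rowSum] at this; linarith
    calc _ ≤ P x a * ((1 - ε) * M) + ∑ b ∈ univ.erase a, P x b * M := by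
          refine (norm_add_le _ _).trans (add_le_add ?_ ((norm_sum_le _ _).trans
            (Finset.sum_le_sum fun b _ => ?_)))
          · rw [norm_mul, norm_mul, Complex.norm_exp_ofReal_mul_I, one_mul, Complex.norm_real,
              Real.norm_of_nonneg hp.le]
            exact mul_le_mul_of_nonneg_left (H t g M hg) hp.le
          · rw [norm_mul, norm_mul, Complex.norm_exp_ofReal_mul_I, one_mul, Complex.norm_real,
              Real.norm_of_nonneg (hS.nonneg _ _)]
            exact mul_le_mul_of_nonneg_left (PT_bound hS f t n hg b) (hS.nonneg _ _)
      _ = (1 - P x a * ε) * M := by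
          rw [← Finset.sum_mul, e2]; ring

lemma norm_exp_add (α β : ℝ) : ‖Complex.exp (α * Complex.I) + Complex.exp (β * Complex.I)‖ ≤
    2 - (1 - Real.cos (α - β)) / 2 := by
  have h1 := Real.cos_le_one (α - β)
  have h2 := Real.neg_one_le_cos (α - β)
  refine abs_le_of_sq_le_sq' ?_ (by linarith) |>.2
  rw [← Complex.normSq_eq_norm_sq, Complex.normSq_apply]
  simp only [Complex.add_re, Complex.add_im, Complex.exp_ofReal_mul_I_re,
    Complex.exp_ofReal_mul_I_im]
  rw [Real.cos_sub] at *
  nlinarith [Real.sin_sq_add_cos_sq α, Real.sin_sq_add_cos_sq β,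
    sq_nonneg (1 - (Real.cos α * Real.cos β + Real.sin α * Real.sin β))]

lemma reach_two {P : X → X → ℝ} {ν : X → ℝ} (hS : IsStochastic P ν) {f : X → ℝ} {N : ℕ}
    {x x' : X} {s s' : ℝ} (h : Reach P f N x x' s) (h' : Reach P f N x x' s') :
    ∃ c : ℝ, 0 < c ∧ ∀ (t : ℝ) (g : X → ℂ) (M : ℝ), (∀ x, ‖g x‖ ≤ M) →
      ‖(PT P f t ^ N) g x‖ ≤ (1 - c * (1 - Real.cos (t * (s - s')))) * M := by
  obtain ⟨ε₁, hε₁, H₁⟩ := reach_bound hS h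
  obtain ⟨ε₂, hε₂, H₂⟩ := reach_bound hS h'
  set ε := min ε₁ ε₂
  have hε : 0 < ε := lt_min hε₁ hε₂
  have aux : ∀ (ε₁ : ℝ) (s : ℝ), ε ≤ ε₁ → (∀ (t : ℝ) (g : X → ℂ) (M : ℝ), (∀ x, ‖g x‖ ≤ M) →
      ‖(PT P f t ^ N) g x - ε₁ * (Complex.exp ((t * s : ℝ) * Complex.I) * g x')‖ ≤ (1 - ε₁) * M) →
      ∀ (t : ℝ) (g : X → ℂ) (M : ℝ), (∀ x, ‖g x‖ ≤ M) →
      ‖(PT P f t ^ N) g x - ε * (Complex.exp ((t * s : ℝ) * Complex.I) * g x')‖ ≤ (1 - ε) * M := by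
    intro ε₁ s hle H t g M hg
    have e : (PT P f t ^ N) g x - ε * (Complex.exp ((t * s : ℝ) * Complex.I) * g x') =
      ((PT P f t ^ N) g x - ε₁ * (Complex.exp ((t * s : ℝ) * Complex.I) * g x')) +
        ((ε₁ - ε : ℝ) : ℂ) * (Complex.exp ((t * s : ℝ) * Complex.I) * g x') := by push_cast; ring
    rw [e]
    refine (norm_add_le _ _).trans ?_
    have h2 : ‖((ε₁ - ε : ℝ) : ℂ) * (Complex.exp ((t * s : ℝ) * Complex.I) * g x')‖ ≤
        (ε₁ - ε) * M := by
      rw [norm_mul, norm_mul, Complex.norm_exp_ofReal_mul_I, one_mul, Complex.norm_real,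
        Real.norm_of_nonneg (by linarith)]
      exact mul_le_mul_of_nonneg_left (hg x') (by linarith)
    linarith [H t g M hg]
  refine ⟨ε / 4, by positivity, fun t g M hg => ?_⟩
  have a1 := aux ε₁ s (min_le_left _ _) H₁ t g M hg
  have a2 := aux ε₂ s' (min_le_right _ _) H₂ t g M hg
  have a3 : ‖(Complex.exp ((t * s : ℝ) * Complex.I) + Complex.exp ((t * s' : ℝ) * Complex.I)) * g x'‖
      ≤ (2 - (1 - Real.cos (t * (s - s'))) / 2) * M := by
    rw [norm_mul]
    have := norm_exp_add (t * s) (t * s')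
    rw [← mul_sub] at this
    have h0 := Real.neg_one_le_cos (t * (s - s'))
    exact mul_le_mul this (hg x') (norm_nonneg _) (by linarith)
  have e : (2 : ℂ) * (PT P f t ^ N) g x =
      ((PT P f t ^ N) g x - ε * (Complex.exp ((t * s : ℝ) * Complex.I) * g x')) +
      ((PT P f t ^ N) g x - ε * (Complex.exp ((t * s' : ℝ) * Complex.I) * g x')) +
      (ε : ℂ) * ((Complex.exp ((t * s : ℝ) * Complex.I) + Complex.exp ((t * s' : ℝ) * Complex.I))
        * g x') := by ring
  have e' : 2 * ‖(PT P f t ^ N) g x‖ = ‖(2 : ℂ) * (PT P f t ^ N) g x‖ := by simp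
  have a4 : ‖(ε : ℂ) * ((Complex.exp ((t * s : ℝ) * Complex.I) +
      Complex.exp ((t * s' : ℝ) * Complex.I)) * g x')‖
      ≤ ε * ((2 - (1 - Real.cos (t * (s - s'))) / 2) * M) := by
    rw [norm_mul, Complex.norm_real, Real.norm_of_nonneg hε.le]
    exact mul_le_mul_of_nonneg_left a3 hε.le
  have a5 := norm_add₃_le (a := ((PT P f t ^ N) g x -
      ε * (Complex.exp ((t * s : ℝ) * Complex.I) * g x')))
      (b := ((PT P f t ^ N) g x - ε * (Complex.exp ((t * s' : ℝ) * Complex.I) * g x')))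
      (c := (ε : ℂ) * ((Complex.exp ((t * s : ℝ) * Complex.I) +
        Complex.exp ((t * s' : ℝ) * Complex.I)) * g x'))
  rw [← e, ← e'] at a5
  nlinarith

lemma reach_path {P : X → X → ℝ} (f : X → ℝ) (n : ℕ) (h : ℕ → X)
    (hp : ∀ i < n, 0 < P (h i) (h (i + 1))) :
    Reach P f n (h 0) (h n) (∑ i ∈ range n, f (h (i + 1))) := by
  induction n with
  | zero => simpa using Reach.nil (h 0)
  | succ n ih =>
    have h1 := ih fun i hi => hp i (by omega)
    have h2 := h1.trans (Reach.cons (f := f) (hp n (by omega)) (Reach.nil (h (n + 1))))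
    rw [Finset.sum_range_succ]
    simpa using h2

lemma reach_iter {P : X → X → ℝ} {f : X → ℝ} {k : ℕ} {x : X} {L : ℝ} (h : Reach P f k x x L)
    (p : ℕ) : Reach P f (p * k) x x (p * L) := by
  induction p with
  | zero => simpa using Reach.nil x
  | succ p ih =>
    have := ih.trans h
    rw [Nat.succ_mul]; push_cast; rw [add_mul, one_mul]; exact this

lemma nl_loop {P : X → X → ℝ} (hP : ∀ x x', 0 ≤ P x x') (f : X → ℝ) (h3 : NonLattice P f)
    (θ a : ℝ) :
    ∃ (p : ℕ) (x : X) (s : ℝ), Reach P f p x x s ∧ ∀ m : ℤ, s - p * θ ≠ a * m := by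
  obtain ⟨n, g, hpos, hm⟩ := h3 θ a
  have hpos' : ∀ i : Fin (n + 1), 0 < P (g i) (g (i + 1)) := by
    intro i
    refine (hP _ _).lt_of_ne fun h => ?_
    rw [Finset.prod_eq_zero (Finset.mem_univ i) h.symm] at hpos
    exact lt_irrefl _ hpos
  let h : ℕ → X := fun i => g (Fin.ofNat (n + 1) i)
  have hs : ∀ i : ℕ, Fin.ofNat (n + 1) (i + 1) = Fin.ofNat (n + 1) i + 1 := by
    intro i; ext; simp [Fin.val_add, Fin.ofNat]
  have h1 := reach_path (P := P) f (n + 1) h fun i _ => by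
    simp only [h]; rw [hs]; exact hpos' _
  have h2 : h (n + 1) = h 0 := by simp only [h]; congr 1; ext; simp [Fin.ofNat]
  rw [h2] at h1
  have h4 : ∑ i ∈ range (n + 1), f (h (i + 1)) = ∑ i, f (g i) := by
    rw [← Equiv.sum_comp (Equiv.addRight (1 : Fin (n + 1))) (fun i => f (g i)), Finset.sum_range]
    refine Finset.sum_congr rfl fun i _ => ?_
    simp only [h]; rw [hs]
    congr 3
    ext; simp [Fin.ofNat, Nat.mod_eq_of_lt i.2]
  rw [h4] at h1
  exact ⟨n + 1, h 0, _, h1, fun m => by have := hm m; push_cast; exact this⟩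

lemma reach_pair {P : X → X → ℝ} {ν f : X → ℝ} (hG : Good P ν f) (a : ℝ) :
    ∃ (N : ℕ) (x₀ x₁ : X) (s s' : ℝ), Reach P f N x₀ x₁ s ∧ Reach P f N x₀ x₁ s' ∧
      ∀ m : ℤ, s - s' ≠ a * m := by
  by_contra hc
  push Not at hc
  obtain ⟨k, -, hk⟩ := hG.pr
  have hR : ∀ x y, ∃ s, Reach P f k x y s := fun x y =>
    reach_of_kpow hG.st.nonneg f k x y (hk x y)
  let x₀ : X := Classical.arbitrary X
  obtain ⟨L, hL⟩ := hR x₀ x₀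
  have : ∃ y, 0 < P x₀ y := by
    by_contra h
    push Not at h
    have h1 := hG.st.rowSum x₀
    have := Finset.sum_nonpos (s := univ) (f := fun y => P x₀ y) fun y _ => h y
    linarith
  obtain ⟨y, hy⟩ := this
  obtain ⟨M', hM'⟩ := hR y x₀
  have hM := Reach.cons (f := f) hy hM'
  set M := f y + M'
  obtain ⟨p, x, s, hs, hm⟩ := nl_loop hG.st.nonneg f hG.nl (M - L) a
  obtain ⟨α, hα⟩ := hR x₀ x
  obtain ⟨β, hβ⟩ := hR x x₀
  have p1 := ((hα.trans hs).trans hβ).trans (reach_iter hL p)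
  have p2 := (hα.trans hβ).trans (reach_iter hM p)
  have e : k + k + p * (k + 1) = k + p + k + p * k := by ring
  rw [e] at p2
  obtain ⟨m, hm'⟩ := hc _ _ _ _ _ p1 p2
  exact hm m (by rw [← hm']; ring)

lemma contr {P : X → X → ℝ} {ν f : X → ℝ} (hG : Good P ν f) (a : ℝ) :
    ∃ (N : ℕ) (d c : ℝ), 0 < c ∧ (∀ m : ℤ, d ≠ a * m) ∧ ∀ (t : ℝ) (g : X → ℂ) (M : ℝ),
      (∀ x, ‖g x‖ ≤ M) → ∀ x, ‖(PT P f t ^ N) g x‖ ≤ (1 - c * (1 - Real.cos (t * d))) * M := by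
  obtain ⟨N, x₀, x₁, s, s', hs, hs', hm⟩ := reach_pair hG a
  obtain ⟨k, -, hk⟩ := hG.pr
  have hx : ∀ x, ∃ c : ℝ, 0 < c ∧ ∀ (t : ℝ) (g : X → ℂ) (M : ℝ), (∀ x, ‖g x‖ ≤ M) →
      ‖(PT P f t ^ (k + N)) g x‖ ≤ (1 - c * (1 - Real.cos (t * (s - s')))) * M := by
    intro x
    obtain ⟨α, hα⟩ := reach_of_kpow hG.st.nonneg f k x x₀ (hk x x₀)
    have := reach_two hG.st (hα.trans hs) (hα.trans hs')
    rwa [show α + s - (α + s') = s - s' by ring] at this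
  choose c hc H using hx
  obtain ⟨x₂, -, hx₂⟩ := Finset.exists_min_image (univ : Finset X) c Finset.univ_nonempty
  refine ⟨k + N, s - s', c x₂, hc x₂, hm, fun t g M hg x => (H x t g M hg).trans ?_⟩
  have hM : 0 ≤ M := (norm_nonneg _).trans (hg x)
  refine mul_le_mul_of_nonneg_right ?_ hM
  have := mul_le_mul_of_nonneg_right (hx₂ x (Finset.mem_univ x))
    (sub_nonneg.2 (Real.cos_le_one (t * (s - s'))))
  linarith

lemma contr_cpt {P : X → X → ℝ} {ν f : X → ℝ} (hG : Good P ν f) (K : ℝ) :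
    ∃ (N : ℕ) (c : ℝ), 0 < c ∧ ∀ t ∈ Set.Icc 0 K, ∀ (g : X → ℂ) (M : ℝ), (∀ x, ‖g x‖ ≤ M) →
      ∀ x, ‖(PT P f t ^ N) g x‖ ≤ Real.exp (-c * t ^ 2) * M := by
  have one_sub_le : ∀ x : ℝ, 1 - x ≤ Real.exp (-x) := fun x => by
    have := Real.add_one_le_exp (-x); linarith
  refine IsCompact.induction_on (p := fun s : Set ℝ => ∃ (N : ℕ) (c : ℝ), 0 < c ∧ ∀ t ∈ s,
      ∀ (g : X → ℂ) (M : ℝ), (∀ x, ‖g x‖ ≤ M) →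
      ∀ x, ‖(PT P f t ^ N) g x‖ ≤ Real.exp (-c * t ^ 2) * M) isCompact_Icc ?_ ?_ ?_ ?_
  · exact ⟨0, 1, one_pos, fun t ht => absurd ht (Set.notMem_empty t)⟩
  · rintro s t hst ⟨N, c, hc, H⟩
    exact ⟨N, c, hc, fun u hu => H u (hst hu)⟩
  · rintro s s' ⟨N, c, hc, H⟩ ⟨N', c', hc', H'⟩
    refine ⟨N + N', min c c', lt_min hc hc', ?_⟩
    rintro t ht g M hg x
    have hM : 0 ≤ M := (norm_nonneg _).trans (hg x)
    rcases ht with ht | ht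
    · rw [PT_add]
      refine (H t ht _ M (fun x => PT_bound hG.st f t N' hg x) x).trans ?_
      refine mul_le_mul_of_nonneg_right (Real.exp_le_exp.2 ?_) hM
      nlinarith [sq_nonneg t, min_le_left c c']
    · rw [add_comm, PT_add]
      refine (H' t ht _ M (fun x => PT_bound hG.st f t N hg x) x).trans ?_
      refine mul_le_mul_of_nonneg_right (Real.exp_le_exp.2 ?_) hM
      nlinarith [sq_nonneg t, min_le_right c c']
  · intro t₀ ht₀
    by_cases h0 : t₀ = 0
    · subst h0
      obtain ⟨N, d, c, hc, hd, H⟩ := contr hG 0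
      have hd0 : d ≠ 0 := by simpa using hd 0
      have hda : 0 < |d| := abs_pos.2 hd0
      refine ⟨Metric.ball 0 (1 / |d|), mem_nhdsWithin_of_mem_nhds
        (Metric.ball_mem_nhds _ (by positivity)), N, c * (2 / π ^ 2 * d ^ 2), by positivity, ?_⟩
      intro t ht g M hg x
      have hM : 0 ≤ M := (norm_nonneg _).trans (hg x)
      refine (H t g M hg x).trans (mul_le_mul_of_nonneg_right ?_ hM)
      have h1 : |t * d| ≤ 1 := by
        rw [Metric.mem_ball, dist_zero_right, Real.norm_eq_abs, lt_div_iff₀ hda] at ht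
        rw [abs_mul]; exact ht.le
      have h3 : Real.cos (t * d) ≤ 1 - 2 / π ^ 2 * (t * d) ^ 2 :=
        Real.cos_le_one_sub_mul_cos_sq (h1.trans (by linarith [Real.pi_gt_three]))
      have h4 := one_sub_le (c * (2 / π ^ 2 * (t * d) ^ 2))
      have h5 := mul_le_mul_of_nonneg_left h3 hc.le
      calc _ ≤ 1 - (c * (2 / π ^ 2 * (t * d) ^ 2)) := by nlinarith
        _ ≤ _ := h4
        _ = _ := by congr 1; ring
    · obtain ⟨N, d, c, hc, hd, H⟩ := contr hG (2 * π / t₀)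
      have hcos : Real.cos (t₀ * d) < 1 := by
        refine lt_of_le_of_ne (Real.cos_le_one _) fun h => ?_
        obtain ⟨m, hm⟩ := (Real.cos_eq_one_iff _).1 h
        refine hd m ?_
        field_simp
        linarith
      set η := (1 - Real.cos (t₀ * d)) / 2 with hη
      have hη0 : 0 < η := by rw [hη]; linarith
      have hcont : ∀ᶠ t in 𝓝 t₀, Real.cos (t * d) < 1 - η ∧ |t| < |t₀| + 1 := by
        have c1 : Continuous fun t : ℝ => Real.cos (t * d) := by fun_prop
        refine (c1.continuousAt.eventually_lt_const (by rw [hη]; linarith)).and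
          (continuous_abs.continuousAt.eventually_lt_const (by linarith))
      refine ⟨{t | Real.cos (t * d) < 1 - η ∧ |t| < |t₀| + 1},
        mem_nhdsWithin_of_mem_nhds hcont, N, c * η / (|t₀| + 1) ^ 2, by positivity, ?_⟩
      rintro t ⟨ht1, ht2⟩ g M hg x
      have hM : 0 ≤ M := (norm_nonneg _).trans (hg x)
      refine (H t g M hg x).trans (mul_le_mul_of_nonneg_right ?_ hM)
      have h5 : c * η ≤ c * (1 - Real.cos (t * d)) := mul_le_mul_of_nonneg_left (by linarith) hc.le
      calc _ ≤ 1 - c * η := by linarith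
        _ ≤ _ := one_sub_le _
        _ ≤ _ := by
          refine Real.exp_le_exp.2 ?_
          have : t ^ 2 ≤ (|t₀| + 1) ^ 2 := by
            rw [← sq_abs t]; exact pow_le_pow_left₀ (abs_nonneg _) ht2.le 2
          have h6 : c * η / (|t₀| + 1) ^ 2 * t ^ 2 ≤ c * η := by
            rw [div_mul_eq_mul_div, div_le_iff₀ (by positivity)]
            exact mul_le_mul_of_nonneg_left this (by positivity)
          linarith

/-- F1. -/
lemma F1 {P : X → X → ℝ} {ν f : X → ℝ} (hG : Good P ν f) (K : ℝ) :
    ∃ C c : ℝ, 0 < C ∧ 0 < c ∧ ∀ t ∈ Set.Icc 0 K, ∀ (i : ℕ) (g : X → ℂ) (M : ℝ),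
      (∀ x, ‖g x‖ ≤ M) → ∀ x, ‖(PT P f t ^ i) g x‖ ≤ C * Real.exp (-c * i * t ^ 2) * M := by
  obtain ⟨N, c, hc, H⟩ := contr_cpt hG K
  have Hq : ∀ t ∈ Set.Icc 0 K, ∀ (q : ℕ) (g : X → ℂ) (M : ℝ), (∀ x, ‖g x‖ ≤ M) →
      ∀ x, ‖(PT P f t ^ (q * (N + 1))) g x‖ ≤ Real.exp (-c * q * t ^ 2) * M := by
    intro t ht q
    induction q with
    | zero => intro g M hg x; simpa using hg x
    | succ q ih =>
      intro g M hg x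
      have h1 : ∀ x, ‖(PT P f t ^ (N + 1)) g x‖ ≤ Real.exp (-c * t ^ 2) * M := by
        intro x; rw [PT_add]; exact H t ht _ M (fun x => PT_bound hG.st f t 1 hg x) x
      rw [Nat.succ_mul, PT_add]
      refine (ih _ _ h1 x).trans (le_of_eq ?_)
      rw [← mul_assoc, ← Real.exp_add]; push_cast; ring_nf
  refine ⟨Real.exp (c * K ^ 2), c / (N + 1), Real.exp_pos _, by positivity, ?_⟩
  intro t ht i g M hg x
  have hM : 0 ≤ M := (norm_nonneg _).trans (hg x)
  have h1 := Hq t ht (i / (N + 1)) _ M (fun x => PT_bound hG.st f t (i % (N + 1)) hg x) x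
  rw [← PT_add, mul_comm, Nat.div_add_mod] at h1
  refine h1.trans (mul_le_mul_of_nonneg_right ?_ hM)
  rw [← Real.exp_add]
  refine Real.exp_le_exp.2 ?_
  have h2 : (i : ℝ) / (N + 1) ≤ (i / (N + 1) : ℕ) + 1 := by
    rw [div_le_iff₀ (by positivity)]
    have := Nat.lt_div_mul_add (a := i) (b := N + 1) (by omega)
    have h3 : i ≤ (i / (N + 1) + 1) * (N + 1) := by rw [Nat.succ_mul]; exact this.le
    exact_mod_cast h3
  have h4 : t ^ 2 ≤ K ^ 2 := pow_le_pow_left₀ ht.1 ht.2 2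
  have h5 : c * ((i : ℝ) / (N + 1)) * t ^ 2 ≤ c * ((i / (N + 1) : ℕ) + 1) * t ^ 2 := by gcongr
  have h6 : c * t ^ 2 ≤ c * K ^ 2 := by gcongr
  have h7 : -(c / (N + 1)) * (i : ℝ) * t ^ 2 = -(c * ((i : ℝ) / (N + 1)) * t ^ 2) := by ring
  rw [h7]
  linarith

end PartB


section PartC
variable [Fintype X] [DecidableEq X] [Nonempty X]

/-- Average. -/
noncomputable def av (ν φ : X → ℝ) : ℝ := ∑ x, φ x * ν x

lemma av_abs {P : X → X → ℝ} {ν : X → ℝ} (hS : IsStochastic P ν) {φ : X → ℝ} {M : ℝ}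
    (h : ∀ x, |φ x| ≤ M) : |av ν φ| ≤ M := by
  unfold av
  calc _ ≤ ∑ x, |φ x * ν x| := Finset.abs_sum_le_sum_abs _ _
    _ ≤ ∑ x, M * ν x := Finset.sum_le_sum fun x _ => by
        rw [abs_mul, abs_of_pos (hS.nuPos x)]
        exact mul_le_mul_of_nonneg_right (h x) (hS.nuPos x).le
    _ = M := by rw [← Finset.mul_sum, hS.nuSum, mul_one]

lemma Pop_succ (P : X → X → ℝ) (φ : X → ℝ) (n : ℕ) (x : X) :
    (Pop P)^[n + 1] φ x = ∑ x', P x x' * (Pop P)^[n] φ x' := by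
  rw [Function.iterate_succ_apply']; rfl

lemma Pop_abs {P : X → X → ℝ} {ν : X → ℝ} (hS : IsStochastic P ν) {φ : X → ℝ} {M : ℝ}
    (h : ∀ x, |φ x| ≤ M) (n : ℕ) (x : X) : |(Pop P)^[n] φ x| ≤ M := by
  induction n generalizing x with
  | zero => exact h x
  | succ n ih =>
    rw [Pop_succ]
    calc _ ≤ ∑ x', |P x x' * (Pop P)^[n] φ x'| := Finset.abs_sum_le_sum_abs _ _
      _ ≤ ∑ x', P x x' * M := Finset.sum_le_sum fun x' _ => by
        rw [abs_mul, abs_of_nonneg (hS.nonneg _ _)]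
        exact mul_le_mul_of_nonneg_left (ih x') (hS.nonneg _ _)
      _ = M := by rw [← Finset.sum_mul, hS.rowSum, one_mul]

lemma Pop_kpow (P : X → X → ℝ) (φ : X → ℝ) (n : ℕ) (x : X) :
    (Pop P)^[n] φ x = ∑ x', kpow P n x x' * φ x' := by
  induction n generalizing x with
  | zero => simp [kpow]
  | succ n ih =>
    rw [Pop_succ]
    simp only [kpow, ih, Finset.sum_mul, Finset.mul_sum]
    rw [Finset.sum_comm]
    exact Finset.sum_congr rfl fun _ _ => Finset.sum_congr rfl fun _ _ => by ring

lemma kpow_sum {P : X → X → ℝ} {ν : X → ℝ} (hS : IsStochastic P ν) (n : ℕ) (x : X) :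
    ∑ x', kpow P n x x' = 1 := by
  have h := Pop_kpow P (fun _ => 1) n x
  simp only [mul_one] at h
  rw [← h]
  clear h
  induction n generalizing x with
  | zero => rfl
  | succ n ih => rw [Pop_succ]; simp only [ih, mul_one, hS.rowSum]

lemma Pop_av {P : X → X → ℝ} {ν : X → ℝ} (hS : IsStochastic P ν) (φ : X → ℝ) (n : ℕ) :
    av ν ((Pop P)^[n] φ) = av ν φ := by
  induction n with
  | zero => rfl
  | succ n ih =>
    rw [← ih]
    unfold av
    simp only [Pop_succ, Finset.sum_mul]
    rw [Finset.sum_comm]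
    refine Finset.sum_congr rfl fun x' _ => ?_
    rw [← hS.nuInv x', Finset.mul_sum]
    exact Finset.sum_congr rfl fun _ _ => by ring

lemma mix {P : X → X → ℝ} {ν f : X → ℝ} (hG : Good P ν f) :
    ∃ C ρ : ℝ, 0 < C ∧ 0 < ρ ∧ ρ < 1 ∧ ∀ (φ : X → ℝ) (M : ℝ), av ν φ = 0 → (∀ x, |φ x| ≤ M) →
      ∀ (n : ℕ) (x : X), |(Pop P)^[n] φ x| ≤ C * ρ ^ n * M := by
  obtain ⟨k, hk1, hk⟩ := hG.pr
  have hS := hG.st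
  obtain ⟨⟨x₀, x₁⟩, -, hmin⟩ := Finset.exists_min_image (univ : Finset (X × X))
    (fun p => kpow P k p.1 p.2) Finset.univ_nonempty
  set ε := kpow P k x₀ x₁ with hε
  have hε0 : 0 < ε := hk _ _
  have hν1 : ∀ x, ν x ≤ 1 := fun x => by
    rw [← hS.nuSum]
    exact Finset.single_le_sum (f := ν) (fun y _ => (hS.nuPos y).le) (Finset.mem_univ x)
  have hkε : ∀ x x', ε * ν x' ≤ kpow P k x x' := fun x x' => by
    have := hmin (x, x') (Finset.mem_univ _)
    nlinarith [hν1 x', hS.nuPos x']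
  have step : ∀ (φ : X → ℝ) (M : ℝ), av ν φ = 0 → (∀ x, |φ x| ≤ M) →
      ∀ x, |(Pop P)^[k] φ x| ≤ Real.exp (-ε) * M := by
    intro φ M h0 hM x
    have hM0 : 0 ≤ M := (abs_nonneg _).trans (hM x)
    have e : (Pop P)^[k] φ x = ∑ x', (kpow P k x x' - ε * ν x') * φ x' := by
      rw [Pop_kpow]
      have : ∑ x', ε * ν x' * φ x' = 0 := by
        have : ∑ x', ε * ν x' * φ x' = ε * av ν φ := by
          unfold av; rw [Finset.mul_sum]; exact Finset.sum_congr rfl fun _ _ => by ring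
        rw [this, h0, mul_zero]
      simp only [sub_mul, Finset.sum_sub_distrib, this, sub_zero]
    rw [e]
    calc _ ≤ ∑ x', |(kpow P k x x' - ε * ν x') * φ x'| := Finset.abs_sum_le_sum_abs _ _
      _ ≤ ∑ x', (kpow P k x x' - ε * ν x') * M := Finset.sum_le_sum fun x' _ => by
        rw [abs_mul, abs_of_nonneg (sub_nonneg.2 (hkε _ _))]
        exact mul_le_mul_of_nonneg_left (hM x') (sub_nonneg.2 (hkε _ _))
      _ = (1 - ε) * M := by
        rw [← Finset.sum_mul, Finset.sum_sub_distrib, kpow_sum hS, ← Finset.mul_sum, hS.nuSum,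
          mul_one]
      _ ≤ _ := by
        refine mul_le_mul_of_nonneg_right ?_ hM0
        have := Real.add_one_le_exp (-ε); linarith
  have stepq : ∀ (q : ℕ) (φ : X → ℝ) (M : ℝ), av ν φ = 0 → (∀ x, |φ x| ≤ M) →
      ∀ x, |(Pop P)^[q * k] φ x| ≤ Real.exp (-ε * q) * M := by
    intro q
    induction q with
    | zero => intro φ M h0 hM x; simpa using hM x
    | succ q ih =>
      intro φ M h0 hM x
      rw [Nat.succ_mul, Function.iterate_add_apply]
      refine (ih _ _ ((Pop_av hS φ k).trans h0) (step φ M h0 hM) x).trans (le_of_eq ?_)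
      rw [← mul_assoc, ← Real.exp_add]; push_cast; ring_nf
  have hk0 : (0 : ℝ) < k := by exact_mod_cast hk1
  refine ⟨Real.exp ε, Real.exp (-(ε / k)), Real.exp_pos _, Real.exp_pos _, ?_, ?_⟩
  · rw [Real.exp_lt_one_iff]; have : 0 < ε / k := by positivity
    linarith
  · intro φ M h0 hM n x
    have hM0 : 0 ≤ M := (abs_nonneg _).trans (hM x)
    have h1 := stepq (n / k) _ M ((Pop_av hS φ (n % k)).trans h0) (Pop_abs hS hM (n % k)) x
    rw [← Function.iterate_add_apply, mul_comm, Nat.div_add_mod] at h1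
    refine h1.trans (mul_le_mul_of_nonneg_right ?_ hM0)
    rw [← Real.exp_nat_mul, ← Real.exp_add]
    refine Real.exp_le_exp.2 ?_
    have h2 : (n : ℝ) / k ≤ (n / k : ℕ) + 1 := by
      rw [div_le_iff₀ hk0]
      have := Nat.lt_div_mul_add (a := n) (b := k) (by omega)
      have h3 : n ≤ (n / k + 1) * k := by rw [Nat.succ_mul]; exact this.le
      exact_mod_cast h3
    have h3 : ε * ((n : ℝ) / k) ≤ ε * ((n / k : ℕ) + 1) := by gcongr
    have h4 : (n : ℝ) * -(ε / k) = -(ε * (n / k)) := by ring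
    rw [h4]; linarith

/-- Resolvent at 1. -/
noncomputable def Rs (P : X → X → ℝ) (φ : X → ℝ) (x : X) : ℝ := ∑' n : ℕ, (Pop P)^[n] φ x

lemma exists_bd (φ : X → ℝ) : ∃ M, ∀ x, |φ x| ≤ M := by
  obtain ⟨x₀, -, h⟩ := Finset.exists_max_image (univ : Finset X) (fun x => |φ x|)
    Finset.univ_nonempty
  exact ⟨|φ x₀|, fun x => h x (Finset.mem_univ x)⟩

lemma Pop_summable {P : X → X → ℝ} {ν f : X → ℝ} (hG : Good P ν f) {φ : X → ℝ}
    (h0 : av ν φ = 0) (x : X) : Summable fun n : ℕ => (Pop P)^[n] φ x := by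
  obtain ⟨C, ρ, hC, hρ, hρ1, H⟩ := mix hG
  obtain ⟨M, hM⟩ := exists_bd φ
  refine Summable.of_norm_bounded (g := fun n => C * M * ρ ^ n)
    ((summable_geometric_of_lt_one hρ.le hρ1).mul_left _) fun n => ?_
  rw [Real.norm_eq_abs]
  exact (H φ M h0 hM n x).trans (le_of_eq (by ring))

lemma Rs_eq {P : X → X → ℝ} {ν f : X → ℝ} (hG : Good P ν f) {φ : X → ℝ}
    (h0 : av ν φ = 0) (x : X) : Rs P φ x = φ x + Pop P (Rs P φ) x ∧
      Pop P (Rs P φ) x = ∑' n : ℕ, (Pop P)^[n + 1] φ x := by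
  have h2 : Pop P (Rs P φ) x = ∑' n : ℕ, (Pop P)^[n + 1] φ x := by
    simp only [Pop_succ]
    rw [Summable.tsum_finsetSum fun x' _ => (Pop_summable hG h0 x').mul_left _]
    unfold Pop Rs
    exact Finset.sum_congr rfl fun x' _ => (tsum_mul_left).symm
  refine ⟨?_, h2⟩
  rw [h2]; unfold Rs
  rw [(Pop_summable hG h0 x).tsum_eq_zero_add]; rfl

/-- First corrector and second corrector. -/
lemma correctors {P : X → X → ℝ} {ν f : X → ℝ} (hG : Good P ν f) :
    ∃ r q : X → ℝ, (∀ x, r x = Pop P (fun x => f x + r x) x) ∧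
      (∀ x, q x + sigma2 P ν f / 2 = Pop P (fun x => f x ^ 2 / 2 + f x * r x + q x) x) ∧
      sigma2 P ν f = av ν (fun x => f x ^ 2) + 2 * av ν (fun x => f x * r x) := by
  have h0 : av ν f = 0 := hG.ce
  set r : X → ℝ := Pop P (Rs P f) with hr
  have hsig : sigma2 P ν f = av ν (fun x => f x ^ 2) + 2 * av ν (fun x => f x * r x) := by
    unfold sigma2
    congr 2
    unfold av
    rw [Summable.tsum_finsetSum fun x _ => ?_]
    · refine Finset.sum_congr rfl fun x _ => ?_
      rw [tsum_mul_right, tsum_mul_left, ← (Rs_eq hG h0 x).2]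
    · exact (((summable_nat_add_iff 1).2 (Pop_summable hG h0 x)).mul_left _).mul_right _
  set h : X → ℝ := fun x => f x ^ 2 / 2 + f x * r x - sigma2 P ν f / 2 with hh
  have hh0 : av ν h = 0 := by
    have : av ν h = av ν (fun x => f x ^ 2) / 2 + av ν (fun x => f x * r x)
        - sigma2 P ν f / 2 * ∑ x, ν x := by
      unfold av
      rw [Finset.sum_div, Finset.mul_sum, ← Finset.sum_add_distrib, ← Finset.sum_sub_distrib]
      exact Finset.sum_congr rfl fun x _ => by simp only [hh]; ring
    rw [this, hG.st.nuSum, hsig]; ring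
  refine ⟨r, Pop P (Rs P h), fun x => ?_, fun x => ?_, hsig⟩
  · have : (fun x => f x + r x) = Rs P f := by
      ext x; rw [(Rs_eq hG h0 x).1]
    rw [this]
  · have : (fun x => f x ^ 2 / 2 + f x * r x + Pop P (Rs P h) x) =
        fun x => Rs P h x + sigma2 P ν f / 2 := by
      ext x; rw [(Rs_eq hG hh0 x).1]; simp only [hh]; ring
    rw [this]
    unfold Pop
    simp only [mul_add, Finset.sum_add_distrib, ← Finset.sum_mul, hG.st.rowSum, one_mul]

lemma PT_close {P : X → X → ℝ} {ν : X → ℝ} (hS : IsStochastic P ν) {f : X → ℝ} {B : ℝ}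
    (hB : ∀ x, |f x| ≤ B) {t : ℝ} (ht : 0 ≤ t) {φ : X → ℝ} {M : ℝ} (hM : ∀ x, |φ x| ≤ M)
    (n : ℕ) (x : X) :
    ‖(PT P f t ^ n) (fun x => (φ x : ℂ)) x - ((Pop P)^[n] φ x : ℝ)‖ ≤ n * (t * B * M) := by
  induction n generalizing x with
  | zero => simp
  | succ n ih =>
    have e : (PT P f t ^ (n + 1)) (fun x => (φ x : ℂ)) x - ((Pop P)^[n + 1] φ x : ℝ) =
        ∑ x', (P x x' : ℂ) * (Complex.exp ((t * f x' : ℝ) * Complex.I) *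
          ((PT P f t ^ n) (fun x => (φ x : ℂ)) x' - ((Pop P)^[n] φ x' : ℝ)) +
          (Complex.exp ((t * f x' : ℝ) * Complex.I) - 1) * ((Pop P)^[n] φ x' : ℝ)) := by
      rw [PT_succ, Pop_succ]
      push_cast
      rw [← Finset.sum_sub_distrib]
      exact Finset.sum_congr rfl fun _ _ => by ring
    rw [e]
    calc _ ≤ ∑ x', P x x' * (n * (t * B * M) + t * B * M) := by
          refine (norm_sum_le _ _).trans (Finset.sum_le_sum fun x' _ => ?_)
          rw [norm_mul, Complex.norm_real, Real.norm_of_nonneg (hS.nonneg _ _)]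
          refine mul_le_mul_of_nonneg_left ((norm_add_le _ _).trans (add_le_add ?_ ?_))
            (hS.nonneg _ _)
          · rw [norm_mul, Complex.norm_exp_ofReal_mul_I, one_mul]; exact ih x'
          · rw [norm_mul, Complex.norm_real, Real.norm_eq_abs]
            refine mul_le_mul ?_ (Pop_abs hS hM n x') (abs_nonneg _) ?_
            · have := Real.norm_exp_I_mul_ofReal_sub_one_le (x := t * f x')
              rw [mul_comm] at this
              refine this.trans ?_
              rw [Real.norm_eq_abs, abs_mul, abs_of_nonneg ht]
              exact mul_le_mul_of_nonneg_left (hB x') ht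
            · exact mul_nonneg ht ((abs_nonneg _).trans (hB x'))
      _ = _ := by rw [← Finset.sum_mul, hS.rowSum]; push_cast; ring

end PartC


section PartD
variable [Fintype X] [DecidableEq X] [Nonempty X]

lemma exp_taylor3 (a : ℝ) : ‖Complex.exp ((a : ℝ) * Complex.I) - (1 + a * Complex.I - a ^ 2 / 2)‖ ≤
    |a| ^ 3 * Real.exp |a| := by
  have h := Complex.norm_exp_sub_sum_le_norm_mul_exp ((a : ℂ) * Complex.I) 3
  simp only [Finset.sum_range_succ, Finset.sum_range_zero, norm_mul, Complex.norm_I, mul_one,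
    Complex.norm_real, Real.norm_eq_abs] at h
  convert h using 3
  simp only [pow_zero, Nat.factorial, pow_one, mul_pow, Complex.I_sq]
  push_cast
  ring

lemma exp_taylor2 (a : ℝ) : |Real.exp a - (1 + a)| ≤ |a| ^ 2 * Real.exp |a| := by
  have h := Complex.norm_exp_sub_sum_le_norm_mul_exp (a : ℂ) 2
  simp only [Finset.sum_range_succ, Finset.sum_range_zero,
    Complex.norm_real, Real.norm_eq_abs] at h
  rw [← Real.norm_eq_abs, ← Complex.norm_real]
  convert h using 2
  simp [Nat.factorial]

/-- Approximate eigenvalue. -/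
noncomputable def mu (P : X → X → ℝ) (ν f : X → ℝ) (t : ℝ) : ℝ :=
  Real.exp (-(sigma2 P ν f * t ^ 2 / 2))

lemma eig {P : X → X → ℝ} {ν f : X → ℝ} (hG : Good P ν f) (K : ℝ) :
    ∃ (e : ℝ → X → ℂ) (C : ℝ), 0 < C ∧ ∀ t ∈ Set.Icc 0 K, ∀ x,
      ‖e t x - 1‖ ≤ C * t ∧ ‖PT P f t (e t) x - mu P ν f t * e t x‖ ≤ C * t ^ 3 := by
  by_cases hK : 0 ≤ K
  swap
  · refine ⟨fun _ _ => 1, 1, one_pos, fun t ht => ?_⟩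
    exact absurd (ht.1.trans ht.2) hK
  obtain ⟨r, q, hr, hq, -⟩ := correctors hG
  obtain ⟨B1, hB1⟩ := exists_bd f
  obtain ⟨B2, hB2⟩ := exists_bd r
  obtain ⟨B3, hB3⟩ := exists_bd q
  set σ2 := sigma2 P ν f with hσ2
  set B := max (max B1 B2) (max B3 (max |σ2| 1)) with hB
  have hf : ∀ x, |f x| ≤ B := fun x => (hB1 x).trans (by simp [hB])
  have hrB : ∀ x, |r x| ≤ B := fun x => (hB2 x).trans (by simp [hB])
  have hqB : ∀ x, |q x| ≤ B := fun x => (hB3 x).trans (by simp [hB])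
  have hσB : |σ2| ≤ B := by simp [hB]
  have hB0 : 1 ≤ B := by simp [hB]
  have hBp : 0 < B := by linarith
  set D := B + K * B with hD
  have hDp : 0 < D := by positivity
  set C1 := B ^ 3 * Real.exp (K * B) * (1 + D * K) + (B ^ 2 + B ^ 3 + K * B ^ 3) with hC1
  set C2 := B ^ 2 * K * Real.exp (B * K ^ 2) * (1 + D * K) + (B ^ 2 + K * B ^ 2) with hC2
  have hC1p : 0 < C1 := by positivity
  have hC2p : 0 < C2 := by positivity
  let e : ℝ → X → ℂ := fun t x => 1 + t * r x * Complex.I - t ^ 2 * q x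
  refine ⟨e, max D (C1 + C2), lt_max_of_lt_left hDp, fun t ht x => ?_⟩
  have ht0 := ht.1
  have he : ∀ x, ‖e t x - 1‖ ≤ D * t := by
    intro x
    have : e t x - 1 = (t * r x : ℝ) * Complex.I + (-(t ^ 2 * q x) : ℝ) := by
      simp only [e]; push_cast; ring
    rw [this]
    refine (norm_add_le _ _).trans ?_
    rw [norm_mul, Complex.norm_I, mul_one, Complex.norm_real, Complex.norm_real,
      Real.norm_eq_abs, Real.norm_eq_abs, abs_neg, abs_mul, abs_mul, abs_of_nonneg ht0,
      abs_of_nonneg (sq_nonneg t)]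
    have h1 := mul_le_mul_of_nonneg_left (hrB x) ht0
    have h2 : t ^ 2 * |q x| ≤ (t * K) * B := by
      refine mul_le_mul ?_ (hqB x) (abs_nonneg _) (by positivity)
      rw [pow_two]; exact mul_le_mul_of_nonneg_left ht.2 ht0
    rw [hD]; nlinarith
  have he1 : ∀ x, ‖e t x‖ ≤ 1 + D * K := by
    intro x
    have : e t x = 1 + (e t x - 1) := by ring
    rw [this]
    refine (norm_add_le _ _).trans ?_
    rw [norm_one]
    have := he x
    have h2 : D * t ≤ D * K := mul_le_mul_of_nonneg_left ht.2 hDp.le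
    linarith
  refine ⟨(he x).trans (mul_le_mul_of_nonneg_right (le_max_left _ _) ht0), ?_⟩
  -- remainders
  let E1 : X → ℂ := fun x' => Complex.exp ((t * f x' : ℝ) * Complex.I) -
    (1 + (t * f x' : ℝ) * Complex.I - (t * f x' : ℝ) ^ 2 / 2)
  let E2 : ℝ := mu P ν f t - (1 + -(σ2 * t ^ 2 / 2))
  have hE1 : ∀ x', ‖E1 x'‖ ≤ t ^ 3 * (B ^ 3 * Real.exp (K * B)) := by
    intro x'
    refine (exp_taylor3 (t * f x')).trans ?_
    have h1 : |t * f x'| ≤ t * B := by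
      rw [abs_mul, abs_of_nonneg ht0]; exact mul_le_mul_of_nonneg_left (hf x') ht0
    calc _ ≤ (t * B) ^ 3 * Real.exp (K * B) := by
          refine mul_le_mul (pow_le_pow_left₀ (abs_nonneg _) h1 3) (Real.exp_le_exp.2
            (h1.trans (mul_le_mul_of_nonneg_right ht.2 hBp.le))) (Real.exp_pos _).le (by positivity)
      _ = _ := by ring
  have hE2 : |E2| ≤ t ^ 3 * (B ^ 2 * K * Real.exp (B * K ^ 2)) := by
    refine (exp_taylor2 (-(σ2 * t ^ 2 / 2))).trans ?_
    have h1 : |-(σ2 * t ^ 2 / 2)| ≤ B * t ^ 2 := by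
      rw [abs_neg, abs_div, abs_mul, abs_of_nonneg (sq_nonneg t), abs_two]
      nlinarith [mul_le_mul_of_nonneg_right hσB (sq_nonneg t), mul_nonneg (abs_nonneg σ2)
        (sq_nonneg t)]
    calc _ ≤ (B * t ^ 2) ^ 2 * Real.exp (B * K ^ 2) := by
          refine mul_le_mul (pow_le_pow_left₀ (abs_nonneg _) h1 2) (Real.exp_le_exp.2
            (h1.trans (mul_le_mul_of_nonneg_left (pow_le_pow_left₀ ht0 ht.2 2) hBp.le)))
            (Real.exp_pos _).le (by positivity)
      _ = t ^ 3 * (B ^ 2 * t * Real.exp (B * K ^ 2)) := by ring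
      _ ≤ _ := by
          have := ht.2
          gcongr
  let Q1 : X → ℂ := fun x' => t ^ 3 * (((-(f x' * q x') - f x' ^ 2 * r x' / 2 : ℝ) : ℂ) * Complex.I
    + ((t * f x' ^ 2 * q x' / 2 : ℝ) : ℂ))
  let Q2 : ℂ := t ^ 3 * ((-(σ2 * r x / 2) : ℝ) * Complex.I + (t * σ2 * q x / 2 : ℝ))
  have ht3 : ‖((t : ℂ)) ^ 3‖ = t ^ 3 := by
    rw [norm_pow, Complex.norm_real, Real.norm_of_nonneg ht0]
  have hQ1 : ∀ x', ‖Q1 x'‖ ≤ t ^ 3 * (B ^ 2 + B ^ 3 + K * B ^ 3) := by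
    intro x'
    simp only [Q1]
    rw [norm_mul, ht3]
    refine mul_le_mul_of_nonneg_left ((norm_add_le _ _).trans ?_) (by positivity)
    rw [norm_mul, Complex.norm_I, mul_one, Complex.norm_real, Complex.norm_real,
      Real.norm_eq_abs, Real.norm_eq_abs]
    have a1 : |f x' * q x'| ≤ B * B := by
      rw [abs_mul]; exact mul_le_mul (hf x') (hqB x') (abs_nonneg _) hBp.le
    have a0 : |f x' ^ 2| ≤ B ^ 2 := by
      rw [abs_pow]; exact pow_le_pow_left₀ (abs_nonneg _) (hf x') 2
    have a2 : |f x' ^ 2 * r x' / 2| ≤ B ^ 2 * B := by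
      rw [abs_div, abs_mul, abs_two]
      have := mul_le_mul a0 (hrB x') (abs_nonneg _) (by positivity)
      have : 0 ≤ |f x' ^ 2| * |r x'| := by positivity
      linarith
    have a3 : |t * f x' ^ 2 * q x' / 2| ≤ K * (B ^ 2 * B) := by
      rw [abs_div, abs_mul, abs_mul, abs_two, abs_of_nonneg ht0, mul_assoc]
      have h1 := mul_le_mul a0 (hqB x') (abs_nonneg _) (by positivity)
      have h2 := mul_le_mul ht.2 h1 (by positivity) hK
      have : 0 ≤ t * (|f x' ^ 2| * |q x'|) := by positivity
      linarith
    have a4 := abs_sub (-(f x' * q x')) (f x' ^ 2 * r x' / 2)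
    rw [abs_neg] at a4
    nlinarith
  have hQ2 : ‖Q2‖ ≤ t ^ 3 * (B ^ 2 + K * B ^ 2) := by
    simp only [Q2]
    rw [norm_mul, ht3]
    refine mul_le_mul_of_nonneg_left ((norm_add_le _ _).trans ?_) (by positivity)
    rw [norm_mul, Complex.norm_I, mul_one, Complex.norm_real, Complex.norm_real,
      Real.norm_eq_abs, Real.norm_eq_abs, abs_neg]
    have a2 : |σ2 * r x / 2| ≤ B * B := by
      rw [abs_div, abs_mul, abs_two]
      have := mul_le_mul hσB (hrB x) (abs_nonneg _) (by positivity)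
      have : 0 ≤ |σ2| * |r x| := by positivity
      linarith
    have a3 : |t * σ2 * q x / 2| ≤ K * (B * B) := by
      rw [abs_div, abs_mul, abs_mul, abs_two, abs_of_nonneg ht0, mul_assoc]
      have h1 := mul_le_mul hσB (hqB x) (abs_nonneg _) (by positivity)
      have h2 := mul_le_mul ht.2 h1 (by positivity) hK
      have : 0 ≤ t * (|σ2| * |q x|) := by positivity
      linarith
    nlinarith
  have hr' : (r x : ℂ) = ∑ x', (P x x' : ℂ) * (f x' + r x') := by
    have := hr x; unfold Pop at this; rw [this]; push_cast; rfl
  have hq' : (q x : ℂ) + σ2 / 2 = ∑ x', (P x x' : ℂ) * (f x' ^ 2 / 2 + f x' * r x' + q x') := by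
    have := hq x; unfold Pop at this
    have h2 := congrArg (fun u : ℝ => (u : ℂ)) this
    push_cast at h2; exact h2
  have h1' : (1 : ℂ) = ∑ x', (P x x' : ℂ) := by
    have := hG.st.rowSum x
    rw [← Complex.ofReal_sum, this]; simp
  have key : PT P f t (e t) x - mu P ν f t * e t x =
      ∑ x', (P x x' : ℂ) * (E1 x' * e t x' + Q1 x') - (E2 * e t x + Q2) := by
    have s1 : PT P f t (e t) x = ∑ x', (P x x' : ℂ) * (E1 x' * e t x' + Q1 x') +
        ((∑ x', (P x x' : ℂ)) + t * Complex.I * (∑ x', (P x x' : ℂ) * (f x' + r x')) -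
        t ^ 2 * ∑ x', (P x x' : ℂ) * (f x' ^ 2 / 2 + f x' * r x' + q x')) := by
      rw [PT_apply, Finset.mul_sum, Finset.mul_sum, ← Finset.sum_add_distrib,
        ← Finset.sum_sub_distrib, ← Finset.sum_add_distrib]
      refine Finset.sum_congr rfl fun x' _ => ?_
      simp only [E1, Q1, e]
      push_cast
      ring_nf
      simp only [Complex.I_sq]
      ring
    have s2 : (mu P ν f t : ℂ) = E2 + (1 + -(σ2 * t ^ 2 / 2)) := by
      simp only [E2]; push_cast; ring
    rw [s1, ← h1', ← hr', ← hq', s2]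
    simp only [Q2, e]
    push_cast
    ring
  rw [key]
  have t1 : ‖∑ x', (P x x' : ℂ) * (E1 x' * e t x' + Q1 x')‖ ≤ t ^ 3 * C1 := by
    calc _ ≤ ∑ x', P x x' * (t ^ 3 * C1) := by
          refine (norm_sum_le _ _).trans (Finset.sum_le_sum fun x' _ => ?_)
          rw [norm_mul, Complex.norm_real, Real.norm_of_nonneg (hG.st.nonneg _ _)]
          refine mul_le_mul_of_nonneg_left ((norm_add_le _ _).trans ?_) (hG.st.nonneg _ _)
          have : ‖E1 x' * e t x'‖ ≤ t ^ 3 * (B ^ 3 * Real.exp (K * B)) * (1 + D * K) := by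
            rw [norm_mul]; exact mul_le_mul (hE1 x') (he1 x') (norm_nonneg _) (by positivity)
          calc _ ≤ _ := add_le_add this (hQ1 x')
            _ = _ := by rw [hC1]; ring
      _ = _ := by rw [← Finset.sum_mul, hG.st.rowSum, one_mul]
  have t2 : ‖(E2 : ℂ) * e t x + Q2‖ ≤ t ^ 3 * C2 := by
    have : ‖(E2 : ℂ) * e t x‖ ≤ t ^ 3 * (B ^ 2 * K * Real.exp (B * K ^ 2)) * (1 + D * K) := by
      rw [norm_mul, Complex.norm_real, Real.norm_eq_abs]
      exact mul_le_mul hE2 (he1 x) (norm_nonneg _) (by positivity)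
    calc _ ≤ _ := (norm_add_le _ _).trans (add_le_add this hQ2)
      _ = _ := by rw [hC2]; ring
  calc _ ≤ t ^ 3 * C1 + t ^ 3 * C2 := (norm_sub_le _ _).trans (add_le_add t1 t2)
    _ = (C1 + C2) * t ^ 3 := by ring
    _ ≤ _ := mul_le_mul_of_nonneg_right (le_max_right _ _) (by positivity)

/-- Telescoping. -/
lemma PT_tele (P : X → X → ℝ) (f : X → ℝ) (t : ℝ) (μ : ℂ) (e : X → ℂ) (i : ℕ) (x : X) :
    (PT P f t ^ i) e x = μ ^ i * e x +
      ∑ j ∈ range i, μ ^ j * (PT P f t ^ (i - 1 - j)) (fun x => PT P f t e x - μ * e x) x := by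
  induction i with
  | zero => simp
  | succ i ih =>
    have h1 : (PT P f t ^ (i + 1)) e x =
        (PT P f t ^ i) (fun x => PT P f t e x - μ * e x) x + μ * (PT P f t ^ i) e x := by
      rw [pow_succ, Module.End.mul_apply]
      have : PT P f t e = (fun x => PT P f t e x - μ * e x) + μ • e := by
        ext x; simp
      conv_lhs => rw [this, map_add, map_smul]
      simp
    rw [h1, ih, Finset.sum_range_succ']
    simp only [add_tsub_cancel_right, tsub_zero, pow_zero, one_mul, mul_add, Finset.mul_sum]
    have : ∀ j ∈ range i, μ ^ (j + 1) * (PT P f t ^ (i - (j + 1)))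
        (fun x => PT P f t e x - μ * e x) x =
        μ * (μ ^ j * (PT P f t ^ (i - 1 - j)) (fun x => PT P f t e x - μ * e x) x) := by
      intro j _
      rw [show i - (j + 1) = i - 1 - j by omega]; ring
    rw [Finset.sum_congr rfl this]; ring

lemma sigma_pos {P : X → X → ℝ} {ν f : X → ℝ} (hG : Good P ν f) : 0 < sigma2 P ν f := by
  by_contra hneg
  push Not at hneg
  obtain ⟨e, C, hC, He⟩ := eig hG 1
  obtain ⟨C', c, hC', hc, H1⟩ := F1 hG 1
  let x : X := Classical.arbitrary X
  have main : ∀ t ∈ Set.Icc (0 : ℝ) 1, ∀ i : ℕ, 1 - C * t ≤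
      C' * Real.exp (-c * i * t ^ 2) * (1 + C) + i * (C * t ^ 3) := by
    intro t ht i
    have hμ : 1 ≤ mu P ν f t := by
      unfold mu; rw [Real.one_le_exp_iff]
      have : sigma2 P ν f * t ^ 2 ≤ 0 := mul_nonpos_of_nonpos_of_nonneg hneg (sq_nonneg t)
      linarith
    set μ := mu P ν f t
    have hT := PT_tele P f t μ (e t) i x
    have hen : ∀ x, ‖e t x‖ ≤ 1 + C := fun x => by
      have : e t x = 1 + (e t x - 1) := by ring
      rw [this]
      refine (norm_add_le _ _).trans ?_
      rw [norm_one]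
      have := (He t ht x).1
      have h2 : C * t ≤ C * 1 := mul_le_mul_of_nonneg_left ht.2 hC.le
      linarith
    have hb1 := H1 t ht i (e t) (1 + C) hen x
    have hb2 : ‖∑ j ∈ range i, (μ : ℂ) ^ j * (PT P f t ^ (i - 1 - j))
        (fun x => PT P f t (e t) x - μ * e t x) x‖ ≤ μ ^ i * (i * (C * t ^ 3)) := by
      calc _ ≤ ∑ j ∈ range i, μ ^ i * (C * t ^ 3) := by
            refine (norm_sum_le _ _).trans (Finset.sum_le_sum fun j hj => ?_)
            rw [norm_mul, norm_pow, Complex.norm_real, Real.norm_of_nonneg (by linarith)]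
            refine mul_le_mul (pow_le_pow_right₀ hμ (Finset.mem_range.1 hj).le) ?_ (norm_nonneg _)
              (by positivity)
            exact PT_bound hG.st f t _ (fun x => (He t ht x).2) x
        _ = _ := by rw [Finset.sum_const, Finset.card_range, nsmul_eq_mul]; ring
    have hb3 : μ ^ i * (1 - C * t) ≤ ‖(μ : ℂ) ^ i * e t x‖ := by
      rw [norm_mul, norm_pow, Complex.norm_real, Real.norm_of_nonneg (by linarith)]
      refine mul_le_mul_of_nonneg_left ?_ (by positivity)
      have h1 := (He t ht x).1
      have h2 := norm_sub_norm_le (1 : ℂ) (1 - e t x)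
      rw [norm_one, sub_sub_cancel, norm_sub_rev] at h2
      linarith
    have hb4 : ‖(μ : ℂ) ^ i * e t x‖ ≤ C' * Real.exp (-c * i * t ^ 2) * (1 + C) +
        μ ^ i * (i * (C * t ^ 3)) := by
      have : (μ : ℂ) ^ i * e t x = (PT P f t ^ i) (e t) x - ∑ j ∈ range i, (μ : ℂ) ^ j *
        (PT P f t ^ (i - 1 - j)) (fun x => PT P f t (e t) x - μ * e t x) x := by rw [hT]; ring
      rw [this]
      exact (norm_sub_le _ _).trans (add_le_add hb1 hb2)
    have hp : 1 ≤ μ ^ i := one_le_pow₀ hμ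
    have hq : 0 ≤ C' * Real.exp (-c * i * t ^ 2) * (1 + C) := by positivity
    by_contra hcon
    push Not at hcon
    nlinarith
  have lim : ∀ B : ℝ, 0 ≤ B → 1 ≤ C' * Real.exp (-c * B ^ 2) * (1 + C) := by
    intro B hB
    have h1 : Tendsto (fun n : ℕ => 1 - C * (B / n)) atTop (𝓝 (1 - C * 0)) :=
      ((tendsto_const_div_atTop_nhds_zero_nat B).const_mul C).const_sub 1
    have h2 : Tendsto (fun n : ℕ => C' * Real.exp (-c * B ^ 2) * (1 + C) + C * B ^ 3 / n) atTop
        (𝓝 (C' * Real.exp (-c * B ^ 2) * (1 + C) + 0)) :=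
      (tendsto_const_div_atTop_nhds_zero_nat (C * B ^ 3)).const_add _
    rw [mul_zero, sub_zero] at h1
    rw [add_zero] at h2
    refine le_of_tendsto_of_tendsto h1 h2 ?_
    filter_upwards [eventually_ge_atTop (Nat.ceil B + 1)] with n hn
    have hn0 : (0 : ℝ) < n := by exact_mod_cast (by omega : 0 < n)
    have hnB : B ≤ n := (Nat.le_ceil B).trans (by exact_mod_cast (by omega : ⌈B⌉₊ ≤ n))
    have := main (B / n) ⟨by positivity, (div_le_one hn0).2 hnB⟩ (n ^ 2)
    refine this.trans (le_of_eq ?_)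
    push_cast
    congr 1
    · congr 3; field_simp
    · field_simp
  have h3 : Tendsto (fun B : ℝ => C' * Real.exp (-c * B ^ 2) * (1 + C)) atTop
      (𝓝 (C' * 0 * (1 + C))) := by
    refine ((Real.tendsto_exp_atBot.comp ?_).const_mul C').mul_const _
    have := (tendsto_pow_atTop (α := ℝ) (n := 2) (by norm_num)).const_mul_atTop hc
    have := tendsto_neg_atTop_atBot.comp this
    refine this.congr fun B => by simp
  have := ge_of_tendsto h3 ((eventually_ge_atTop 0).mono fun B hB => lim B hB)
  norm_num at this

end PartD


section PartD2
variable [Fintype X] [DecidableEq X] [Nonempty X]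

lemma PT_one {P : X → X → ℝ} {ν f : X → ℝ} (hG : Good P ν f) (K : ℝ) :
    ∃ C c : ℝ, 0 < C ∧ 0 < c ∧ ∀ t ∈ Set.Icc 0 K, ∀ (i : ℕ) (x : X),
      ‖(PT P f t ^ i) (fun _ => 1) x - (mu P ν f t : ℂ) ^ i‖ ≤ C * t * Real.exp (-c * i * t ^ 2) := by
  obtain ⟨e, C, hC, He⟩ := eig hG K
  obtain ⟨C', c, hC', hc, H1⟩ := F1 hG K
  have hσ := sigma_pos hG
  set σ2 := sigma2 P ν f with hσ2
  set c₀ := min c (σ2 / 2) with hc₀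
  have hc₀p : 0 < c₀ := lt_min hc (by positivity)
  refine ⟨C' * C + C + C' * C * Real.exp (c₀ * K ^ 2) * (2 / c₀), c₀ / 2, by positivity,
    by positivity, fun t ht i x => ?_⟩
  have ht0 := ht.1
  have exp_le : ∀ a : ℝ, c₀ ≤ a → ∀ j : ℕ, Real.exp (-a * j * t ^ 2) ≤
      Real.exp (-c₀ * j * t ^ 2) := by
    intro a ha j
    refine Real.exp_le_exp.2 ?_
    have : c₀ * ((j : ℝ) * t ^ 2) ≤ a * (j * t ^ 2) := mul_le_mul_of_nonneg_right ha (by positivity)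
    linarith
  have half : Real.exp (-c₀ * i * t ^ 2) ≤ Real.exp (-(c₀ / 2) * i * t ^ 2) := by
    refine Real.exp_le_exp.2 ?_
    have : 0 ≤ c₀ * ((i : ℝ) * t ^ 2) := by positivity
    linarith
  set μ := mu P ν f t with hμ
  have hμ0 : 0 < μ := Real.exp_pos _
  have hμj : ∀ j : ℕ, μ ^ j ≤ Real.exp (-c₀ * j * t ^ 2) := by
    intro j
    have : μ ^ j = Real.exp (-(σ2 / 2) * j * t ^ 2) := by
      rw [hμ]; unfold mu; rw [← Real.exp_nat_mul]; congr 1; ring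
    rw [this]; exact exp_le _ (min_le_right _ _) j
  have b1 : ‖(PT P f t ^ i) (fun x => 1 - e t x) x‖ ≤ C' * Real.exp (-c₀ * i * t ^ 2) * (C * t) := by
    have := H1 t ht i (fun x => 1 - e t x) (C * t)
      (fun x => by rw [norm_sub_rev]; exact (He t ht x).1) x
    refine this.trans ?_
    have h2 := exp_le c (min_le_left _ _) i
    gcongr
  have b2 : ‖(μ : ℂ) ^ i * (e t x - 1)‖ ≤ Real.exp (-c₀ * i * t ^ 2) * (C * t) := by
    rw [norm_mul, norm_pow, Complex.norm_real, Real.norm_of_nonneg hμ0.le]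
    exact mul_le_mul (hμj i) (He t ht x).1 (norm_nonneg _) (Real.exp_pos _).le
  have b3 : ‖∑ j ∈ range i, (μ : ℂ) ^ j * (PT P f t ^ (i - 1 - j))
        (fun x => PT P f t (e t) x - μ * e t x) x‖ ≤
        C' * C * Real.exp (c₀ * K ^ 2) * (2 / c₀) * t * Real.exp (-(c₀ / 2) * i * t ^ 2) := by
    calc _ ≤ ∑ j ∈ range i, (C' * C * Real.exp (c₀ * K ^ 2) * t ^ 3 *
              Real.exp (-c₀ * i * t ^ 2)) := by
          refine (norm_sum_le _ _).trans (Finset.sum_le_sum fun j hj => ?_)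
          rw [norm_mul, norm_pow, Complex.norm_real, Real.norm_of_nonneg hμ0.le]
          have h1 := H1 t ht (i - 1 - j) _ (C * t ^ 3) (fun x => (He t ht x).2) x
          have h2 := exp_le c (min_le_left _ _) (i - 1 - j)
          have h3 : ‖(PT P f t ^ (i - 1 - j)) (fun x => PT P f t (e t) x - μ * e t x) x‖ ≤
              C' * Real.exp (-c₀ * (i - 1 - j : ℕ) * t ^ 2) * (C * t ^ 3) := by
            refine h1.trans ?_
            gcongr
          calc _ ≤ Real.exp (-c₀ * j * t ^ 2) *
                (C' * Real.exp (-c₀ * (i - 1 - j : ℕ) * t ^ 2) * (C * t ^ 3)) :=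
              mul_le_mul (hμj j) h3 (norm_nonneg _) (Real.exp_pos _).le
            _ = C' * C * t ^ 3 * (Real.exp (-c₀ * j * t ^ 2) *
                  Real.exp (-c₀ * (i - 1 - j : ℕ) * t ^ 2)) := by ring
            _ ≤ C' * C * t ^ 3 * (Real.exp (c₀ * K ^ 2) * Real.exp (-c₀ * i * t ^ 2)) := by
              refine mul_le_mul_of_nonneg_left ?_ (by positivity)
              rw [← Real.exp_add, ← Real.exp_add]
              refine Real.exp_le_exp.2 ?_
              have hj' := Finset.mem_range.1 hj
              have : ((i - 1 - j : ℕ) : ℝ) = i - 1 - j := by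
                rw [Nat.sub_sub, Nat.cast_sub (by omega)]; push_cast; ring
              rw [this]
              have h4 : t ^ 2 ≤ K ^ 2 := pow_le_pow_left₀ ht.1 ht.2 2
              nlinarith
            _ = _ := by ring
      _ = C' * C * Real.exp (c₀ * K ^ 2) * t * ((i * t ^ 2) * Real.exp (-c₀ * i * t ^ 2)) := by
          rw [Finset.sum_const, Finset.card_range, nsmul_eq_mul]; ring
      _ ≤ C' * C * Real.exp (c₀ * K ^ 2) * t *
            ((2 / c₀) * Real.exp (-(c₀ / 2) * i * t ^ 2)) := by
          refine mul_le_mul_of_nonneg_left ?_ (by positivity)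
          have h1 : c₀ / 2 * (i * t ^ 2) ≤ Real.exp (c₀ / 2 * (i * t ^ 2)) := by
            have := Real.add_one_le_exp (c₀ / 2 * (i * t ^ 2)); linarith
          have h2 : Real.exp (-c₀ * i * t ^ 2) = Real.exp (-(c₀ / 2) * i * t ^ 2) /
              Real.exp (c₀ / 2 * (i * t ^ 2)) := by
            rw [← Real.exp_sub]; congr 1; ring
          rw [h2, ← mul_div_assoc, div_le_iff₀ (Real.exp_pos _)]
          have h4 := mul_le_mul_of_nonneg_left h1 (show 0 ≤ 2 / c₀ *
            Real.exp (-(c₀ / 2) * i * t ^ 2) by positivity)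
          refine le_trans (le_of_eq ?_) h4
          field_simp
      _ = _ := by ring
  have key : (PT P f t ^ i) (fun _ => 1) x - (μ : ℂ) ^ i =
      (PT P f t ^ i) (fun x => 1 - e t x) x + (μ : ℂ) ^ i * (e t x - 1) +
      ∑ j ∈ range i, (μ : ℂ) ^ j * (PT P f t ^ (i - 1 - j))
        (fun x => PT P f t (e t) x - μ * e t x) x := by
    have h1 : (fun _ : X => (1 : ℂ)) = (fun x => 1 - e t x) + e t := by ext x; simp
    have h2 := PT_tele P f t μ (e t) i x
    rw [h1, map_add, Pi.add_apply, h2]; ring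
  rw [key]
  refine norm_add₃_le.trans ?_
  have := add_le_add (add_le_add b1 b2) b3
  refine this.trans ?_
  have h5 : C' * Real.exp (-c₀ * i * t ^ 2) * (C * t) + Real.exp (-c₀ * i * t ^ 2) * (C * t) ≤
      (C' * C + C) * t * Real.exp (-(c₀ / 2) * i * t ^ 2) := by
    have := mul_le_mul_of_nonneg_left half (show 0 ≤ (C' * C + C) * t by positivity)
    linarith
  linarith

lemma PT_ofReal_decomp {P : X → X → ℝ} {ν f : X → ℝ} (t : ℝ) (i l : ℕ) (φ : X → ℝ) (x : X) :
    (PT P f t ^ (i + l)) (fun x => (φ x : ℂ)) x =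
      (av ν φ : ℂ) * (PT P f t ^ i) (fun _ => 1) x +
      (PT P f t ^ i) (fun x => (((Pop P)^[l] φ x - av ν φ : ℝ) : ℂ)) x +
      (PT P f t ^ i) (fun x => (PT P f t ^ l) (fun x => (φ x : ℂ)) x - ((Pop P)^[l] φ x : ℝ)) x := by
  rw [PT_add]
  have : (PT P f t ^ l) (fun x => (φ x : ℂ)) = (av ν φ : ℂ) • (fun _ : X => (1 : ℂ)) +
      (fun x => (((Pop P)^[l] φ x - av ν φ : ℝ) : ℂ)) +
      (fun x => (PT P f t ^ l) (fun x => (φ x : ℂ)) x - ((Pop P)^[l] φ x : ℝ)) := by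
    ext x; simp
  conv_lhs => rw [this, map_add, map_add, map_smul]
  simp

lemma av_sub_const {P : X → X → ℝ} {ν : X → ℝ} (hS : IsStochastic P ν) (φ : X → ℝ) :
    av ν (fun x => φ x - av ν φ) = 0 := by
  have : av ν (fun x => φ x - av ν φ) = av ν φ - av ν φ * ∑ x, ν x := by
    conv_lhs => unfold av
    simp only [sub_mul, Finset.sum_sub_distrib, Finset.mul_sum]
    rfl
  rw [this, hS.nuSum]; ring

lemma Pop_sub_const {P : X → X → ℝ} {ν : X → ℝ} (hS : IsStochastic P ν) (φ : X → ℝ) (a : ℝ)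
    (l : ℕ) (x : X) : (Pop P)^[l] (fun x => φ x - a) x = (Pop P)^[l] φ x - a := by
  induction l generalizing x with
  | zero => rfl
  | succ l ih =>
    rw [Pop_succ, Pop_succ]
    simp only [ih, mul_sub, Finset.sum_sub_distrib, ← Finset.sum_mul, hS.rowSum, one_mul]

lemma mix' {P : X → X → ℝ} {ν f : X → ℝ} (hG : Good P ν f) {ε : ℝ} (hε : 0 < ε) :
    ∃ l : ℕ, 1 ≤ l ∧ ∀ (φ : X → ℝ) (M : ℝ), (∀ x, |φ x| ≤ M) →
      ∀ (x : X), |(Pop P)^[l] φ x - av ν φ| ≤ ε * M := by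
  obtain ⟨C, ρ, hC, hρ, hρ1, H⟩ := mix hG
  have h1 : Tendsto (fun n : ℕ => C * ρ ^ n * 2) atTop (𝓝 (C * 0 * 2)) :=
    ((tendsto_pow_atTop_nhds_zero_of_lt_one hρ.le hρ1).const_mul C).mul_const 2
  have h2 := (h1.eventually_lt_const (u := ε) (by simpa using hε)).and (eventually_ge_atTop 1)
  obtain ⟨l, hl, hl1⟩ := h2.exists
  refine ⟨l, hl1, fun φ M hM x => ?_⟩
  have hM0 : 0 ≤ M := (abs_nonneg _).trans (hM x)
  have h3 := H (fun x => φ x - av ν φ) (2 * M) (av_sub_const hG.st φ) (fun x => by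
    have := abs_sub (φ x) (av ν φ)
    linarith [hM x, av_abs hG.st hM]) l x
  rw [Pop_sub_const hG.st] at h3
  refine h3.trans ?_
  nlinarith

/-- F2. -/
lemma F2 {P : X → X → ℝ} {ν f : X → ℝ} (hG : Good P ν f) (K : ℝ) :
    ∃ C c : ℝ, 0 < C ∧ 0 < c ∧ ∀ t ∈ Set.Icc 0 K, ∀ (i : ℕ) (φ : X → ℝ) (M : ℝ),
      (∀ x, |φ x| ≤ M) → ∀ x,
      |((PT P f t ^ i) (fun x => (φ x : ℂ)) x).im| ≤ C * t * Real.exp (-c * i * t ^ 2) * M := by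
  obtain ⟨C1, c1, hC1, hc1, H1⟩ := PT_one hG K
  obtain ⟨C2, c2, hC2, hc2, H2⟩ := F1 hG K
  obtain ⟨l, hl1, hl⟩ := mix' hG (ε := 1 / 2) (by norm_num)
  obtain ⟨B0, hB0⟩ := exists_bd f
  set B := max B0 1
  have hB : ∀ x, |f x| ≤ B := fun x => (hB0 x).trans (le_max_left _ _)
  have hBp : 0 < B := lt_max_of_lt_right one_pos
  have hl0 : (0 : ℝ) < l := by exact_mod_cast hl1
  set c := min (min c1 c2) (1 / (4 * l * (K ^ 2 + 1))) with hc
  have hcp : 0 < c := lt_min (lt_min hc1 hc2) (by positivity)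
  set A := 4 * (C1 + C2 * (l * B) + l * B) with hA
  have hAp : 0 < A := by positivity
  have hlt : ∀ t ∈ Set.Icc 0 K, 3 / 4 ≤ Real.exp (-c * l * t ^ 2) := by
    intro t ht
    have h4 : t ^ 2 ≤ K ^ 2 := pow_le_pow_left₀ ht.1 ht.2 2
    have h5 : c * l * t ^ 2 ≤ 1 / 4 := by
      calc c * l * t ^ 2 ≤ (1 / (4 * l * (K ^ 2 + 1))) * l * (K ^ 2 + 1) := by
            gcongr
            · exact min_le_right _ _
            · linarith
        _ = 1 / 4 := by field_simp
    have := Real.add_one_le_exp (-c * l * t ^ 2)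
    linarith
  refine ⟨A, c, hAp, hcp, fun t ht i => ?_⟩
  have ht0 := ht.1
  induction i using Nat.strong_induction_on with
  | _ i ih =>
  intro φ M hM x
  have hM0 : 0 ≤ M := (abs_nonneg _).trans (hM x)
  by_cases hil : i < l
  · have h1 := PT_close hG.st hB ht0 hM i x
    have h2 : |((PT P f t ^ i) (fun x => (φ x : ℂ)) x).im| ≤ i * (t * B * M) := by
      refine le_trans ?_ h1
      have := Complex.abs_im_le_norm ((PT P f t ^ i) (fun x => (φ x : ℂ)) x -
        ((Pop P)^[i] φ x : ℝ))
      simpa using this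
    have h3 : 3 / 4 ≤ Real.exp (-c * i * t ^ 2) := by
      refine (hlt t ht).trans (Real.exp_le_exp.2 ?_)
      have : (i : ℝ) ≤ l := by exact_mod_cast hil.le
      have := mul_le_mul_of_nonneg_left this (show 0 ≤ c * t ^ 2 by positivity)
      linarith
    have h4 : (i : ℝ) * (t * B * M) ≤ l * (t * B * M) := by
      have : (i : ℝ) ≤ l := by exact_mod_cast hil.le
      gcongr
    calc _ ≤ _ := h2
      _ ≤ _ := h4
      _ ≤ A * t * (3 / 4) * M := by
        have : 0 ≤ t * M := by positivity
        have h6 : l * B ≤ A * (3 / 4) := by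
          rw [hA]
          have : 0 ≤ C1 + C2 * (l * B) := by positivity
          have : 0 ≤ l * B := by positivity
          linarith
        nlinarith
      _ ≤ _ := by gcongr
  · push Not at hil
    obtain ⟨k, rfl⟩ : ∃ k, i = k + l := ⟨i - l, by omega⟩
    have ihk := ih k (by omega) (fun x => (Pop P)^[l] φ x - av ν φ) (1 / 2 * M) (hl φ M hM) x
    rw [PT_ofReal_decomp (ν := ν), Complex.add_im, Complex.add_im]
    have ekc : ∀ a : ℝ, c ≤ a → Real.exp (-a * k * t ^ 2) ≤ Real.exp (-c * k * t ^ 2) := by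
      intro a ha
      refine Real.exp_le_exp.2 ?_
      have : c * ((k : ℝ) * t ^ 2) ≤ a * (k * t ^ 2) :=
        mul_le_mul_of_nonneg_right ha (by positivity)
      linarith
    have b1 : |((av ν φ : ℂ) * (PT P f t ^ k) (fun _ => 1) x).im| ≤
        M * (C1 * t * Real.exp (-c * k * t ^ 2)) := by
      rw [Complex.im_ofReal_mul, abs_mul]
      refine mul_le_mul (av_abs hG.st hM) ?_ (abs_nonneg _) hM0
      have h1 : ((PT P f t ^ k) (fun _ => 1) x).im =
          ((PT P f t ^ k) (fun _ => 1) x - (mu P ν f t : ℂ) ^ k).im := by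
        rw [Complex.sub_im, ← Complex.ofReal_pow, Complex.ofReal_im, sub_zero]
      rw [h1]
      refine (Complex.abs_im_le_norm _).trans ((H1 t ht k x).trans ?_)
      have := ekc c1 ((min_le_left _ _).trans (min_le_left _ _))
      gcongr
    have b3 : |((PT P f t ^ k) (fun x => (PT P f t ^ l) (fun x => (φ x : ℂ)) x -
        ((Pop P)^[l] φ x : ℝ)) x).im| ≤ C2 * Real.exp (-c * k * t ^ 2) * (l * (t * B * M)) := by
      refine (Complex.abs_im_le_norm _).trans ((H2 t ht k _ _
        (fun x => PT_close hG.st hB ht0 hM l x) x).trans ?_)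
      have := ekc c2 ((min_le_left _ _).trans (min_le_right _ _))
      gcongr
    set E := Real.exp (-c * k * t ^ 2) with hE
    have hEp : 0 < E := Real.exp_pos _
    have e1 : Real.exp (-c * (k + l : ℕ) * t ^ 2) = E * Real.exp (-c * l * t ^ 2) := by
      rw [hE, ← Real.exp_add]; push_cast; ring_nf
    rw [e1]
    have htot := (abs_add_three (((av ν φ : ℂ) * (PT P f t ^ k) (fun _ => 1) x).im) _ _).trans
      (add_le_add (add_le_add b1 ihk) b3)
    refine htot.trans ?_
    have h3 := hlt t ht
    calc _ = (C1 + C2 * (l * B) + A / 2) * (t * E * M) := by ring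
      _ ≤ (A * (3 / 4)) * (t * E * M) := by
        refine mul_le_mul_of_nonneg_right ?_ (by positivity)
        have : 0 ≤ l * B := by positivity
        rw [hA]; linarith
      _ = A * t * (E * (3 / 4)) * M := by ring
      _ ≤ _ := by gcongr

/-- F3. -/
lemma F3 {P : X → X → ℝ} {ν f : X → ℝ} (hG : Good P ν f) {k : ℕ → ℕ} {t : ℕ → ℝ} {θ : ℝ}
    (hk : Tendsto k atTop atTop) (ht0 : ∀ n, 0 ≤ t n) (ht : Tendsto t atTop (𝓝 0))
    (hkt : Tendsto (fun n => k n * t n ^ 2) atTop (𝓝 θ)) {φ : ℕ → X → ℝ} {φ' : X → ℝ}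
    (hφ : ∀ x, Tendsto (fun n => φ n x) atTop (𝓝 (φ' x))) (x : X) :
    Tendsto (fun n => (PT P f (t n) ^ k n) (fun x => (φ n x : ℂ)) x) atTop
      (𝓝 (av ν φ' * Real.exp (-(sigma2 P ν f * θ / 2)) : ℝ)) := by
  obtain ⟨C1, c1, hC1, hc1, H1⟩ := PT_one hG 1
  obtain ⟨B, hB⟩ := exists_bd f
  obtain ⟨M, hM⟩ := exists_bd φ'
  have hM0 : 0 ≤ M := (abs_nonneg _).trans (hM x)
  -- reduce to constant φ
  have red : Tendsto (fun n => (PT P f (t n) ^ k n) (fun x => ((φ n x - φ' x : ℝ) : ℂ)) x) atTop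
      (𝓝 0) := by
    have hs : Tendsto (fun n => ∑ x, |φ n x - φ' x|) atTop (𝓝 (∑ x : X, 0)) := by
      refine tendsto_finsetSum _ fun x _ => ?_
      have := ((hφ x).sub_const (φ' x)).abs
      simpa using this
    rw [Finset.sum_const_zero] at hs
    refine squeeze_zero_norm (fun n => PT_bound hG.st f (t n) (k n) (fun x => ?_) x) hs
    rw [Complex.norm_real, Real.norm_eq_abs]
    exact Finset.single_le_sum (f := fun x => |φ n x - φ' x|) (fun _ _ => abs_nonneg _)
      (Finset.mem_univ x)
  have main : Tendsto (fun n => (PT P f (t n) ^ k n) (fun x => (φ' x : ℂ)) x) atTop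
      (𝓝 (av ν φ' * Real.exp (-(sigma2 P ν f * θ / 2)) : ℝ)) := by
    rw [Metric.tendsto_atTop']
    intro ε hε
    obtain ⟨l, hl1, hl⟩ := mix' hG (ε := ε / (2 * (M + 1))) (by positivity)
    have hμ : Tendsto (fun n => mu P ν f (t n) ^ (k n - l)) atTop
        (𝓝 (Real.exp (-(sigma2 P ν f * θ / 2)))) := by
      have e : ∀ᶠ n in atTop, Real.exp (-(sigma2 P ν f * (k n * t n ^ 2 - l * t n ^ 2) / 2)) =
          mu P ν f (t n) ^ (k n - l) := by
        filter_upwards [hk.eventually_ge_atTop l] with n hn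
        unfold mu
        rw [← Real.exp_nat_mul, Nat.cast_sub hn]; congr 1; ring
      refine Tendsto.congr' e ?_
      refine (Real.continuous_exp.tendsto _).comp ?_
      have h2 : Tendsto (fun n => (l : ℝ) * t n ^ 2) atTop (𝓝 (l * 0 ^ 2)) :=
        (ht.pow 2).const_mul _
      have h3 := (((hkt.sub h2).const_mul (sigma2 P ν f)).div_const 2).neg
      simpa using h3
    have hbd : Tendsto (fun n => M * (C1 * t n) + ε / (2 * (M + 1)) * M + l * (t n * B * M) +
        M * |mu P ν f (t n) ^ (k n - l) - Real.exp (-(sigma2 P ν f * θ / 2))|) atTop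
        (𝓝 (M * (C1 * 0) + ε / (2 * (M + 1)) * M + l * (0 * B * M) +
        M * |Real.exp (-(sigma2 P ν f * θ / 2)) - Real.exp (-(sigma2 P ν f * θ / 2))|)) := by
      refine (((ht.const_mul C1).const_mul M).add_const _ |>.add
        (((ht.mul_const B).mul_const M).const_mul _)).add ((hμ.sub_const _).abs.const_mul M)
    have hlim : M * (C1 * 0) + ε / (2 * (M + 1)) * M + l * (0 * B * M) +
        M * |Real.exp (-(sigma2 P ν f * θ / 2)) - Real.exp (-(sigma2 P ν f * θ / 2))| < ε := by
      simp only [sub_self, abs_zero, mul_zero, zero_mul, add_zero, zero_add]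
      rw [div_mul_eq_mul_div, div_lt_iff₀ (by positivity)]
      nlinarith
    have ev := (hbd.eventually_lt_const hlim).and ((hk.eventually_ge_atTop l).and
      (ht.eventually_lt_const (show (0 : ℝ) < 1 by norm_num)))
    obtain ⟨n₀, hn₀⟩ := eventually_atTop.1 ev
    refine ⟨n₀, fun n hn => ?_⟩
    obtain ⟨h1, h2, h3⟩ := hn₀ n hn.le
    refine lt_of_le_of_lt ?_ h1
    have htI : t n ∈ Set.Icc (0 : ℝ) 1 := ⟨ht0 n, h3.le⟩
    have hkl : k n = (k n - l) + l := by omega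
    rw [dist_eq_norm]
    conv_lhs => rw [hkl]
    rw [PT_ofReal_decomp (ν := ν)]
    set i := k n - l
    have e : (av ν φ' : ℂ) * (PT P f (t n) ^ i) (fun _ => 1) x +
      (PT P f (t n) ^ i) (fun x => (((Pop P)^[l] φ' x - av ν φ' : ℝ) : ℂ)) x +
      (PT P f (t n) ^ i) (fun x => (PT P f (t n) ^ l) (fun x => (φ' x : ℂ)) x -
        ((Pop P)^[l] φ' x : ℝ)) x - (av ν φ' * Real.exp (-(sigma2 P ν f * θ / 2)) : ℝ) =
      (av ν φ' : ℂ) * ((PT P f (t n) ^ i) (fun _ => 1) x - (mu P ν f (t n) : ℂ) ^ i) +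
      (PT P f (t n) ^ i) (fun x => (((Pop P)^[l] φ' x - av ν φ' : ℝ) : ℂ)) x +
      (PT P f (t n) ^ i) (fun x => (PT P f (t n) ^ l) (fun x => (φ' x : ℂ)) x -
        ((Pop P)^[l] φ' x : ℝ)) x + (av ν φ' : ℂ) *
        ((mu P ν f (t n) ^ i - Real.exp (-(sigma2 P ν f * θ / 2)) : ℝ) : ℂ) := by
      push_cast; ring
    rw [e]
    refine (norm_add_le _ _).trans (add_le_add (norm_add₃_le.trans
      (add_le_add (add_le_add ?_ ?_) ?_)) ?_)
    · rw [norm_mul, Complex.norm_real, Real.norm_eq_abs]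
      refine mul_le_mul (av_abs hG.st hM) ((H1 _ htI i x).trans ?_) (norm_nonneg _) hM0
      have : Real.exp (-c1 * i * t n ^ 2) ≤ 1 := by
        rw [Real.exp_le_one_iff]
        have : 0 ≤ c1 * ((i : ℝ) * t n ^ 2) := by positivity
        linarith
      have h5 := mul_le_mul_of_nonneg_left this (mul_nonneg hC1.le (ht0 n))
      linarith
    · exact PT_bound hG.st f _ _ (fun x => by
        rw [Complex.norm_real, Real.norm_eq_abs]; exact hl φ' M hM x) x
    · exact PT_bound hG.st f _ _ (fun x => PT_close hG.st hB (ht0 n) hM l x) x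
    · rw [norm_mul, Complex.norm_real, Complex.norm_real, Real.norm_eq_abs, Real.norm_eq_abs]
      exact mul_le_mul_of_nonneg_right (av_abs hG.st hM) (abs_nonneg _)
  have := main.add red
  rw [add_zero] at this
  refine this.congr fun n => ?_
  have : (fun x => (φ n x : ℂ)) = (fun x => (φ' x : ℂ)) + fun x => ((φ n x - φ' x : ℝ) : ℂ) := by
    ext x; simp
  rw [this, map_add]; rfl

/-- Free evolution of characters. -/
lemma FS_char (P : X → X → ℝ) (f : X → ℝ) (t e : ℝ) (φ : X → ℝ) (i : ℕ) (x : X) (u : ℝ) :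
    (FS P f ^ i) (fun x u => φ x * Real.cos (t * (u + e))) x u =
      (Complex.exp ((t * (u + e) : ℝ) * Complex.I) * (PT P f t ^ i) (fun x => (φ x : ℂ)) x).re ∧
    (FS P f ^ i) (fun x u => φ x * Real.sin (t * (u + e))) x u =
      (Complex.exp ((t * (u + e) : ℝ) * Complex.I) * (PT P f t ^ i) (fun x => (φ x : ℂ)) x).im := by
  induction i generalizing x u with
  | zero =>
    simp only [pow_zero, Module.End.one_apply, Complex.mul_re, Complex.mul_im,
      Complex.exp_ofReal_mul_I_re, Complex.exp_ofReal_mul_I_im, Complex.ofReal_re,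
      Complex.ofReal_im]
    constructor <;> ring
  | succ i ih =>
    have key : Complex.exp ((t * (u + e) : ℝ) * Complex.I) *
        (PT P f t ^ (i + 1)) (fun x => (φ x : ℂ)) x =
        ∑ x', (P x x' : ℂ) * (Complex.exp ((t * (u + f x' + e) : ℝ) * Complex.I) *
          (PT P f t ^ i) (fun x => (φ x : ℂ)) x') := by
      rw [PT_succ, Finset.mul_sum]
      refine Finset.sum_congr rfl fun x' _ => ?_
      have : Complex.exp ((t * (u + f x' + e) : ℝ) * Complex.I) =
        Complex.exp ((t * (u + e) : ℝ) * Complex.I) *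
          Complex.exp ((t * f x' : ℝ) * Complex.I) := by
        rw [← Complex.exp_add]; push_cast; ring_nf
      rw [this]; ring
    rw [key, FS_succ, FS_succ, Complex.re_sum, Complex.im_sum]
    constructor
    · refine Finset.sum_congr rfl fun x' _ => ?_
      rw [(ih x' (u + f x')).1, Complex.re_ofReal_mul]
    · refine Finset.sum_congr rfl fun x' _ => ?_
      rw [(ih x' (u + f x')).2, Complex.im_ofReal_mul]

lemma FS_sin_bd {P : X → X → ℝ} {ν f : X → ℝ} (hG : Good P ν f) (K : ℝ) :
    ∃ C c : ℝ, 0 < C ∧ 0 < c ∧ ∀ t ∈ Set.Icc 0 K, ∀ (i : ℕ) (φ : X → ℝ) (M : ℝ),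
      (∀ x, |φ x| ≤ M) → ∀ (e : ℝ) x u,
      |(FS P f ^ i) (fun x u => φ x * Real.sin (t * (u + e))) x u| ≤
        C * t * (1 + |u + e|) * Real.exp (-c * i * t ^ 2) * M ∧
      |(FS P f ^ i) (fun x u => φ x * Real.cos (t * (u + e))) x u| ≤
        C * Real.exp (-c * i * t ^ 2) * M ∧
      |(FS P f ^ i) (fun x u => φ x * Real.sin (t * (u + e))) x u -
        Real.sin (t * (u + e)) * ((PT P f t ^ i) (fun x => (φ x : ℂ)) x).re| ≤
        C * t * Real.exp (-c * i * t ^ 2) * M := by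
  obtain ⟨C1, c1, hC1, hc1, H1⟩ := F1 hG K
  obtain ⟨C2, c2, hC2, hc2, H2⟩ := F2 hG K
  refine ⟨C1 + C2, min c1 c2, by positivity, lt_min hc1 hc2, fun t ht i φ M hM e x u => ?_⟩
  have ht0 := ht.1
  have hM0 : 0 ≤ M := (abs_nonneg _).trans (hM x)
  have ekc : ∀ a : ℝ, min c1 c2 ≤ a → Real.exp (-a * i * t ^ 2) ≤
      Real.exp (-(min c1 c2) * i * t ^ 2) := by
    intro a ha
    refine Real.exp_le_exp.2 ?_
    have : min c1 c2 * ((i : ℝ) * t ^ 2) ≤ a * (i * t ^ 2) :=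
      mul_le_mul_of_nonneg_right ha (by positivity)
    linarith
  set E := Real.exp (-(min c1 c2) * i * t ^ 2) with hE
  have hEp : 0 < E := Real.exp_pos _
  set g := (PT P f t ^ i) (fun x => (φ x : ℂ)) x with hg
  have hn : ‖g‖ ≤ C1 * E * M := by
    refine (H1 t ht i _ M (fun x => by rw [Complex.norm_real, Real.norm_eq_abs]; exact hM x)
      x).trans ?_
    have := ekc c1 (min_le_left _ _)
    gcongr
  have him : |g.im| ≤ C2 * t * E * M := by
    refine (H2 t ht i φ M hM x).trans ?_
    have := ekc c2 (min_le_right _ _)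
    gcongr
  obtain ⟨hc, hs⟩ := FS_char P f t e φ i x u
  rw [hc, hs]
  have him2 : |Real.cos (t * (u + e)) * g.im| ≤ C2 * t * E * M := by
    rw [abs_mul]
    calc _ ≤ 1 * |g.im| := mul_le_mul_of_nonneg_right (Real.abs_cos_le_one _) (abs_nonneg _)
      _ ≤ _ := by rw [one_mul]; exact him
  have hsin : |Real.sin (t * (u + e)) * g.re| ≤ t * |u + e| * (C1 * E * M) := by
    rw [abs_mul]
    refine mul_le_mul ?_ ((Complex.abs_re_le_norm _).trans hn) (abs_nonneg _) (by positivity)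
    have := Real.abs_sin_le_abs (x := t * (u + e))
    rwa [abs_mul, abs_of_nonneg ht0] at this
  have himexp : (Complex.exp ((t * (u + e) : ℝ) * Complex.I) * g).im =
      Real.cos (t * (u + e)) * g.im + Real.sin (t * (u + e)) * g.re := by
    rw [Complex.mul_im, Complex.exp_ofReal_mul_I_re, Complex.exp_ofReal_mul_I_im]
  refine ⟨?_, ?_, ?_⟩
  · rw [himexp]
    refine (abs_add_le _ _).trans ((add_le_add him2 hsin).trans ?_)
    have h1 : 0 ≤ t * E * M := by positivity
    have h2 := abs_nonneg (u + e)
    have h3 : 0 ≤ t * E * M * |u + e| := by positivity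
    calc _ = C2 * (t * E * M) + C1 * (t * E * M * |u + e|) := by ring
      _ ≤ (C1 + C2) * (t * E * M) + (C1 + C2) * (t * E * M * |u + e|) := by gcongr <;> linarith
      _ = _ := by ring
  · refine (Complex.abs_re_le_norm _).trans ?_
    rw [norm_mul, Complex.norm_exp_ofReal_mul_I, one_mul]
    refine hn.trans ?_
    gcongr; linarith
  · rw [himexp, add_sub_cancel_right]
    refine him2.trans ?_
    gcongr; linarith

end PartD2


section PartDu
variable [Fintype X] [DecidableEq X] [Nonempty X]

lemma dual_mul {P : X → X → ℝ} {ν : X → ℝ} (hS : IsStochastic P ν) (x x' : X) :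
    ν x * dualK P ν x x' = ν x' * P x' x := by
  unfold dualK; field_simp [(hS.nuPos x).ne']

lemma dual_st {P : X → X → ℝ} {ν : X → ℝ} (hS : IsStochastic P ν) :
    IsStochastic (dualK P ν) ν where
  nonneg x x' := div_nonneg (mul_nonneg (hS.nuPos _).le (hS.nonneg _ _)) (hS.nuPos _).le
  rowSum x := by
    unfold dualK
    rw [← Finset.sum_div, hS.nuInv, div_self (hS.nuPos x).ne']
  nuPos := hS.nuPos
  nuSum := hS.nuSum
  nuInv x' := by
    simp only [dual_mul hS]
    rw [← Finset.mul_sum, hS.rowSum, mul_one]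

lemma kpow_succ' (P : X → X → ℝ) (n : ℕ) (x x' : X) :
    kpow P (n + 1) x x' = ∑ y, kpow P n x y * P y x' := by
  induction n generalizing x x' with
  | zero => simp [kpow]
  | succ n ih =>
    have e : ∀ x x', kpow P (n + 1) x x' = ∑ y, P x y * kpow P n y x' := fun _ _ => rfl
    calc kpow P (n + 1 + 1) x x' = ∑ y, P x y * kpow P (n + 1) y x' := rfl
      _ = ∑ y, ∑ z, P x y * (kpow P n y z * P z x') := by
        refine Finset.sum_congr rfl fun y _ => ?_
        rw [ih, Finset.mul_sum]
      _ = ∑ z, ∑ y, P x y * (kpow P n y z * P z x') := Finset.sum_comm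
      _ = _ := by
        refine Finset.sum_congr rfl fun z _ => ?_
        rw [e, Finset.sum_mul]
        exact Finset.sum_congr rfl fun _ _ => by ring

lemma dual_kpow {P : X → X → ℝ} {ν : X → ℝ} (hS : IsStochastic P ν) (n : ℕ) (x x' : X) :
    ν x * kpow (dualK P ν) n x x' = ν x' * kpow P n x' x := by
  induction n generalizing x x' with
  | zero =>
    simp only [kpow]
    by_cases h : x = x'
    · subst h; simp
    · simp [h, Ne.symm h]
  | succ n ih =>
    rw [kpow_succ', show kpow P (n + 1) = fun x x' => ∑ y, P x y * kpow P n y x' from rfl]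
    simp only [Finset.mul_sum]
    refine Finset.sum_congr rfl fun y _ => ?_
    have h1 := ih x y
    have h2 := dual_mul hS y x'
    calc _ = (ν x * kpow (dualK P ν) n x y) * dualK P ν y x' := by ring
      _ = (ν y * dualK P ν y x') * kpow P n y x := by rw [h1]; ring
      _ = _ := by rw [h2]; ring

lemma dual_good {P : X → X → ℝ} {ν f : X → ℝ} (hG : Good P ν f) :
    Good (dualK P ν) ν (fun b => -f b) where
  st := dual_st hG.st
  pr := by
    obtain ⟨k, hk, h⟩ := hG.pr
    refine ⟨k, hk, fun x x' => ?_⟩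
    have h1 := dual_kpow hG.st k x x'
    have h2 : 0 < ν x' * kpow P k x' x := mul_pos (hG.st.nuPos _) (h _ _)
    rw [← h1] at h2
    exact (mul_pos_iff_of_pos_left (hG.st.nuPos x)).1 h2
  ce := by
    have := hG.ce
    simp only [neg_mul, Finset.sum_neg_distrib, this, neg_zero]
  nl := by
    intro θ a
    obtain ⟨n, g, hg, h⟩ := hG.nl (-θ) a
    refine ⟨n, fun i => g (-i), ?_, fun m => ?_⟩
    · have e1 : ∏ i : Fin (n + 1), dualK P ν (g (-i)) (g (-(i + 1))) =
          ∏ i : Fin (n + 1), P (g (-(i + 1))) (g (-i)) := by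
        unfold dualK
        rw [Finset.prod_div_distrib, Finset.prod_mul_distrib]
        have : ∏ i : Fin (n + 1), ν (g (-(i + 1))) = ∏ i : Fin (n + 1), ν (g (-i)) :=
          Equiv.prod_comp (Equiv.addRight (1 : Fin (n + 1))) (fun i => ν (g (-i)))
        rw [this]
        have hne : ∏ i : Fin (n + 1), ν (g (-i)) ≠ 0 :=
          Finset.prod_ne_zero_iff.2 fun i _ => (hG.st.nuPos _).ne'
        field_simp
      rw [e1]
      have e2 : ∏ i : Fin (n + 1), P (g (-(i + 1))) (g (-i)) =
          ∏ i : Fin (n + 1), P (g i) (g (i + 1)) := by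
        rw [← Equiv.prod_comp ((Equiv.addRight (1 : Fin (n + 1))).trans (Equiv.neg _))
          (fun i => P (g i) (g (i + 1)))]
        refine Finset.prod_congr rfl fun i _ => ?_
        simp only [Equiv.trans_apply, Equiv.coe_addRight, Equiv.neg_apply]
        congr 2
        abel
      rw [e2]; exact hg
    · have e3 : ∑ i : Fin (n + 1), f (g (-i)) = ∑ i : Fin (n + 1), f (g i) :=
        Equiv.sum_comp (Equiv.neg (Fin (n + 1))) (fun i => f (g i))
      rw [Finset.sum_neg_distrib, e3]
      have := h (-m)
      intro hc
      apply this
      push_cast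
      linarith

lemma dual_pair {P : X → X → ℝ} {ν : X → ℝ} (hS : IsStochastic P ν) (n : ℕ) (g h : X → ℝ) :
    ∑ x, g x * ((Pop (dualK P ν))^[n] h) x * ν x = ∑ x, ((Pop P)^[n] g) x * h x * ν x := by
  induction n generalizing g h with
  | zero => rfl
  | succ n ih =>
    rw [Function.iterate_succ_apply, Function.iterate_succ_apply', ih]
    unfold Pop
    simp only [Finset.mul_sum, Finset.sum_mul]
    rw [Finset.sum_comm]
    refine Finset.sum_congr rfl fun x _ => Finset.sum_congr rfl fun y _ => ?_
    have := dual_mul hS y x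
    calc _ = ((ν y * dualK P ν y x) * h x) * ((fun g x => ∑ x', P x x' * g x')^[n] g) y := by ring
      _ = _ := by rw [this]; ring

lemma Pop_neg_iter (P : X → X → ℝ) (n : ℕ) (g : X → ℝ) :
    (Pop P)^[n] (fun b => -g b) = fun b => -((Pop P)^[n] g) b := by
  induction n with
  | zero => rfl
  | succ n ih =>
    rw [Function.iterate_succ_apply', Function.iterate_succ_apply', ih]
    ext b
    simp [Pop, Finset.sum_neg_distrib]

lemma dual_sigma {P : X → X → ℝ} {ν f : X → ℝ} (hG : Good P ν f) :
    sigma2 (dualK P ν) ν (fun b => -f b) = sigma2 P ν f := by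
  unfold sigma2
  congr 1
  · exact Finset.sum_congr rfl fun _ _ => by ring
  · congr 2
    ext n
    have := dual_pair hG.st (n + 1) f f
    rw [Pop_neg_iter]
    calc _ = ∑ x, f x * ((Pop (dualK P ν))^[n + 1] f) x * ν x :=
          Finset.sum_congr rfl fun _ _ => by ring
      _ = _ := by rw [this]; exact Finset.sum_congr rfl fun _ _ => by ring

end PartDu


section PartK

/-- Fejér kernel. -/
noncomputable def Fd (δ u : ℝ) : ℝ := ∫ t in (0:ℝ)..δ, (δ - t) * Real.cos (t * u)

lemma Fd_eq (δ u : ℝ) : Fd δ u * u ^ 2 = 1 - Real.cos (δ * u) := by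
  unfold Fd
  have h : ∀ t : ℝ, HasDerivAt (fun t => (δ - t) * (Real.sin (t * u) * u) - Real.cos (t * u))
      (((δ - t) * Real.cos (t * u)) * u ^ 2) t := by
    intro t
    have h0 : HasDerivAt (fun t : ℝ => t * u) u t := by simpa using (hasDerivAt_id t).mul_const u
    have h1 : HasDerivAt (fun t => Real.sin (t * u)) (Real.cos (t * u) * u) t := h0.sin
    have h2 : HasDerivAt (fun t => Real.cos (t * u)) (-Real.sin (t * u) * u) t := h0.cos
    have h3 : HasDerivAt (fun t : ℝ => δ - t) (-1) t := by
      simpa using (hasDerivAt_id t).const_sub δ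
    refine ((h3.mul (h1.mul_const u)).sub h2).congr_deriv ?_
    ring
  rw [← intervalIntegral.integral_mul_const]
  rw [intervalIntegral.integral_eq_sub_of_hasDerivAt (fun t _ => h t)
    (Continuous.intervalIntegrable (by fun_prop) _ _)]
  simp
  ring

lemma Fd_cont (δ : ℝ) : Continuous (Fd δ) := by
  unfold Fd
  exact intervalIntegral.continuous_parametric_intervalIntegral_of_continuous' (by fun_prop) 0 δ

lemma Fd_nonneg (δ u : ℝ) (hδ : 0 ≤ δ) : 0 ≤ Fd δ u := by
  by_cases hu : u = 0
  · subst hu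
    unfold Fd
    refine intervalIntegral.integral_nonneg hδ fun t ht => ?_
    simpa using ht.2
  · have h := Fd_eq δ u
    have h1 : 0 < u ^ 2 := by positivity
    have h2 : 0 ≤ Fd δ u * u ^ 2 := by rw [h]; linarith [Real.cos_le_one (δ * u)]
    exact nonneg_of_mul_nonneg_left h2 h1

lemma Fd_le (δ u : ℝ) (hδ : 0 ≤ δ) : Fd δ u ≤ δ ^ 2 / 2 := by
  unfold Fd
  have : ∫ t in (0:ℝ)..δ, (δ - t) = δ ^ 2 / 2 := by
    rw [intervalIntegral.integral_sub (by simp) (by simp)]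
    simp; ring
  rw [← this]
  refine intervalIntegral.integral_mono_on hδ (Continuous.intervalIntegrable (by fun_prop) _ _)
    (Continuous.intervalIntegrable (by fun_prop) _ _) fun t ht => ?_
  have := Real.cos_le_one (t * u)
  nlinarith [ht.2]

lemma Fd_le2 (δ u : ℝ) : Fd δ u * u ^ 2 ≤ 2 := by
  rw [Fd_eq]; linarith [Real.neg_one_le_cos (δ * u)]

lemma Fd_bd (δ u : ℝ) (hδ : 0 ≤ δ) : |Fd δ u| ≤ (δ ^ 2 / 2 + 2) * (1 + u ^ 2)⁻¹ := by
  rw [abs_of_nonneg (Fd_nonneg δ u hδ), ← div_eq_mul_inv, le_div_iff₀ (by positivity)]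
  have := Fd_le δ u hδ
  have := Fd_le2 δ u
  linarith

lemma Fd_int (δ : ℝ) (hδ : 0 ≤ δ) : Integrable (Fd δ) := by
  refine (integrable_inv_one_add_sq.const_mul (δ ^ 2 / 2 + 2)).mono'
    (Fd_cont δ).aestronglyMeasurable (Eventually.of_forall fun u => ?_)
  exact Fd_bd δ u hδ

lemma Fd_scale (δ u : ℝ) (hδ : 0 < δ) : Fd δ u = δ ^ 2 * Fd 1 (δ * u) := by
  by_cases hu : u = 0
  · subst hu
    have h : ∀ δ : ℝ, Fd δ 0 = δ ^ 2 / 2 := by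
      intro δ
      unfold Fd
      simp only [mul_zero, Real.cos_zero, mul_one]
      rw [intervalIntegral.integral_sub (by simp) (by simp)]
      simp; ring
    rw [mul_zero, h, h]; ring
  · have h := Fd_eq δ u
    have h1 := Fd_eq 1 (δ * u)
    rw [one_mul, ← h] at h1
    have h2 : u ^ 2 ≠ 0 := by positivity
    apply mul_right_cancel₀ h2
    rw [← h1]; ring

lemma Fd_even (δ u : ℝ) : Fd δ (-u) = Fd δ u := by
  unfold Fd; simp

/-- Triangle. -/
noncomputable def tri (t : ℝ) : ℝ := max (1 - |t|) 0

lemma tri_cont : Continuous tri := by unfold tri; fun_prop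

lemma tri_supp : HasCompactSupport tri := by
  refine HasCompactSupport.of_support_subset_isCompact (isCompact_Icc (a := (-1 : ℝ)) (b := 1)) ?_
  intro t ht
  rw [Function.mem_support] at ht
  by_contra h
  apply ht
  unfold tri
  rw [max_eq_right]
  rw [Set.mem_Icc, ← abs_le] at h
  linarith

lemma tri_cos (u : ℝ) : ∫ t, tri t * Real.cos (t * u) = 2 * Fd 1 u := by
  have h1 : (fun t => tri t * Real.cos (t * u)) =
      fun t => (fun s => tri s * Real.cos (s * u)) |t| := by
    ext t
    simp only
    have : Real.cos (|t| * u) = Real.cos (t * u) := by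
      rcases abs_choice t with h | h <;> rw [h] <;> simp
    rw [this]
    unfold tri; rw [abs_abs]
  rw [h1, integral_comp_abs (f := fun s => tri s * Real.cos (s * u))]
  congr 1
  unfold Fd
  rw [intervalIntegral.integral_of_le zero_le_one]
  have h2 : Set.Ioi (0:ℝ) = Set.Ioc 0 1 ∪ Set.Ioi 1 := (Set.Ioc_union_Ioi_eq_Ioi zero_le_one).symm
  have h3 : Integrable fun s => tri s * Real.cos (s * u) :=
    (tri_cont.mul (by fun_prop)).integrable_of_hasCompactSupport tri_supp.mul_right
  rw [h2, setIntegral_union (Set.Ioc_disjoint_Ioi le_rfl) measurableSet_Ioi h3.integrableOn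
    h3.integrableOn]
  have h4 : ∫ t in Set.Ioi (1:ℝ), tri t * Real.cos (t * u) = 0 := by
    refine (setIntegral_congr_fun measurableSet_Ioi fun t ht => ?_).trans (integral_zero _ _)
    have ht : 1 < t := ht
    simp only [tri]
    rw [max_eq_right]
    · simp
    · rw [abs_of_pos (by linarith)]; linarith
  rw [h4, add_zero]
  refine setIntegral_congr_fun measurableSet_Ioc fun t ht => ?_
  simp only [tri]
  rw [abs_of_pos ht.1, max_eq_left (by linarith [ht.2])]

lemma tri_sin (u : ℝ) : ∫ t, tri t * Real.sin (t * u) = 0 := by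
  have h := integral_neg_eq_self (fun t => tri t * Real.sin (t * u)) volume
  have h2 : ∀ t, tri (-t) * Real.sin (-t * u) = - (tri t * Real.sin (t * u)) := by
    intro t; simp [tri]
  simp only [h2, integral_neg] at h
  linarith

lemma tri_fourier (w : ℝ) :
    FourierTransform.fourier (fun t => (tri t : ℂ)) w = ((2 * Fd 1 (2 * π * w) : ℝ) : ℂ) := by
  rw [Real.fourier_real_eq_integral_exp_smul]
  have i1 : Integrable fun s => tri s * Real.cos (s * (2 * π * w)) :=
    (tri_cont.mul (by fun_prop)).integrable_of_hasCompactSupport tri_supp.mul_right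
  have i2 : Integrable fun s => tri s * Real.sin (s * (2 * π * w)) :=
    (tri_cont.mul (by fun_prop)).integrable_of_hasCompactSupport tri_supp.mul_right
  have h1 : ∀ t : ℝ, Complex.exp (((-2 * π * t * w : ℝ) : ℂ) * Complex.I) • (tri t : ℂ) =
      ((tri t * Real.cos (t * (2 * π * w)) : ℝ) : ℂ) -
        ((tri t * Real.sin (t * (2 * π * w)) : ℝ) : ℂ) * Complex.I := by
    intro t
    have : (((-2 * π * t * w : ℝ) : ℂ)) = ((-(t * (2 * π * w)) : ℝ) : ℂ) := by
      congr 1; ring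
    rw [this, Complex.exp_mul_I, ← Complex.ofReal_cos, ← Complex.ofReal_sin, Real.cos_neg,
      Real.sin_neg, smul_eq_mul]
    push_cast
    ring
  simp only [h1]
  rw [integral_sub i1.ofReal (i2.ofReal.mul_const _), integral_mul_const, integral_complex_ofReal,
    integral_complex_ofReal, tri_sin, tri_cos]
  simp

lemma Fd_one_integral : ∫ u, Fd 1 u = π := by
  have hc : Continuous fun t => (tri t : ℂ) := Complex.continuous_ofReal.comp tri_cont
  have hi : Integrable fun t => (tri t : ℂ) :=
    (tri_cont.integrable_of_hasCompactSupport tri_supp).ofReal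
  have hi' : Integrable fun w => 2 * Fd 1 (2 * π * w) :=
    ((Fd_int 1 zero_le_one).comp_mul_left' (by positivity)).const_mul 2
  have hf : FourierTransform.fourier (fun t => (tri t : ℂ)) =
      fun w => ((2 * Fd 1 (2 * π * w) : ℝ) : ℂ) := funext tri_fourier
  have h := congr_fun (Continuous.fourierInv_fourier_eq hc hi (by rw [hf]; exact hi'.ofReal)) 0
  rw [hf, Real.fourierInv_eq'] at h
  simp only [inner_zero_right, mul_zero, Complex.ofReal_zero, zero_mul, Complex.exp_zero,
    one_smul] at h
  rw [integral_complex_ofReal] at h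
  have h := Complex.ofReal_injective h
  rw [integral_const_mul, Measure.integral_comp_mul_left (fun u => Fd 1 u)] at h
  have : tri 0 = 1 := by simp [tri]
  rw [this, abs_of_pos (by positivity), smul_eq_mul] at h
  have hp := Real.pi_pos
  field_simp at h
  linarith

lemma Fd_integral (δ : ℝ) (hδ : 0 < δ) : ∫ u, Fd δ u = π * δ := by
  simp only [fun u => Fd_scale δ u hδ]
  rw [integral_const_mul, Measure.integral_comp_mul_left (fun u => Fd 1 u), Fd_one_integral,
    abs_of_pos (by positivity), smul_eq_mul]
  field_simp

lemma Fd_integral_Ioi (δ : ℝ) (hδ : 0 < δ) : ∫ u in Set.Ioi 0, Fd δ u = π * δ / 2 := by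
  have h := integral_comp_abs (f := Fd δ)
  have h1 : (fun x => Fd δ |x|) = Fd δ := by
    ext x
    rcases abs_choice x with h | h <;> rw [h]
    exact Fd_even δ x
  rw [h1, Fd_integral δ hδ] at h
  linarith

lemma Fd_tail (δ ε : ℝ) (hδ : 0 < δ) (hε : 0 < ε) : ∫ u in Set.Ioi ε, Fd δ u ≤ 2 / ε := by
  have h1 : ∫ u in Set.Ioi ε, 2 * u ^ (-2 : ℝ) = 2 / ε := by
    rw [integral_const_mul, integral_Ioi_rpow_of_lt (by norm_num) hε]
    norm_num
    rw [Real.rpow_neg_one]; rfl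
  rw [← h1]
  refine setIntegral_mono_on (Fd_int δ hδ.le).integrableOn
    ((integrableOn_Ioi_rpow_of_lt (by norm_num) hε).const_mul 2) measurableSet_Ioi fun u hu => ?_
  have hu : 0 < u := hε.trans hu
  rw [Real.rpow_neg hu.le, Real.rpow_two, ← div_eq_mul_inv, le_div_iff₀ (by positivity)]
  exact Fd_le2 δ u

lemma Fd_window (δ ε : ℝ) (hδ : 0 < δ) (hε : 0 < ε) :
    π * δ - 4 / ε ≤ ∫ u in (-ε)..ε, Fd δ u := by
  have h0 : ∫ u in (-ε)..ε, Fd δ u = 2 * ∫ u in (0:ℝ)..ε, Fd δ u := by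
    rw [← intervalIntegral.integral_add_adjacent_intervals (b := 0)
      ((Fd_cont δ).intervalIntegrable _ _) ((Fd_cont δ).intervalIntegrable _ _)]
    have := intervalIntegral.integral_comp_neg (a := (0:ℝ)) (b := ε) (fun u => Fd δ u)
    simp only [Fd_even, neg_zero] at this
    rw [← this]; ring
  have h1 := intervalIntegral.integral_Ioi_sub_Ioi (f := Fd δ) (a := 0) (b := ε)
    (Fd_int δ hδ.le).integrableOn hε.le
  rw [Fd_integral_Ioi δ hδ] at h1
  have := Fd_tail δ ε hδ hε
  rw [h0, ← h1]
  have e : 4 / ε = 2 * (2 / ε) := by ring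
  rw [e]; linarith

/-- Second kernel. -/
noncomputable def Gk (u : ℝ) : ℝ :=
  ∫ t in (0:ℝ)..1, (1 - t) * (1 + Real.cos (π * t)) * Real.cos (t * u)

lemma Gk_eq (u : ℝ) : Gk u = Fd 1 u + (Fd 1 (u - π) + Fd 1 (u + π)) / 2 := by
  unfold Gk Fd
  rw [← intervalIntegral.integral_add (Continuous.intervalIntegrable (by fun_prop) _ _)
    (Continuous.intervalIntegrable (by fun_prop) _ _), ← intervalIntegral.integral_div,
    ← intervalIntegral.integral_add (Continuous.intervalIntegrable (by fun_prop) _ _)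
    (Continuous.intervalIntegrable (by fun_prop) _ _)]
  refine intervalIntegral.integral_congr fun t _ => ?_
  have h1 : t * (u - π) = t * u - π * t := by ring
  have h2 : t * (u + π) = t * u + π * t := by ring
  rw [h1, h2, Real.cos_sub, Real.cos_add]
  change _ = _
  ring

lemma Fd_low (u w : ℝ) (h : |u| ≤ w) : 1 - Real.cos u ≤ Fd 1 u * w ^ 2 := by
  have h1 := Fd_eq 1 u
  rw [one_mul] at h1
  rw [← h1]
  have : u ^ 2 ≤ w ^ 2 := by rw [← sq_abs]; exact pow_le_pow_left₀ (abs_nonneg _) h 2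
  exact mul_le_mul_of_nonneg_left this (Fd_nonneg 1 u zero_le_one)

lemma Gk_low (u : ℝ) : 2 ≤ Gk u * (|u| + π) ^ 2 := by
  rw [Gk_eq]
  have hp := Real.pi_pos
  have h1 := Fd_low u (|u| + π) (by linarith)
  have h2 := Fd_low (u - π) (|u| + π) (by
    refine (abs_sub _ _).trans ?_
    rw [abs_of_pos hp])
  have h3 := Fd_low (u + π) (|u| + π) (by
    refine (abs_add_le _ _).trans ?_
    rw [abs_of_pos hp])
  rw [Real.cos_sub_pi] at h2
  rw [Real.cos_add_pi] at h3
  linarith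

lemma Gk_nonneg (u : ℝ) : 0 ≤ Gk u := by
  rw [Gk_eq]
  have := Fd_nonneg 1 u zero_le_one
  have := Fd_nonneg 1 (u - π) zero_le_one
  have := Fd_nonneg 1 (u + π) zero_le_one
  linarith

lemma Gk_bd : ∃ C : ℝ, 0 < C ∧ ∀ u, |Gk u| ≤ C * (1 + u ^ 2)⁻¹ := by
  have hp := Real.pi_pos
  refine ⟨5 / 2 + 5 / 2 * (2 + 2 * π ^ 2), by positivity, fun u => ?_⟩
  rw [abs_of_nonneg (Gk_nonneg u), Gk_eq]
  have h : ∀ v : ℝ, Fd 1 v ≤ 5 / 2 * (1 + v ^ 2)⁻¹ := fun v => by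
    have := (le_abs_self _).trans (Fd_bd 1 v zero_le_one)
    norm_num at this ⊢; linarith
  have h' : ∀ v : ℝ, |v| = π → Fd 1 (u + v) ≤ 5 / 2 * (2 + 2 * π ^ 2) * (1 + u ^ 2)⁻¹ := by
    intro v hv
    refine (h _).trans ?_
    rw [mul_assoc]
    refine mul_le_mul_of_nonneg_left ?_ (by norm_num)
    rw [← div_eq_mul_inv, le_div_iff₀ (by positivity), inv_mul_le_iff₀ (by positivity)]
    have hv2 : v ^ 2 = π ^ 2 := by rw [← sq_abs, hv]
    rw [← hv2]
    nlinarith [sq_nonneg (u + 2 * v), sq_nonneg (v * (u + v)), sq_nonneg v, sq_nonneg (u + v)]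
  have h1 := h u
  have h2 := h' (-π) (by rw [abs_neg, abs_of_pos hp])
  have h3 := h' π (abs_of_pos hp)
  rw [← sub_eq_add_neg] at h2
  have : (5 / 2 + 5 / 2 * (2 + 2 * π ^ 2)) * (1 + u ^ 2)⁻¹ =
    5 / 2 * (1 + u ^ 2)⁻¹ + 5 / 2 * (2 + 2 * π ^ 2) * (1 + u ^ 2)⁻¹ := by ring
  linarith

/-- Antiderivative of the kernel. -/
noncomputable def Ph (u : ℝ) : ℝ := ∫ t in (0:ℝ)..1, (1 - t) * (Real.sin (t * u) / t)

lemma Ph_eq (u : ℝ) : Ph u = ∫ v in (0:ℝ)..u, Fd 1 v := by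
  unfold Ph Fd
  rw [intervalIntegral_intervalIntegral_swap]
  · rw [intervalIntegral.integral_of_le zero_le_one, intervalIntegral.integral_of_le zero_le_one]
    refine setIntegral_congr_fun measurableSet_Ioc fun t ht => ?_
    change _ = ∫ y in (0:ℝ)..u, (1 - t) * Real.cos (t * y)
    rw [intervalIntegral.integral_const_mul]
    congr 1
    rw [intervalIntegral.integral_comp_mul_left (fun v => Real.cos v) ht.1.ne']
    simp
    ring
  · have hc : Continuous (Function.uncurry fun x y : ℝ => (1 - y) * Real.cos (y * x)) := by
      unfold Function.uncurry; fun_prop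
    refine (hc.continuousOn.integrableOn_compact
      (isCompact_uIcc.prod isCompact_uIcc)).mono_set
        (Set.prod_mono Set.uIoc_subset_uIcc Set.uIoc_subset_uIcc)

lemma Ph_bd (u : ℝ) (hu : 0 < u) : 0 ≤ π / 2 - Ph u ∧ π / 2 - Ph u ≤ 2 / u := by
  have h1 := intervalIntegral.integral_Ioi_sub_Ioi (f := Fd 1) (a := 0) (b := u)
    (Fd_int 1 zero_le_one).integrableOn hu.le
  rw [Fd_integral_Ioi 1 zero_lt_one, ← Ph_eq] at h1
  have h2 : π / 2 - Ph u = ∫ v in Set.Ioi u, Fd 1 v := by rw [← h1]; ring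
  rw [h2]
  exact ⟨setIntegral_nonneg measurableSet_Ioi fun v _ => Fd_nonneg 1 v zero_le_one,
    Fd_tail 1 u one_pos hu⟩

lemma Ph_nonneg (u : ℝ) (hu : 0 ≤ u) : 0 ≤ Ph u := by
  rw [Ph_eq]
  exact intervalIntegral.integral_nonneg hu fun v _ => Fd_nonneg 1 v zero_le_one

end PartK


section PartE
variable [Fintype X] [DecidableEq X] [Nonempty X]

lemma KS_integral {T : Type*} [MeasurableSpace T] (μ : Measure T) (P : X → X → ℝ) (f : X → ℝ)
    (n : ℕ) {φ : T → X → ℝ → ℝ} (h : ∀ w u, Integrable (fun t => φ t w u) μ) (x : X) (y : ℝ) :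
    Integrable (fun t => (KS P f ^ n) (φ t) x y) μ ∧
    (KS P f ^ n) (fun w u => ∫ t, φ t w u ∂μ) x y = ∫ t, (KS P f ^ n) (φ t) x y ∂μ := by
  obtain ⟨c, w, u, H⟩ := KS_sum P f n x y
  simp only [H]
  have hi : ∀ p ∈ (univ : Finset (Fin n → X)),
      Integrable (fun t => c p * φ t (w p) (u p)) μ := fun p _ => (h _ _).const_mul _
  refine ⟨integrable_finsetSum _ hi, ?_⟩
  rw [integral_finsetSum _ hi]
  exact Finset.sum_congr rfl fun p _ => (integral_const_mul _ _).symm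

lemma FS_integral {T : Type*} [MeasurableSpace T] (μ : Measure T) (P : X → X → ℝ) (f : X → ℝ)
    (n : ℕ) {φ : T → X → ℝ → ℝ} (h : ∀ w u, Integrable (fun t => φ t w u) μ) (x : X) (y : ℝ) :
    Integrable (fun t => (FS P f ^ n) (φ t) x y) μ ∧
    (FS P f ^ n) (fun w u => ∫ t, φ t w u ∂μ) x y = ∫ t, (FS P f ^ n) (φ t) x y ∂μ := by
  induction n generalizing x y with
  | zero => exact ⟨h x y, rfl⟩
  | succ n ih =>
    simp only [FS_succ]
    have hi : ∀ x' ∈ (univ : Finset X),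
        Integrable (fun t => P x x' * (FS P f ^ n) (φ t) x' (y + f x')) μ :=
      fun x' _ => (ih x' _).1.const_mul _
    refine ⟨integrable_finsetSum _ hi, ?_⟩
    rw [integral_finsetSum _ hi]
    refine Finset.sum_congr rfl fun x' _ => ?_
    rw [(ih x' _).2, integral_const_mul]

lemma FS_mono {P : X → X → ℝ} (hP : ∀ x x', 0 ≤ P x x') (f : X → ℝ) (n : ℕ) {F G : X → ℝ → ℝ}
    (h : ∀ x u, F x u ≤ G x u) (x : X) (y : ℝ) :
    (FS P f ^ n) F x y ≤ (FS P f ^ n) G x y := by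
  induction n generalizing x y with
  | zero => exact h x y
  | succ n ih =>
    rw [FS_succ, FS_succ]
    exact Finset.sum_le_sum fun x' _ => mul_le_mul_of_nonneg_left (ih _ _) (hP _ _)

lemma FS_smul (P : X → X → ℝ) (f : X → ℝ) (n : ℕ) (F : X → ℝ → ℝ) (c : ℝ) (x : X) (y : ℝ) :
    (FS P f ^ n) (fun w u => c * F w u) x y = c * (FS P f ^ n) F x y := by
  have : (fun w u => c * F w u) = c • F := rfl
  rw [this, map_smul]; rfl

lemma KS_smul (P : X → X → ℝ) (f : X → ℝ) (n : ℕ) (F : X → ℝ → ℝ) (c : ℝ) (x : X) (y : ℝ) :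
    (KS P f ^ n) (fun w u => c * F w u) x y = c * (KS P f ^ n) F x y := by
  have : (fun w u => c * F w u) = c • F := rfl
  rw [this, map_smul]; rfl

lemma KS_addf (P : X → X → ℝ) (f : X → ℝ) (n : ℕ) (F G : X → ℝ → ℝ) (x : X) (y : ℝ) :
    (KS P f ^ n) (fun w u => F w u + G w u) x y = (KS P f ^ n) F x y + (KS P f ^ n) G x y := by
  have : (fun w u => F w u + G w u) = F + G := rfl
  rw [this, map_add]; rfl

lemma KS_subf (P : X → X → ℝ) (f : X → ℝ) (n : ℕ) (F G : X → ℝ → ℝ) (x : X) (y : ℝ) :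
    (KS P f ^ n) (fun w u => F w u - G w u) x y = (KS P f ^ n) F x y - (KS P f ^ n) G x y := by
  have : (fun w u => F w u - G w u) = F - G := rfl
  rw [this, map_sub]; rfl

/-- Concentration bound. -/
lemma conc {P : X → X → ℝ} {ν f : X → ℝ} (hG : Good P ν f) :
    ∃ C : ℝ, 0 < C ∧ ∀ U : ℝ, 1 ≤ U → ∀ i : ℕ, 1 ≤ i → ∀ (e : ℝ) x u,
      (FS P f ^ i) (fun _ v => Gk ((v + e) / U)) x u ≤ C * U / √i := by
  obtain ⟨C, c, hC, hc, H⟩ := FS_sin_bd hG 1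
  refine ⟨2 * C * (√(π / c) / 2), by have := Real.pi_pos; positivity, fun U hU i hi e x u => ?_⟩
  have hU0 : 0 < U := by linarith
  have hi0 : (0:ℝ) < i := by exact_mod_cast hi
  have e1 : (fun (_ : X) v => Gk ((v + e) / U)) = fun _ v => ∫ t in Set.Ioc (0:ℝ) 1,
      (1 - t) * (1 + Real.cos (π * t)) * Real.cos (t / U * (v + e)) := by
    ext _ v
    unfold Gk
    rw [intervalIntegral.integral_of_le zero_le_one]
    refine setIntegral_congr_fun measurableSet_Ioc fun t _ => ?_
    congr 2
    field_simp
  have hIntg : ∀ (w : X) (v : ℝ), Integrable (fun t => (1 - t) * (1 + Real.cos (π * t)) *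
      Real.cos (t / U * (v + e))) (volume.restrict (Set.Ioc (0:ℝ) 1)) := by
    intro w v
    exact (Continuous.integrableOn_Icc (by fun_prop)).mono_set Set.Ioc_subset_Icc_self
  obtain ⟨i1, i2⟩ := FS_integral (volume.restrict (Set.Ioc (0:ℝ) 1)) P f i
    (φ := fun t (_ : X) v => (1 - t) * (1 + Real.cos (π * t)) * Real.cos (t / U * (v + e))) hIntg x u
  rw [e1, i2]
  have hb : 0 < c * i / U ^ 2 := by positivity
  have ig : Integrable fun t : ℝ => 2 * C * Real.exp (-(c * i / U ^ 2) * t ^ 2) :=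
    (integrable_exp_neg_mul_sq hb).const_mul _
  calc _ ≤ ∫ t in Set.Ioc (0:ℝ) 1, 2 * C * Real.exp (-(c * i / U ^ 2) * t ^ 2) := by
        refine setIntegral_mono_on i1 ig.integrableOn measurableSet_Ioc fun t ht => ?_
        rw [FS_smul]
        have h1 := (H (t / U) ⟨div_nonneg ht.1.le hU0.le, (div_le_one hU0).2 (ht.2.trans hU)⟩ i
          (fun _ => 1) 1 (by simp) e x u).2.1
        simp only [one_mul, mul_one] at h1
        have h2 : -c * i * (t / U) ^ 2 = -(c * i / U ^ 2) * t ^ 2 := by field_simp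
        rw [h2] at h1
        have h3 := le_abs_self ((FS P f ^ i) (fun _ v => Real.cos (t / U * (v + e))) x u)
        have h4 : |(1 - t) * (1 + Real.cos (π * t))| ≤ 2 := by
          rw [abs_mul, abs_of_nonneg (by linarith [ht.2]),
            abs_of_nonneg (by linarith [Real.neg_one_le_cos (π * t)])]
          nlinarith [Real.cos_le_one (π * t), ht.1, ht.2, Real.neg_one_le_cos (π * t)]
        refine (le_abs_self _).trans ?_
        rw [abs_mul, mul_assoc]
        exact mul_le_mul h4 h1 (abs_nonneg _) (by norm_num)
    _ ≤ ∫ t in Set.Ioi (0:ℝ), 2 * C * Real.exp (-(c * i / U ^ 2) * t ^ 2) :=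
        setIntegral_mono_set ig.integrableOn
          (Eventually.of_forall fun t => by positivity)
          (Set.Ioc_subset_Ioi_self.eventuallyLE)
    _ = _ := by
        rw [integral_const_mul, integral_gaussian_Ioi]
        have : π / (c * i / U ^ 2) = π / c * (U / √i) ^ 2 := by
          rw [div_pow, Real.sq_sqrt hi0.le]; field_simp
        rw [this, Real.sqrt_mul (by have := Real.pi_pos; positivity), Real.sqrt_sq (by positivity)]
        ring

/-- Survival probability. -/
noncomputable def Tn (P : X → X → ℝ) (f : X → ℝ) (n : ℕ) (x : X) (y : ℝ) : ℝ :=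
  (KS P f ^ n) (fun _ _ => 1) x y

lemma FS_one {P : X → X → ℝ} {ν : X → ℝ} (hS : IsStochastic P ν) (f : X → ℝ) (n : ℕ) (x : X)
    (y : ℝ) : (FS P f ^ n) (fun _ _ => 1) x y = 1 := by
  induction n generalizing x y with
  | zero => rfl
  | succ n ih => rw [FS_succ]; simp only [ih, mul_one]; exact hS.rowSum x

lemma Tn_nonneg {P : X → X → ℝ} {ν : X → ℝ} (hS : IsStochastic P ν) (f : X → ℝ) (n : ℕ) (x : X)
    (y : ℝ) : 0 ≤ Tn P f n x y := KS_nonneg hS.nonneg f n x y fun _ _ _ => zero_le_one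

lemma Tn_le_one {P : X → X → ℝ} {ν : X → ℝ} (hS : IsStochastic P ν) (f : X → ℝ) (n : ℕ) (x : X)
    (y : ℝ) : Tn P f n x y ≤ 1 := by
  rw [← FS_one hS f n x y]
  exact (KS_le_FS hS.nonneg f n (fun _ _ => zero_le_one) x y).1

lemma KS_const (P : X → X → ℝ) (f : X → ℝ) (n : ℕ) (c : ℝ) (x : X) (y : ℝ) :
    (KS P f ^ n) (fun _ _ => c) x y = c * Tn P f n x y := by
  have := KS_smul P f n (fun _ _ => 1) c x y
  simpa [Tn] using this

lemma Tn_mono {P : X → X → ℝ} {ν : X → ℝ} (hS : IsStochastic P ν) (f : X → ℝ) (n : ℕ) (x : X)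
    {y R : ℝ} (h : y ≤ R) : Tn P f n x y ≤ Tn P f n x R := by
  have := KS_mono_start hS.nonneg f n (F := fun _ _ => 1) (G := fun _ _ => 1)
    (fun _ _ => zero_le_one) (R - y) (by linarith) (fun _ _ => le_rfl) x y
  rwa [add_sub_cancel] at this

/-- exit term -/
lemma exit_eq {P : X → X → ℝ} {ν : X → ℝ} (hS : IsStochastic P ν) (f : X → ℝ) (j : ℕ) (x : X)
    (y : ℝ) : (KS P f ^ j) (ES P f (fun _ _ => 1)) x y = Tn P f j x y - Tn P f (j + 1) x y := by
  have h1 : ES P f (fun _ _ => 1) = fun w u => (1:ℝ) - KS P f (fun _ _ => 1) w u := by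
    have h := KS_eq P f
    ext w u
    have h2 : KS P f (fun _ _ => 1) w u = FS P f (fun _ _ => 1) w u - ES P f (fun _ _ => 1) w u := by
      rw [h]; rfl
    have h3 := FS_one hS f 1 w u
    rw [pow_one] at h3
    rw [h2, h3]; ring
  rw [h1, KS_subf]
  unfold Tn
  rw [KS_add, pow_one]

lemma exit_sum {P : X → X → ℝ} {ν : X → ℝ} (hS : IsStochastic P ν) (f : X → ℝ) (m : ℕ) (x : X)
    (y : ℝ) : ∑ j ∈ range m, (KS P f ^ j) (ES P f (fun _ _ => 1)) x y ≤ 1 := by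
  simp only [exit_eq hS]
  rw [Finset.sum_range_sub' (fun j => Tn P f j x y)]
  have := Tn_nonneg hS f m x y
  have := Tn_le_one hS f 0 x y
  linarith

lemma ES_nonneg {P : X → X → ℝ} {ν : X → ℝ} (hS : IsStochastic P ν) (f : X → ℝ) (x : X)
    (y : ℝ) : 0 ≤ ES P f (fun _ _ => 1) x y := by
  rw [ES_apply]
  refine Finset.sum_nonneg fun x' _ => mul_nonneg (hS.nonneg _ _) ?_
  split_ifs <;> norm_num

/-- The existence of `V`. -/
def HasV (P : X → X → ℝ) (ν f : X → ℝ) (V : X → ℝ → ℝ) : Prop :=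
  ∀ x y, Tendsto (fun n : ℕ => √(sigma2 P ν f) * √(2 * π * n) / 2 * Tn P f n x y) atTop
    (𝓝 (V x y))

lemma surv {P : X → X → ℝ} {ν f : X → ℝ} (hG : Good P ν f) {V : X → ℝ → ℝ} (hV : HasV P ν f V)
    (R : ℝ) : ∃ C : ℝ, 0 < C ∧ ∀ (n : ℕ) x y, y ≤ R → Tn P f n x y ≤ C / √(n + 1) := by
  have hσ := sigma_pos hG
  have hp := Real.pi_pos
  have h1 : ∀ x, ∃ C, ∀ n : ℕ,
      √(sigma2 P ν f) * √(2 * π * n) / 2 * Tn P f n x R ≤ C := by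
    intro x
    obtain ⟨C, hC⟩ := (hV x R).bddAbove_range
    exact ⟨C, fun n => hC ⟨n, rfl⟩⟩
  choose C hC using h1
  obtain ⟨M, hM⟩ := exists_bd C
  set s := √(sigma2 P ν f) * √(2 * π) / 2 with hs
  have hs0 : 0 < s := by positivity
  have hM0 : 0 ≤ M := (abs_nonneg _).trans (hM (Classical.arbitrary X))
  refine ⟨2 * (M / s) + 1, by positivity, fun n x y hy => (Tn_mono hG.st f n x hy).trans ?_⟩
  rw [le_div_iff₀ (by positivity)]
  rcases Nat.eq_zero_or_pos n with rfl | hn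
  · have := Tn_le_one hG.st f 0 x R
    simp
    have : 0 ≤ M / s := by positivity
    linarith
  · have h2 := (hC x n).trans ((le_abs_self _).trans (hM x))
    have e1 : √(2 * π * n) = √(2 * π) * √n := Real.sqrt_mul (by positivity) _
    have h3 : √n * Tn P f n x R ≤ M / s := by
      rw [le_div_iff₀ hs0, hs]; rw [e1] at h2; linarith
    have h4 : √((n:ℝ) + 1) ≤ 2 * √n := by
      rw [show (2:ℝ) * √n = √(4 * n) by
        rw [Real.sqrt_mul (by norm_num), show (4:ℝ) = 2 ^ 2 by norm_num,
          Real.sqrt_sq (by norm_num)]]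
      refine Real.sqrt_le_sqrt ?_
      have : (1:ℝ) ≤ n := by exact_mod_cast hn
      linarith
    have h5 := mul_le_mul_of_nonneg_left h4 (Tn_nonneg hG.st f n x R)
    linarith

lemma Gk_low' (U v : ℝ) (hU : 0 < U) : 1 / (U ^ 2 + v ^ 2) ≤ π ^ 2 / U ^ 2 * Gk (v / U) := by
  have hp := Real.pi_gt_three
  have h1 := Gk_low (v / U)
  have h0 := Gk_nonneg (v / U)
  set w := v / U with hw
  have hv : v = w * U := by rw [hw]; field_simp
  rw [hv, div_le_iff₀ (by positivity)]
  have h2 : (|w| + π) ^ 2 ≤ 2 * π ^ 2 * (1 + w ^ 2) := by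
    have : w ^ 2 = |w| ^ 2 := (sq_abs _).symm
    rw [this]
    nlinarith [sq_nonneg (|w| - π), sq_nonneg (|w|), mul_nonneg (sq_nonneg |w|) (show 0 ≤ π ^ 2 - 1 by nlinarith)]
  have h3 := mul_le_mul_of_nonneg_left h2 h0
  have : π ^ 2 / U ^ 2 * Gk w * (U ^ 2 + (w * U) ^ 2) = Gk w * (π ^ 2 * (1 + w ^ 2)) := by
    field_simp
  rw [this]; linarith

/-- Localisation bound. -/
lemma loc {P : X → X → ℝ} {ν f : X → ℝ} (hG : Good P ν f) {V : X → ℝ → ℝ} (hV : HasV P ν f V)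
    (R : ℝ) : ∃ C : ℝ, 0 < C ∧ ∀ U : ℝ, 1 ≤ U → ∀ (n : ℕ) x y, y ≤ R →
      (KS P f ^ n) (fun _ v => 1 / (U ^ 2 + v ^ 2)) x y ≤ C / (U * (n + 1)) := by
  obtain ⟨C1, hC1, H1⟩ := conc hG
  obtain ⟨C2, hC2, H2⟩ := surv hG hV R
  have hp := Real.pi_pos
  refine ⟨π ^ 2 * C1 * C2 * 4 + 1, by positivity, fun U hU n x y hy => ?_⟩
  have hU0 : 0 < U := by linarith
  rcases Nat.eq_zero_or_pos n with rfl | hn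
  · simp only [pow_zero, Module.End.one_apply, Nat.cast_zero, zero_add, mul_one]
    rw [div_le_div_iff₀ (by positivity) hU0]
    have : U ≤ U ^ 2 + y ^ 2 := by nlinarith
    have : 0 ≤ π ^ 2 * C1 * C2 * 4 * (U ^ 2 + y ^ 2) := by positivity
    linarith
  · obtain ⟨m, k, hmk, hk1, hm, hk⟩ : ∃ m k : ℕ, n = m + k ∧ 1 ≤ k ∧ n + 1 ≤ 2 * (m + 1) ∧
        n + 1 ≤ 4 * k := ⟨n / 2, n - n / 2, by omega, by omega, by omega, by omega⟩
    have hb : ∀ w u, (KS P f ^ k) (fun _ v => 1 / (U ^ 2 + v ^ 2)) w u ≤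
        π ^ 2 / U ^ 2 * (C1 * U / √k) := by
      intro w u
      refine (KS_le_FS hG.st.nonneg f k (fun _ v => by positivity) w u).1.trans ?_
      refine (FS_mono hG.st.nonneg f k (G := fun _ v => π ^ 2 / U ^ 2 * Gk ((v + 0) / U))
        (fun _ v => by rw [add_zero]; exact Gk_low' U v hU0) w u).trans ?_
      rw [FS_smul]
      exact mul_le_mul_of_nonneg_left (H1 U hU k hk1 0 w u) (by positivity)
    rw [hmk, KS_add]
    refine (KS_mono hG.st.nonneg f m (G := fun _ _ => π ^ 2 / U ^ 2 * (C1 * U / √k)) x y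
      fun w u _ => hb w u).trans ?_
    rw [KS_const]
    have hk0 : (0:ℝ) < k := by exact_mod_cast hk1
    have h3 := mul_le_mul_of_nonneg_left (H2 m x y hy)
      (show 0 ≤ π ^ 2 / U ^ 2 * (C1 * U / √k) by positivity)
    refine h3.trans ?_
    have e1 : π ^ 2 / U ^ 2 * (C1 * U / √k) * (C2 / √(m + 1)) =
        π ^ 2 * C1 * C2 / U * (1 / (√k * √(m + 1))) := by field_simp
    have e2 : 1 / (√k * √((m:ℝ) + 1)) ≤ 4 / (n + 1) := by
      rw [← Real.sqrt_mul hk0.le, div_le_div_iff₀ (by positivity) (by positivity), one_mul]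
      rw [show (4:ℝ) * √(k * (m + 1)) = √(16 * (k * (m + 1))) by
        rw [Real.sqrt_mul (by norm_num : (0:ℝ) ≤ 16), show (16:ℝ) = 4 ^ 2 by norm_num,
          Real.sqrt_sq (by norm_num)]]
      refine Real.le_sqrt_of_sq_le ?_
      have a1 : (n:ℝ) + 1 ≤ 2 * (m + 1) := by exact_mod_cast hm
      have a2 : (n:ℝ) + 1 ≤ 4 * k := by exact_mod_cast hk
      nlinarith
    rw [e1]
    refine (mul_le_mul_of_nonneg_left e2 (by positivity)).trans ?_
    rw [hmk]; push_cast
    rw [div_mul_div_comm]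
    gcongr
    linarith

end PartE


section PartE2
variable [Fintype X] [DecidableEq X] [Nonempty X]

lemma exit_bd {P : X → X → ℝ} {ν f : X → ℝ} (hG : Good P ν f) {V : X → ℝ → ℝ}
    (hV : HasV P ν f V) (R : ℝ) : ∃ C : ℝ, 0 < C ∧ ∀ (j : ℕ) x y, |y| ≤ R →
      (KS P f ^ j) (ES P f (fun _ _ => 1)) x y ≤ C / (j + 1) := by
  obtain ⟨C, hC, H⟩ := loc hG hV R
  obtain ⟨B, hB⟩ := exists_bd f
  refine ⟨(1 + (B + R) ^ 2) * C, by positivity, fun j x y hy => ?_⟩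
  have hR : 0 ≤ R := (abs_nonneg _).trans hy
  have hB0 : 0 ≤ B := (abs_nonneg _).trans (hB x)
  have h1 := H 1 le_rfl j x y ((le_abs_self _).trans hy)
  rw [one_mul] at h1
  calc _ ≤ (KS P f ^ j) (fun _ v => (1 + (B + R) ^ 2) * (1 / (1 ^ 2 + v ^ 2))) x y := by
        refine KS_mono hG.st.nonneg f j x y fun w u hu => ?_
        by_cases hub : |u| ≤ B + R
        · have h2 : ES P f (fun _ _ => 1) w u ≤ 1 := by
            rw [ES_apply]
            refine le_trans ?_ (hG.st.rowSum w).le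
            refine Finset.sum_le_sum fun x' _ => ?_
            have := hG.st.nonneg w x'
            split_ifs <;> simp [this]
          refine h2.trans ?_
          rw [mul_one_div, le_div_iff₀ (by positivity), one_mul]
          have : u ^ 2 ≤ (B + R) ^ 2 := by
            rw [← sq_abs]; exact pow_le_pow_left₀ (abs_nonneg _) hub 2
          linarith
        · have h2 : ES P f (fun _ _ => 1) w u = 0 := by
            rw [ES_apply]
            refine Finset.sum_eq_zero fun x' _ => ?_
            rw [if_pos, mul_zero]
            push Not at hub
            have hu0 : 0 < u := by
              rcases hu with hu | hu
              · exact hu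
              · exfalso; rw [hu] at hub; linarith
            rw [abs_of_pos hu0] at hub
            have := (abs_le.1 (hB x')).1
            linarith
          rw [h2]; positivity
    _ ≤ _ := by
      rw [KS_smul, mul_div_assoc]
      exact mul_le_mul_of_nonneg_left h1 (by positivity)

/-- Bound for one exit term in Duhamel's formula. -/
lemma exit_term {P : X → X → ℝ} {ν f : X → ℝ} (hG : Good P ν f) (K R : ℝ) :
    ∃ C c : ℝ, 0 < C ∧ 0 < c ∧ ∀ t ∈ Set.Icc 0 K, ∀ (i j : ℕ) (φ : X → ℝ) (M : ℝ),
      (∀ x, |φ x| ≤ M) → ∀ e : ℝ, |e| ≤ 1 → ∀ x y, -R ≤ y →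
      |(KS P f ^ j) (ES P f ((FS P f ^ i) (fun x u => φ x * Real.sin (t * (u + e))))) x y| ≤
        C * t * Real.exp (-c * i * t ^ 2) * M * (KS P f ^ j) (ES P f (fun _ _ => 1)) x y := by
  obtain ⟨C, c, hC, hc, H⟩ := FS_sin_bd hG K
  obtain ⟨B, hB⟩ := exists_bd f
  refine ⟨C * (2 + |B| + |R|), c, by positivity, hc, fun t ht i j φ M hM e he x y hy => ?_⟩
  have hM0 : 0 ≤ M := (abs_nonneg _).trans (hM x)
  have ht0 := ht.1
  rw [← KS_smul]
  refine KS_abs hG.st.nonneg f j x y fun w u hu => ?_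
  have hu' : -|R| ≤ u := by
    rcases hu with hu | hu
    · linarith [abs_nonneg R]
    · rw [hu]; linarith [le_abs_self R]
  rw [ES_apply, ES_apply, Finset.mul_sum]
  refine (Finset.abs_sum_le_sum_abs _ _).trans (Finset.sum_le_sum fun x' _ => ?_)
  rw [abs_mul, abs_of_nonneg (hG.st.nonneg _ _)]
  split_ifs with h
  · simp
  · rw [mul_one, mul_comm]
    refine mul_le_mul_of_nonneg_right ?_ (hG.st.nonneg _ _)
    have h1 := (H t ht i φ M hM e x' (u + f x')).1
    refine h1.trans ?_
    have h2 : 1 + |u + f x' + e| ≤ 2 + |B| + |R| := by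
      have h3 : |u + f x'| ≤ |B| + |R| := by
        push Not at h
        rw [abs_of_nonpos h]
        have := (abs_le.1 (hB x')).1
        linarith [le_abs_self B]
      have := abs_add_le (u + f x') e
      linarith
    calc _ = (C * t * Real.exp (-c * i * t ^ 2) * M) * (1 + |u + f x' + e|) := by ring
      _ ≤ (C * t * Real.exp (-c * i * t ^ 2) * M) * (2 + |B| + |R|) :=
        mul_le_mul_of_nonneg_left h2 (by positivity)
      _ = _ := by ring

lemma exp_neg_le_inv (a : ℝ) (ha : 0 ≤ a) : Real.exp (-a) ≤ 1 / (1 + a) := by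
  rw [Real.exp_neg, ← one_div]
  exact one_div_le_one_div_of_le (by linarith) (by linarith [Real.add_one_le_exp a])

/-- Killed versus free, fine comparison. -/
lemma KSFS {P : X → X → ℝ} {ν f : X → ℝ} (hG : Good P ν f) (K R : ℝ) :
    ∃ C : ℝ, 0 < C ∧ ∀ t ∈ Set.Icc 0 K, ∀ (k : ℕ) (φ : X → ℝ) (M : ℝ),
      (∀ x, |φ x| ≤ M) → ∀ e : ℝ, |e| ≤ 1 → ∀ x y, -R ≤ y →
      |(KS P f ^ k) (fun x u => φ x * Real.sin (t * (u + e))) x y -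
        Real.sin (t * (y + e)) * ((PT P f t ^ k) (fun x => (φ x : ℂ)) x).re| ≤ C * t * M := by
  obtain ⟨C, c, hC, hc, H⟩ := FS_sin_bd hG K
  obtain ⟨C1, c1, hC1, hc1, H1⟩ := exit_term hG K R
  refine ⟨C + C1, by positivity, fun t ht k φ M hM e he x y hy => ?_⟩
  have hM0 : 0 ≤ M := (abs_nonneg _).trans (hM x)
  have ht0 := ht.1
  have h1 : |(FS P f ^ k) (fun x u => φ x * Real.sin (t * (u + e))) x y -
        Real.sin (t * (y + e)) * ((PT P f t ^ k) (fun x => (φ x : ℂ)) x).re| ≤ C * t * M := by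
    refine (H t ht k φ M hM e x y).2.2.trans ?_
    have : Real.exp (-c * k * t ^ 2) ≤ 1 := Real.exp_le_one_iff.2 (by
      have : 0 ≤ c * k * t ^ 2 := by positivity
      linarith)
    calc _ = C * t * M * Real.exp (-c * k * t ^ 2) := by ring
      _ ≤ C * t * M * 1 := mul_le_mul_of_nonneg_left this (by positivity)
      _ = _ := by ring
  have h2 : |∑ j ∈ range k, (KS P f ^ j) (ES P f ((FS P f ^ (k - 1 - j))
      (fun x u => φ x * Real.sin (t * (u + e))))) x y| ≤ C1 * t * M := by
    refine (Finset.abs_sum_le_sum_abs _ _).trans ?_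
    calc _ ≤ ∑ j ∈ range k, C1 * t * M * (KS P f ^ j) (ES P f (fun _ _ => 1)) x y := by
          refine Finset.sum_le_sum fun j _ => (H1 t ht (k - 1 - j) j φ M hM e he x y hy).trans ?_
          refine mul_le_mul_of_nonneg_right ?_
            (KS_nonneg hG.st.nonneg f j x y fun w u _ => ES_nonneg hG.st f w u)
          have : Real.exp (-c1 * (k - 1 - j : ℕ) * t ^ 2) ≤ 1 := Real.exp_le_one_iff.2 (by
            have : 0 ≤ c1 * (k - 1 - j : ℕ) * t ^ 2 := by positivity
            linarith)
          calc _ = C1 * t * M * Real.exp (-c1 * (k - 1 - j : ℕ) * t ^ 2) := by ring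
            _ ≤ C1 * t * M * 1 := mul_le_mul_of_nonneg_left this (by positivity)
            _ = _ := by ring
      _ ≤ _ := by
          rw [← Finset.mul_sum]
          have := mul_le_mul_of_nonneg_left (exit_sum hG.st f k x y)
            (show 0 ≤ C1 * t * M by positivity)
          linarith
  rw [duhamel, Pi.sub_apply, Pi.sub_apply, Finset.sum_apply, Finset.sum_apply]
  calc _ = |((FS P f ^ k) (fun x u => φ x * Real.sin (t * (u + e))) x y -
        Real.sin (t * (y + e)) * ((PT P f t ^ k) (fun x => (φ x : ℂ)) x).re) -
        ∑ j ∈ range k, (KS P f ^ j) (ES P f ((FS P f ^ (k - 1 - j))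
      (fun x u => φ x * Real.sin (t * (u + e))))) x y| := by congr 1; ring
    _ ≤ _ := abs_sub _ _
    _ ≤ C * t * M + C1 * t * M := add_le_add h1 h2
    _ = _ := by ring

/-- F4. -/
lemma F4 {P : X → X → ℝ} {ν f : X → ℝ} (hG : Good P ν f) {V : X → ℝ → ℝ}
    (hV : HasV P ν f V) (K R : ℝ) :
    ∃ C : ℝ, 0 < C ∧ ∀ t ∈ Set.Icc 0 K, ∀ (m : ℕ) (φ : X → ℝ) (M : ℝ),
      (∀ x, |φ x| ≤ M) → ∀ e : ℝ, |e| ≤ 1 → ∀ x y, |y| ≤ R →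
      |(KS P f ^ m) (fun x u => φ x * Real.sin (t * (u + e))) x y| ≤
        C * t / (1 + m * t ^ 2) * M := by
  obtain ⟨C0, c0, hC0, hc0, H0⟩ := FS_sin_bd hG K
  obtain ⟨C1, c1, hC1, hc1, H1⟩ := exit_term hG K R
  obtain ⟨C2, hC2, H2⟩ := exit_bd hG hV R
  set c := min (min c0 c1) 1 with hc
  have hcp : 0 < c := lt_min (lt_min hc0 hc1) one_pos
  have hc1' : c ≤ 1 := min_le_right _ _
  have hcc0 : c ≤ c0 := (min_le_left _ _).trans (min_le_left _ _)
  have hcc1 : c ≤ c1 := (min_le_left _ _).trans (min_le_right _ _)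
  refine ⟨C0 * (2 + |R|) / c + C1 * (1 / c + C2 * ((1 + c * K ^ 2) / c)), by positivity,
    fun t ht m φ M hM e he x y hy => ?_⟩
  have hM0 : 0 ≤ M := (abs_nonneg _).trans (hM x)
  have ht0 := ht.1
  have hex : ∀ a : ℝ, c ≤ a → ∀ i : ℕ, Real.exp (-a * i * t ^ 2) ≤ Real.exp (-(c * (i * t ^ 2))) := by
    intro a ha i
    refine Real.exp_le_exp.2 ?_
    have : c * (i * t ^ 2) ≤ a * (i * t ^ 2) := mul_le_mul_of_nonneg_right ha (by positivity)
    linarith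
  have hinv : ∀ i : ℕ, Real.exp (-(c * (i * t ^ 2))) * (1 + i * t ^ 2) ≤ 1 / c := by
    intro i
    have h1 := exp_neg_le_inv (c * (i * t ^ 2)) (by positivity)
    have hi : 0 ≤ (i : ℝ) * t ^ 2 := by positivity
    refine (mul_le_mul_of_nonneg_right h1 (by positivity)).trans ?_
    rw [one_div_mul_eq_div, div_le_div_iff₀ (by positivity) hcp]
    nlinarith
  rw [div_mul_eq_mul_div, le_div_iff₀ (by positivity)]
  have hm0 : 0 ≤ 1 + m * t ^ 2 := by positivity
  have h1 : |(FS P f ^ m) (fun x u => φ x * Real.sin (t * (u + e))) x y| * (1 + m * t ^ 2) ≤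
      C0 * (2 + |R|) / c * (t * M) := by
    have a1 := (H0 t ht m φ M hM e x y).1
    have a2 : 1 + |y + e| ≤ 2 + |R| := by
      have := abs_add_le y e
      linarith [le_abs_self R]
    calc _ ≤ (C0 * t * (2 + |R|) * Real.exp (-(c * (m * t ^ 2))) * M) * (1 + m * t ^ 2) := by
          refine mul_le_mul_of_nonneg_right (a1.trans ?_) hm0
          have := hex c0 hcc0 m
          gcongr
      _ = C0 * t * (2 + |R|) * M * (Real.exp (-(c * (m * t ^ 2))) * (1 + m * t ^ 2)) := by ring
      _ ≤ C0 * t * (2 + |R|) * M * (1 / c) := mul_le_mul_of_nonneg_left (hinv m) (by positivity)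
      _ = _ := by ring
  set p : ℕ → ℝ := fun j => (KS P f ^ j) (ES P f (fun _ _ => 1)) x y with hp
  have hp0 : ∀ j, 0 ≤ p j := fun j =>
    KS_nonneg hG.st.nonneg f j x y fun w u _ => ES_nonneg hG.st f w u
  have hgeo : t ^ 2 * ∑ j ∈ range m, Real.exp (-(c * ((m - 1 - j : ℕ) * t ^ 2))) ≤
      (1 + c * K ^ 2) / c := by
    rw [Finset.sum_range_reflect (fun i : ℕ => Real.exp (-(c * (i * t ^ 2)))) m]
    set q := Real.exp (-(c * t ^ 2)) with hq
    have hq1 : ∀ i : ℕ, Real.exp (-(c * (i * t ^ 2))) = q ^ i := by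
      intro i; rw [hq, ← Real.exp_nat_mul]; congr 1; ring
    simp only [hq1]
    have hq0 : 0 < q := Real.exp_pos _
    have g1 : (1 - q) * ∑ i ∈ range m, q ^ i ≤ 1 := by
      have := geom_sum_mul q m
      have : (0:ℝ) < q ^ m := by positivity
      nlinarith
    have g2 := exp_neg_le_inv (c * t ^ 2) (by positivity)
    have g3 : c * t ^ 2 ≤ (1 - q) * (1 + c * K ^ 2) := by
      have hKt : t ^ 2 ≤ K ^ 2 := pow_le_pow_left₀ ht.1 ht.2 2
      rw [← hq, le_div_iff₀ (by positivity)] at g2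
      have hq1 : q ≤ 1 := Real.exp_le_one_iff.2 (by
        have : 0 ≤ c * t ^ 2 := by positivity
        linarith)
      have : c * t ^ 2 ≤ c * K ^ 2 := mul_le_mul_of_nonneg_left hKt hcp.le
      nlinarith
    have hs : 0 ≤ ∑ i ∈ range m, q ^ i := Finset.sum_nonneg fun i _ => by positivity
    rw [le_div_iff₀ hcp]
    calc _ = c * t ^ 2 * ∑ i ∈ range m, q ^ i := by ring
      _ ≤ (1 - q) * (1 + c * K ^ 2) * ∑ i ∈ range m, q ^ i := mul_le_mul_of_nonneg_right g3 hs
      _ = (1 + c * K ^ 2) * ((1 - q) * ∑ i ∈ range m, q ^ i) := by ring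
      _ ≤ (1 + c * K ^ 2) * 1 := mul_le_mul_of_nonneg_left g1 (by positivity)
      _ = _ := by ring
  have hsum : (∑ j ∈ range m, Real.exp (-(c * ((m - 1 - j : ℕ) * t ^ 2))) * p j) *
      (1 + m * t ^ 2) ≤ 1 / c + C2 * ((1 + c * K ^ 2) / c) := by
    rw [Finset.sum_mul]
    calc _ ≤ ∑ j ∈ range m, (1 / c * p j +
          C2 * (t ^ 2 * Real.exp (-(c * ((m - 1 - j : ℕ) * t ^ 2))))) := by
          refine Finset.sum_le_sum fun j hj => ?_
          have hj' := Finset.mem_range.1 hj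
          set i := m - 1 - j with hi
          have hm : (m : ℝ) = i + (j + 1) := by
            have : m = i + (j + 1) := by omega
            exact_mod_cast this
          have q1 := hinv i
          have q2 : p j * (j + 1) ≤ C2 := by
            have := H2 j x y hy
            rwa [le_div_iff₀ (by positivity)] at this
          have q3 := mul_le_mul_of_nonneg_right q1 (hp0 j)
          have q4 := mul_le_mul_of_nonneg_right q2
            (show 0 ≤ t ^ 2 * Real.exp (-(c * (i * t ^ 2))) by positivity)
          rw [hm]
          calc _ = Real.exp (-(c * (i * t ^ 2))) * (1 + i * t ^ 2) * p j +
              p j * (j + 1) * (t ^ 2 * Real.exp (-(c * (i * t ^ 2)))) := by ring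
            _ ≤ _ := add_le_add q3 q4
      _ ≤ _ := by
          rw [Finset.sum_add_distrib, ← Finset.mul_sum, ← Finset.mul_sum, ← Finset.mul_sum]
          refine add_le_add ?_ (mul_le_mul_of_nonneg_left hgeo hC2.le)
          have := mul_le_mul_of_nonneg_left (exit_sum hG.st f m x y)
            (show 0 ≤ 1 / c by positivity)
          simpa using this
  have h2 : |∑ j ∈ range m, (KS P f ^ j) (ES P f ((FS P f ^ (m - 1 - j))
      (fun x u => φ x * Real.sin (t * (u + e))))) x y| * (1 + m * t ^ 2) ≤
      C1 * (1 / c + C2 * ((1 + c * K ^ 2) / c)) * (t * M) := by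
    calc _ ≤ (∑ j ∈ range m, C1 * t * M *
          (Real.exp (-(c * ((m - 1 - j : ℕ) * t ^ 2))) * p j)) * (1 + m * t ^ 2) := by
          refine mul_le_mul_of_nonneg_right ?_ hm0
          refine (Finset.abs_sum_le_sum_abs _ _).trans (Finset.sum_le_sum fun j _ => ?_)
          refine (H1 t ht (m - 1 - j) j φ M hM e he x y (abs_le.1 hy).1).trans ?_
          have := mul_le_mul_of_nonneg_left (mul_le_mul_of_nonneg_right
            (hex c1 hcc1 (m - 1 - j)) (hp0 j)) (show 0 ≤ C1 * t * M by positivity)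
          refine le_trans (le_of_eq ?_) this
          ring
      _ = C1 * t * M * ((∑ j ∈ range m, Real.exp (-(c * ((m - 1 - j : ℕ) * t ^ 2))) * p j) *
          (1 + m * t ^ 2)) := by rw [← Finset.mul_sum]; ring
      _ ≤ C1 * t * M * (1 / c + C2 * ((1 + c * K ^ 2) / c)) :=
          mul_le_mul_of_nonneg_left hsum (by positivity)
      _ = _ := by ring
  rw [duhamel, Pi.sub_apply, Pi.sub_apply, Finset.sum_apply, Finset.sum_apply]
  calc _ ≤ (|(FS P f ^ m) (fun x u => φ x * Real.sin (t * (u + e))) x y| +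
        |∑ j ∈ range m, (KS P f ^ j) (ES P f ((FS P f ^ (m - 1 - j))
        (fun x u => φ x * Real.sin (t * (u + e))))) x y|) * (1 + m * t ^ 2) :=
        mul_le_mul_of_nonneg_right (abs_sub _ _) hm0
    _ ≤ _ := by rw [add_mul]; exact (add_le_add h1 h2).trans (le_of_eq (by ring))

end PartE2


section PartF
variable [Fintype X] [DecidableEq X] [Nonempty X]

lemma sin_slope (a : ℝ) {t : ℕ → ℝ} (ht : Tendsto t atTop (𝓝 0)) (htp : ∀ᶠ n in atTop, 0 < t n) :
    Tendsto (fun n => Real.sin (t n * a) / t n) atTop (𝓝 a) := by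
  have h0 : HasDerivAt (fun t : ℝ => Real.sin (t * a)) a 0 := by
    have h1 : HasDerivAt (fun t : ℝ => t * a) a 0 := by simpa using (hasDerivAt_id (0:ℝ)).mul_const a
    simpa using h1.sin
  rw [hasDerivAt_iff_tendsto_slope_zero] at h0
  have h2 : Tendsto t atTop (𝓝[≠] 0) :=
    tendsto_nhdsWithin_iff.2 ⟨ht, htp.mono fun n hn => hn.ne'⟩
  refine (h0.comp h2).congr fun n => ?_
  simp [div_eq_inv_mul]

lemma KS_lim (P : X → X → ℝ) (f : X → ℝ) (l : ℕ) (x : X) (y : ℝ) {F : ℕ → X → ℝ → ℝ}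
    {G : X → ℝ → ℝ} (h : ∀ w u, Tendsto (fun n => F n w u) atTop (𝓝 (G w u))) :
    Tendsto (fun n => (KS P f ^ l) (F n) x y) atTop (𝓝 ((KS P f ^ l) G x y)) := by
  obtain ⟨c, w, u, H⟩ := KS_sum P f l x y
  simp only [H]
  exact tendsto_finsetSum _ fun p _ => (h _ _).const_mul _

lemma F5a {P : X → X → ℝ} {ν f : X → ℝ} (hG : Good P ν f) (y : ℝ) :
    ∃ C : ℝ, 0 < C ∧ ∀ (m : ℕ → ℕ) (t : ℕ → ℝ) (θ : ℝ) (φ : ℕ → X → ℝ) (φ' : X → ℝ) (e : ℝ) (x : X)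
      (M : ℝ), Tendsto m atTop atTop → (∀ n, 0 ≤ t n) → (∀ᶠ n in atTop, 0 < t n) →
      Tendsto t atTop (𝓝 0) → Tendsto (fun n => m n * t n ^ 2) atTop (𝓝 θ) →
      (∀ x, Tendsto (fun n => φ n x) atTop (𝓝 (φ' x))) → |e| ≤ 1 →
      (∀ᶠ n in atTop, ∀ x, |φ n x| ≤ M) → ∀ (l : ℕ) (ε : ℝ), 0 < ε →
      ∀ᶠ n in atTop, |(KS P f ^ m n) (fun x u => φ n x * Real.sin (t n * (u + e))) x y / t n -
        av ν φ' * Real.exp (-(sigma2 P ν f * θ / 2)) * (KS P f ^ l) (fun _ u => u + e) x y| ≤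
        C * M * Tn P f l x y + ε := by
  obtain ⟨C, hC, H⟩ := KSFS hG 1 |y|
  refine ⟨C, hC, fun m t θ φ φ' e x M hm ht0 htp ht hmt hφ he hM l ε hε => ?_⟩
  set L := av ν φ' * Real.exp (-(sigma2 P ν f * θ / 2)) with hL
  have hk : Tendsto (fun n => m n - l) atTop atTop := by
    refine tendsto_atTop_mono (f := fun n => m n - l) (fun n => le_rfl) ?_
    exact (tendsto_sub_atTop_nat l).comp hm
  have hkt : Tendsto (fun n => ((m n - l : ℕ) : ℝ) * t n ^ 2) atTop (𝓝 θ) := by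
    have h1 : Tendsto (fun n => m n * t n ^ 2 - l * t n ^ 2) atTop (𝓝 (θ - l * 0 ^ 2)) :=
      hmt.sub ((ht.pow 2).const_mul _)
    simp only [ne_eq, OfNat.ofNat_ne_zero, not_false_eq_true, zero_pow, mul_zero, sub_zero] at h1
    refine h1.congr' ?_
    filter_upwards [hm.eventually_ge_atTop l] with n hn
    rw [Nat.cast_sub hn]; ring
  have h3 := fun w => F3 hG hk ht0 ht hkt hφ w
  have h4 : Tendsto (fun n => (KS P f ^ l) (fun w u => Real.sin (t n * (u + e)) / t n *
      ((PT P f (t n) ^ (m n - l)) (fun x => (φ n x : ℂ)) w).re) x y) atTop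
      (𝓝 ((KS P f ^ l) (fun _ u => (u + e) * L) x y)) := by
    refine KS_lim P f l x y fun w u => (sin_slope (u + e) ht htp).mul ?_
    have := (Complex.continuous_re.tendsto _).comp (h3 w)
    simp only [Function.comp_def, hL.symm, Complex.ofReal_re] at this
    exact this
  have e5 : (KS P f ^ l) (fun _ u => (u + e) * L) x y = L * (KS P f ^ l) (fun _ u => u + e) x y := by
    rw [← KS_smul]; simp only [mul_comm]
  rw [e5] at h4
  have h5 := Metric.tendsto_nhds.1 h4 ε hε
  filter_upwards [h5, hM, htp, ht.eventually_le_const (zero_lt_one), hm.eventually_ge_atTop l]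
    with n h5 hM htp ht1 hml
  rw [Real.dist_eq] at h5
  have hM0 : 0 ≤ M := (abs_nonneg _).trans (hM x)
  have h6 : |(KS P f ^ m n) (fun x u => φ n x * Real.sin (t n * (u + e))) x y / t n -
      (KS P f ^ l) (fun w u => Real.sin (t n * (u + e)) / t n *
      ((PT P f (t n) ^ (m n - l)) (fun x => (φ n x : ℂ)) w).re) x y| ≤ C * M * Tn P f l x y := by
    have e1 : m n = l + (m n - l) := by omega
    set k := m n - l with hk'
    rw [e1, KS_add, div_eq_inv_mul, ← KS_smul, ← KS_subf, ← KS_const]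
    refine KS_abs hG.st.nonneg f l x y fun w u hu => ?_
    have := H (t n) ⟨htp.le, ht1⟩ k (φ n) M hM e he w u (by
      rcases hu with hu | hu
      · linarith [abs_nonneg y]
      · rw [hu]; exact neg_abs_le y)
    have e2 : ∀ a b c : ℝ, (t n)⁻¹ * a - b / t n * c = (t n)⁻¹ * (a - b * c) := by
      intros; ring
    rw [e2, abs_mul, abs_of_pos (by positivity), inv_mul_le_iff₀ htp]
    linarith
  have := abs_sub_le ((KS P f ^ m n) (fun x u => φ n x * Real.sin (t n * (u + e))) x y / t n)
    ((KS P f ^ l) (fun w u => Real.sin (t n * (u + e)) / t n *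
      ((PT P f (t n) ^ (m n - l)) (fun x => (φ n x : ℂ)) w).re) x y)
    (L * (KS P f ^ l) (fun _ u => u + e) x y)
  linarith

lemma Tn_tendsto {P : X → X → ℝ} {ν f : X → ℝ} (hG : Good P ν f) {V : X → ℝ → ℝ}
    (hV : HasV P ν f V) (x : X) (y : ℝ) : Tendsto (fun l => Tn P f l x y) atTop (𝓝 0) := by
  obtain ⟨C, hC, H⟩ := surv hG hV y
  have h1 : Tendsto (fun l : ℕ => C / √((l : ℝ) + 1)) atTop (𝓝 0) := by
    refine Tendsto.const_div_atTop ?_ C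
    exact Real.tendsto_sqrt_atTop.comp (tendsto_natCast_atTop_atTop.atTop_add tendsto_const_nhds)
  exact squeeze_zero (fun l => Tn_nonneg hG.st f l x y) (fun l => H l x y le_rfl) h1

lemma F5b {P : X → X → ℝ} {ν f : X → ℝ} (hG : Good P ν f) {V : X → ℝ → ℝ}
    (hV : HasV P ν f V) (x : X) (y : ℝ) :
    ∃ V' : ℝ, Tendsto (fun l => (KS P f ^ l) (fun _ u => u) x y) atTop (𝓝 V') := by
  obtain ⟨C, hC, H⟩ := F5a hG y
  obtain ⟨C1, hC1, H1⟩ := surv hG hV y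
  have h1 : Tendsto (fun l : ℕ => 2 * C * (C1 / √((l : ℝ) + 1))) atTop (𝓝 (2 * C * 0)) := by
    refine Tendsto.const_mul _ (Tendsto.const_div_atTop ?_ C1)
    exact Real.tendsto_sqrt_atTop.comp (tendsto_natCast_atTop_atTop.atTop_add tendsto_const_nhds)
  rw [mul_zero] at h1
  refine cauchySeq_tendsto_of_complete (cauchySeq_of_le_tendsto_0 _ (fun n m N hn hm => ?_) h1)
  have ht : Tendsto (fun n : ℕ => 1 / ((n : ℝ) + 1)) atTop (𝓝 0) :=
    tendsto_one_div_add_atTop_nhds_zero_nat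
  have htm : Tendsto (fun n : ℕ => (n : ℝ) * (1 / ((n : ℝ) + 1)) ^ 2) atTop (𝓝 0) := by
    refine squeeze_zero (fun n => by positivity) (fun n => ?_) ht
    rw [one_div, inv_pow, ← div_eq_mul_inv, inv_eq_one_div,
      div_le_div_iff₀ (by positivity) (by positivity)]
    nlinarith
  have hav : av ν (fun _ => 1) = 1 := by
    unfold av; simp [hG.st.nuSum]
  have key := fun (l : ℕ) (ε : ℝ) (hε : 0 < ε) => H (fun n => n) (fun n => 1 / ((n:ℝ) + 1)) 0
    (fun _ _ => 1) (fun _ => 1) 0 x 1 tendsto_id (fun n => by positivity)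
    (Eventually.of_forall fun n => by positivity) ht htm (fun _ => tendsto_const_nhds)
    (by simp) (Eventually.of_forall fun _ _ => by simp) l ε hε
  simp only [hav, add_zero, mul_zero, zero_div, neg_zero, Real.exp_zero, one_mul, mul_one] at key
  have hT : ∀ l, N ≤ l → Tn P f l x y ≤ C1 / √((N:ℝ) + 1) := by
    intro l hl
    refine (H1 l x y le_rfl).trans ?_
    gcongr
  refine le_of_forall_pos_le_add fun ε hε => ?_
  obtain ⟨k, k1, k2⟩ := ((key n (ε / 2) (by positivity)).and (key m (ε / 2) (by positivity))).exists
  rw [Real.dist_eq]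
  have k3 := abs_sub_le ((KS P f ^ n) (fun _ u => u) x y)
    ((KS P f ^ k) (fun x u => Real.sin (1 / ((k:ℝ) + 1) * u)) x y / (1 / ((k:ℝ) + 1)))
    ((KS P f ^ m) (fun _ u => u) x y)
  rw [abs_sub_comm] at k1
  have k4 := mul_le_mul_of_nonneg_left (hT n hn) hC.le
  have k5 := mul_le_mul_of_nonneg_left (hT m hm) hC.le
  linarith

lemma F5' {P : X → X → ℝ} {ν f : X → ℝ} (hG : Good P ν f) {V : X → ℝ → ℝ}
    (hV : HasV P ν f V) {x : X} {y V' : ℝ}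
    (hV' : Tendsto (fun l => (KS P f ^ l) (fun _ u => u) x y) atTop (𝓝 V'))
    {m : ℕ → ℕ} {t : ℕ → ℝ} {θ : ℝ} {φ : ℕ → X → ℝ} {φ' : X → ℝ} {e : ℝ}
    (hm : Tendsto m atTop atTop) (ht0 : ∀ n, 0 ≤ t n) (htp : ∀ᶠ n in atTop, 0 < t n)
    (ht : Tendsto t atTop (𝓝 0)) (hmt : Tendsto (fun n => m n * t n ^ 2) atTop (𝓝 θ))
    (hφ : ∀ x, Tendsto (fun n => φ n x) atTop (𝓝 (φ' x))) (he : |e| ≤ 1) :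
    Tendsto (fun n => (KS P f ^ m n) (fun x u => φ n x * Real.sin (t n * (u + e))) x y / t n) atTop
      (𝓝 (av ν φ' * Real.exp (-(sigma2 P ν f * θ / 2)) * V')) := by
  obtain ⟨C, hC, H⟩ := F5a hG y
  obtain ⟨M, hM⟩ := exists_bd φ'
  have hM' : ∀ᶠ n in atTop, ∀ x, |φ n x| ≤ M + 1 := by
    rw [eventually_all]
    intro w
    have := ((hφ w).abs).eventually_le_const (show |φ' w| < M + 1 by linarith [hM w])
    exact this
  set L := av ν φ' * Real.exp (-(sigma2 P ν f * θ / 2)) with hL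
  have h1 : Tendsto (fun l => C * (M + 1) * Tn P f l x y) atTop (𝓝 (C * (M + 1) * 0)) :=
    (Tn_tendsto hG hV x y).const_mul _
  have h2 : Tendsto (fun l => L * (KS P f ^ l) (fun _ u => u + e) x y) atTop (𝓝 (L * V')) := by
    have e1 : ∀ l, (KS P f ^ l) (fun _ u => u + e) x y =
        (KS P f ^ l) (fun _ u => u) x y + e * Tn P f l x y := by
      intro l; rw [KS_addf, KS_const]
    simp only [e1]
    have := (hV'.add ((Tn_tendsto hG hV x y).const_mul e)).const_mul L
    simpa using this
  rw [mul_zero] at h1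
  rw [Metric.tendsto_nhds]
  intro ε hε
  obtain ⟨l, l1, l2⟩ := ((h1.eventually_lt_const (show 0 < ε / 3 by positivity)).and
    (Metric.tendsto_nhds.1 h2 (ε / 3) (by positivity))).exists
  filter_upwards [H m t θ φ φ' e x (M + 1) hm ht0 htp ht hmt hφ he hM' l (ε / 3 / 2) (by positivity)]
    with n hn
  rw [Real.dist_eq] at l2 ⊢
  have := abs_sub_le ((KS P f ^ m n) (fun x u => φ n x * Real.sin (t n * (u + e))) x y / t n)
    (L * (KS P f ^ l) (fun _ u => u + e) x y) (L * V')
  linarith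

end PartF


section PartG1
variable [Fintype X] [DecidableEq X] [Nonempty X]

lemma scale_lim {D : ℝ} (hD : 0 < D) {g : ℕ → ℝ → ℝ} {r : ℕ → ℝ} {Bd G : ℝ → ℝ}
    (hm : ∀ n, Measurable (g n)) (hBd : IntegrableOn Bd (Set.Ioi 0)) (hBd0 : ∀ s, 0 ≤ Bd s)
    (hb : ∀ᶠ n : ℕ in atTop, ∀ t, 0 < t → t ≤ D → |r n * g n t| ≤ Bd (√n * t))
    (hl : ∀ s, 0 < s → Tendsto (fun n : ℕ => r n * g n (s / √n)) atTop (𝓝 (G s))) :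
    Tendsto (fun n : ℕ => r n * √n * ∫ t in (0:ℝ)..D, g n t) atTop (𝓝 (∫ s in Set.Ioi 0, G s)) := by
  have hs : Tendsto (fun n : ℕ => √(n:ℝ)) atTop atTop :=
    Real.tendsto_sqrt_atTop.comp tendsto_natCast_atTop_atTop
  have main : Tendsto (fun n : ℕ => ∫ s in Set.Ioi 0, if s ≤ D * √n then r n * g n (s / √n) else 0)
      atTop (𝓝 (∫ s in Set.Ioi 0, G s)) := by
    refine tendsto_integral_filter_of_dominated_convergence Bd ?_ ?_ hBd ?_
    · refine Eventually.of_forall fun n => Measurable.aestronglyMeasurable ?_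
      refine Measurable.ite measurableSet_Iic ?_ measurable_const
      exact ((hm n).comp (measurable_id.div_const _)).const_mul _
    · filter_upwards [hb, eventually_gt_atTop 0] with n hn n0
      refine (ae_restrict_iff' measurableSet_Ioi).2 (Eventually.of_forall fun s hs => ?_)
      have n1 : 0 < √(n:ℝ) := Real.sqrt_pos.2 (by exact_mod_cast n0)
      split_ifs with h
      · have := hn (s / √n) (div_pos hs n1) ((div_le_iff₀ n1).2 h)
        rwa [mul_div_cancel₀ _ n1.ne'] at this
      · simpa using hBd0 s
    · refine (ae_restrict_iff' measurableSet_Ioi).2 (Eventually.of_forall fun s h => ?_)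
      refine (hl s h).congr' ?_
      filter_upwards [(hs.const_mul_atTop hD).eventually_ge_atTop s] with n hn
      rw [if_pos hn]
  refine main.congr' ?_
  filter_upwards [eventually_gt_atTop 0] with n n0
  have n1 : 0 < √(n:ℝ) := Real.sqrt_pos.2 (by exact_mod_cast n0)
  have h1 := integral_comp_mul_left_Ioi (fun t => if t ≤ D then r n * g n t else 0) 0
    (inv_pos.2 n1)
  rw [mul_zero, inv_inv, smul_eq_mul] at h1
  have h2 : ∀ s, (fun t => if t ≤ D then r n * g n t else 0) ((√(n:ℝ))⁻¹ * s) =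
      if s ≤ D * √n then r n * g n (s / √n) else 0 := by
    intro s
    simp only [inv_mul_le_iff₀ n1, mul_comm D, div_eq_inv_mul]
  simp only [h2] at h1
  rw [h1]
  have h3 : ∀ t, (if t ≤ D then r n * g n t else 0) =
      (Set.Iic D).indicator (fun t => r n * g n t) t := by
    intro t; simp [Set.indicator_apply]
  simp only [h3]
  rw [setIntegral_indicator measurableSet_Iic, Set.Ioi_inter_Iic, integral_const_mul,
    intervalIntegral.integral_of_le hD.le]
  ring

lemma VV {P : X → X → ℝ} {ν f : X → ℝ} (hG : Good P ν f) {V : X → ℝ → ℝ}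
    (hV : HasV P ν f V) {x : X} {y V' : ℝ}
    (hV' : Tendsto (fun l => (KS P f ^ l) (fun _ u => u) x y) atTop (𝓝 V')) : V x y = V' := by
  have hσ := sigma_pos hG
  have hP := hG.st.nonneg
  obtain ⟨C, hC, H4⟩ := F4 hG hV 1 |y|
  have hsq : Tendsto (fun n : ℕ => √(n:ℝ)) atTop atTop :=
    Real.tendsto_sqrt_atTop.comp tendsto_natCast_atTop_atTop
  set a : ℕ → ℝ → ℝ := fun n t => (KS P f ^ n) (fun _ u => Real.sin (t * u)) x y with ha
  have hIntg : ∀ u : ℝ, Integrable (fun t => (1 - t) * (Real.sin (t * u) / t))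
      (volume.restrict (Set.Ioc 0 1)) := by
    intro u
    refine Measure.integrableOn_of_bounded (M := |u|) (by simp) (Measurable.aestronglyMeasurable (by fun_prop)) ?_
    refine (ae_restrict_iff' measurableSet_Ioc).2 (Eventually.of_forall fun t ht => ?_)
    rw [norm_mul, norm_div, Real.norm_eq_abs, Real.norm_eq_abs, Real.norm_eq_abs, abs_of_pos ht.1,
      abs_of_nonneg (by linarith [ht.2])]
    have h1 : |Real.sin (t * u)| / t ≤ |u| := by
      rw [div_le_iff₀ ht.1]
      refine Real.abs_sin_le_abs.trans ?_
      rw [abs_mul, abs_of_pos ht.1, mul_comm]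
    have h2 : 1 - t ≤ 1 := by linarith [ht.1]
    have h3 : 0 ≤ |Real.sin (t * u)| / t := div_nonneg (abs_nonneg _) ht.1.le
    calc (1 - t) * (|Real.sin (t * u)| / t) ≤ 1 * |u| :=
          mul_le_mul h2 h1 h3 zero_le_one
      _ = _ := one_mul _
  have hPh : ∀ n, (KS P f ^ n) (fun _ u => Ph u) x y = ∫ t in (0:ℝ)..1, (1 - t) * (a n t / t) := by
    intro n
    have := (KS_integral (volume.restrict (Set.Ioc (0:ℝ) 1)) P f n
      (φ := fun t w u => (1 - t) * (Real.sin (t * u) / t)) (fun w u => hIntg u) x y).2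
    rw [intervalIntegral.integral_of_le zero_le_one]
    have e1 : (fun (_ : X) u => Ph u) = fun (_ : X) (u : ℝ) =>
        ∫ t, (1 - t) * (Real.sin (t * u) / t) ∂(volume.restrict (Set.Ioc (0:ℝ) 1)) := by
      funext w u
      rw [Ph, intervalIntegral.integral_of_le zero_le_one]
    rw [e1, this]
    refine integral_congr_ae (Eventually.of_forall fun t => ?_)
    have e2 : (fun (w : X) (u : ℝ) => (1 - t) * (Real.sin (t * u) / t)) =
        fun w u => ((1 - t) / t) * Real.sin (t * u) := by
      funext w u; ring
    simp only [e2, KS_smul, ha]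
    ring
  have lim1 : Tendsto (fun n : ℕ => √(n:ℝ) * (KS P f ^ n) (fun _ u => Ph u) x y) atTop
      (𝓝 (V' * (√(π / (sigma2 P ν f / 2)) / 2))) := by
    have := scale_lim (D := 1) zero_lt_one (g := fun n t => (1 - t) * (a n t / t)) (r := fun _ => 1)
      (Bd := fun s => C * (1 + s ^ 2)⁻¹)
      (G := fun s => V' * Real.exp (-(sigma2 P ν f / 2) * s ^ 2)) ?_
      (integrable_inv_one_add_sq.const_mul C).integrableOn (fun s => by positivity) ?_ ?_
    · rw [integral_const_mul, integral_gaussian_Ioi] at this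
      simpa only [hPh, one_mul] using this
    · intro n
      obtain ⟨c, w, u, H⟩ := KS_sum P f n x y
      simp only [ha, H]
      fun_prop
    · refine Eventually.of_forall fun n t t0 t1 => ?_
      have := H4 t ⟨t0.le, t1⟩ n (fun _ => 1) 1 (by simp) 0 (by simp) x y le_rfl
      simp only [add_zero, one_mul, mul_one] at this
      rw [one_mul, abs_mul, abs_div, abs_of_pos t0, abs_of_nonneg (by linarith : 0 ≤ 1 - t), mul_pow,
        Real.sq_sqrt (by positivity)]
      calc (1 - t) * (|a n t| / t) ≤ 1 * ((C * t / (1 + n * t ^ 2)) / t) := by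
            gcongr
            · linarith
        _ = _ := by field_simp
    · intro s hs
      have ht : Tendsto (fun n : ℕ => s / √(n:ℝ)) atTop (𝓝 0) := hsq.const_div_atTop s
      have h5 := F5' hG hV hV' (m := fun n => n) (t := fun n => s / √(n:ℝ)) (θ := s ^ 2)
        (φ := fun _ _ => 1) (φ' := fun _ => 1) (e := 0) tendsto_id (fun n => by positivity)
        (by filter_upwards [eventually_gt_atTop 0] with n hn
            have : (0:ℝ) < n := by exact_mod_cast hn
            positivity) ht
        (by refine tendsto_const_nhds.congr' ?_
            filter_upwards [eventually_gt_atTop 0] with n hn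
            have : (0:ℝ) < n := by exact_mod_cast hn
            rw [div_pow, Real.sq_sqrt this.le]
            field_simp) (fun _ => tendsto_const_nhds) (by simp)
      have hav : av ν (fun _ => 1) = 1 := by
        unfold av; simp [hG.st.nuSum]
      simp only [hav, one_mul, add_zero] at h5
      have h6 := ((tendsto_const_nhds (x := (1:ℝ))).sub ht).mul h5
      simp only [one_mul]
      convert h6 using 2
      rw [sub_zero, one_mul, mul_comm]
      congr 2
      ring
  -- error
  obtain ⟨C1, hC1, H1⟩ := surv hG hV y
  obtain ⟨C2, hC2, H2⟩ := loc hG hV y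
  set M := |π / 2 - Ph y| + π with hM
  have hM0 : 0 < M := by positivity
  have hU : Tendsto (fun n : ℕ => √√((n:ℝ) + 1)) atTop atTop :=
    Real.tendsto_sqrt_atTop.comp (Real.tendsto_sqrt_atTop.comp
      (tendsto_natCast_atTop_atTop.atTop_add tendsto_const_nhds))
  have lim2 : Tendsto (fun n : ℕ => √(n:ℝ) * (KS P f ^ n) (fun _ u => π / 2 - Ph u) x y) atTop
      (𝓝 0) := by
    refine squeeze_zero_norm' (a := fun n : ℕ => (2 * C1 + 2 * M * C2) / √√((n:ℝ) + 1)) ?_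
      (hU.const_div_atTop _)
    filter_upwards [hU.eventually_ge_atTop 1, hU.eventually_ge_atTop |y|] with n hU1 hUy
    set U := √√((n:ℝ) + 1) with hUdef
    have hU0 : 0 < U := by linarith
    have hU2 : U ^ 2 = √((n:ℝ) + 1) := Real.sq_sqrt (by positivity)
    have hU4 : √((n:ℝ) + 1) ^ 2 = n + 1 := Real.sq_sqrt (by positivity)
    have hb : |(KS P f ^ n) (fun _ u => π / 2 - Ph u) x y| ≤
        (KS P f ^ n) (fun _ u => 2 / U + (2 * M * U ^ 2) * (1 / (U ^ 2 + u ^ 2))) x y := by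
      refine KS_abs hP f n x y fun w u hu => ?_
      have hfr : |u| ≤ U → M ≤ (2 * M * U ^ 2) * (1 / (U ^ 2 + u ^ 2)) := by
        intro h
        rw [mul_one_div, le_div_iff₀ (by positivity)]
        have : u ^ 2 ≤ U ^ 2 := sq_le_sq' (by linarith [neg_abs_le u]) (by linarith [le_abs_self u])
        nlinarith
      have hnn : 0 ≤ (2 * M * U ^ 2) * (1 / (U ^ 2 + u ^ 2)) := by positivity
      have hnn' : 0 ≤ 2 / U := by positivity
      rcases hu with hu | hu
      · obtain ⟨p1, p2⟩ := Ph_bd u hu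
        rw [abs_of_nonneg p1]
        rcases le_total U u with h | h
        · have : 2 / u ≤ 2 / U := by gcongr
          linarith
        · have p3 := Ph_nonneg u hu.le
          have := hfr (by rwa [abs_of_pos hu])
          have : π / 2 ≤ M := by
            have := Real.pi_pos
            have := abs_nonneg (π / 2 - Ph y)
            linarith
          linarith
      · rw [hu] at hfr ⊢
        have := hfr hUy
        have := Real.pi_pos
        rw [hu] at hnn
        linarith
    rw [KS_addf, KS_const, KS_smul] at hb
    have b1 := H1 n x y le_rfl
    have b2 := H2 U hU1 n x y le_rfl
    rw [norm_mul, Real.norm_eq_abs, Real.norm_eq_abs, abs_of_nonneg (Real.sqrt_nonneg _)]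
    have s1 : √(n:ℝ) ≤ √((n:ℝ) + 1) := Real.sqrt_le_sqrt (by linarith)
    calc √(n:ℝ) * |(KS P f ^ n) (fun _ u => π / 2 - Ph u) x y|
        ≤ √((n:ℝ) + 1) * (2 / U * (C1 / √((n:ℝ) + 1)) + 2 * M * U ^ 2 * (C2 / (U * (n + 1)))) := by
          gcongr
          refine hb.trans ?_
          gcongr
      _ = (2 * C1 + 2 * M * C2) / U := by
          have hn4 : (n:ℝ) + 1 = (U ^ 2) ^ 2 := by rw [hU2, hU4]
          rw [← hU2, hn4]
          field_simp
  have lim3 : Tendsto (fun n : ℕ => √(n:ℝ) * (π / 2 * Tn P f n x y)) atTop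
      (𝓝 (V' * (√(π / (sigma2 P ν f / 2)) / 2))) := by
    have := lim1.add lim2
    rw [add_zero] at this
    refine this.congr fun n => ?_
    rw [KS_subf, KS_const]
    ring
  have lim4 := (hV x y)
  have lim5 := lim3.const_mul (√(sigma2 P ν f) * √(2 * π) / π)
  refine tendsto_nhds_unique lim4 ?_
  have hs2 := Real.sqrt_pos.2 hσ
  have e1 : V' = √(sigma2 P ν f) * √(2 * π) / π * (V' * (√(π / (sigma2 P ν f / 2)) / 2)) := by
    have : π / (sigma2 P ν f / 2) = 2 * π / sigma2 P ν f := by field_simp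
    rw [this, Real.sqrt_div (by positivity)]
    have h7 : √(2 * π) * √(2 * π) = 2 * π := Real.mul_self_sqrt (by positivity)
    field_simp
    rw [sq, h7]; ring
  rw [e1]
  refine lim5.congr fun n => ?_
  rw [Real.sqrt_mul (by positivity : 0 ≤ 2 * π) (n:ℝ)]
  field_simp

lemma V_lim {P : X → X → ℝ} {ν f : X → ℝ} (hG : Good P ν f) {V : X → ℝ → ℝ}
    (hV : HasV P ν f V) (x : X) (y : ℝ) :
    Tendsto (fun l => (KS P f ^ l) (fun _ u => u) x y) atTop (𝓝 (V x y)) := by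
  obtain ⟨V', h⟩ := F5b hG hV x y
  rwa [VV hG hV h]

end PartG1


section PartG2
variable [Fintype X] [DecidableEq X] [Nonempty X]

lemma shift_int (F G : ℝ → ℝ) (c : ℝ) :
    ∫ u in Set.Ioi 0, F u * (if 0 < u + c then G (u + c) else 0) =
    ∫ v in Set.Ioi 0, (if 0 < v - c then F (v - c) else 0) * G v := by
  rw [← integral_indicator measurableSet_Ioi, ← integral_indicator measurableSet_Ioi]
  rw [← integral_add_right_eq_self
    ((Set.Ioi 0).indicator fun v => (if 0 < v - c then F (v - c) else 0) * G v) c]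
  congr 1
  ext u
  simp only [Set.indicator_apply, Set.mem_Ioi, add_sub_cancel_right]
  split_ifs <;> simp

lemma shift_integrable {G : ℝ → ℝ} (hG : IntegrableOn G (Set.Ioi 0)) (c : ℝ) :
    IntegrableOn (fun u => if 0 < u + c then G (u + c) else 0) (Set.Ioi 0) := by
  have h1 := (integrable_indicator_iff measurableSet_Ioi).2 hG
  have h2 := (h1.comp_add_right c).integrableOn (s := Set.Ioi 0)
  refine h2.congr_fun (fun u _ => ?_) measurableSet_Ioi
  simp [Set.indicator_apply]

lemma KS_intble (P : X → X → ℝ) (f : X → ℝ) (n : ℕ) {G : X → ℝ → ℝ}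
    (hG : ∀ x, IntegrableOn (G x) (Set.Ioi 0)) (x : X) :
    IntegrableOn ((KS P f ^ n) G x) (Set.Ioi 0) := by
  induction n generalizing x with
  | zero => exact hG x
  | succ n ih =>
    have : (KS P f ^ (n + 1)) G x = fun u =>
      ∑ x', P x x' * (if 0 < u + f x' then (KS P f ^ n) G x' (u + f x') else 0) := by
      ext u; rw [KS_succ]
    rw [this]
    exact integrable_finsetSum _ fun x' _ => (shift_integrable (ih x') _).const_mul _

lemma pair1 {P : X → X → ℝ} {ν f : X → ℝ} (hS : IsStochastic P ν) {F G : X → ℝ → ℝ}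
    (hFm : ∀ x, Measurable (F x)) {M : ℝ} (hM : ∀ x u, |F x u| ≤ M)
    (hG : ∀ x, IntegrableOn (G x) (Set.Ioi 0)) :
    ∑ x, ν x * ∫ u in Set.Ioi 0, F x u * KS P f G x u =
    ∑ x, ν x * ∫ v in Set.Ioi 0, Dm (fun b => -f b) (Pm (dualK P ν) F) x v * G x v := by
  have e1 : ∀ x, ∫ u in Set.Ioi 0, F x u * KS P f G x u = ∑ x', P x x' *
      ∫ u in Set.Ioi 0, F x u * (if 0 < u + f x' then G x' (u + f x') else 0) := by
    intro x
    simp only [KS_apply, Finset.mul_sum]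
    rw [integral_finsetSum]
    · refine Finset.sum_congr rfl fun x' _ => ?_
      rw [← integral_const_mul]
      congr 1; ext u; ring
    · intro x' _
      have := ((shift_integrable (hG x') (f x')).bdd_mul (c := M) (hFm x).aestronglyMeasurable
        (Eventually.of_forall (hM x))).const_mul (P x x')
      refine this.congr (Eventually.of_forall fun u => ?_)
      simp only []
      ring
  have e2 : ∀ x', ∫ v in Set.Ioi 0, Dm (fun b => -f b) (Pm (dualK P ν) F) x' v * G x' v =
      ∑ x, dualK P ν x' x *
      ∫ v in Set.Ioi 0, (if 0 < v - f x' then F x (v - f x') else 0) * G x' v := by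
    intro x'
    have e3 : ∀ v, Dm (fun b => -f b) (Pm (dualK P ν) F) x' v * G x' v =
      ∑ x, dualK P ν x' x * ((if 0 < v - f x' then F x (v - f x') else 0) * G x' v) := by
      intro v
      change (if 0 < v + -f x' then ∑ x, dualK P ν x' x * F x (v + -f x') else 0) * G x' v = _
      simp only [← sub_eq_add_neg]
      split_ifs
      · rw [Finset.sum_mul]
        exact Finset.sum_congr rfl fun _ _ => by ring
      · simp
    simp only [e3]
    rw [integral_finsetSum]
    · exact Finset.sum_congr rfl fun x _ => integral_const_mul _ _
    · intro x _
      refine Integrable.const_mul ?_ _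
      refine (hG x').bdd_mul (c := M) (Measurable.aestronglyMeasurable ?_)
        (Eventually.of_forall fun v => ?_)
      · refine Measurable.ite ?_ ((hFm x).comp (measurable_id.sub_const _)) measurable_const
        exact measurableSet_lt measurable_const (measurable_id.sub_const _)
      · split_ifs
        · exact hM _ _
        · simpa using (abs_nonneg _).trans (hM x 0)
  simp only [e1, e2, Finset.mul_sum]
  rw [Finset.sum_comm]
  refine Finset.sum_congr rfl fun x' _ => Finset.sum_congr rfl fun x _ => ?_
  rw [shift_int, ← mul_assoc, ← mul_assoc, dual_mul hS]

lemma Kd_bd {P : X → X → ℝ} {ν f : X → ℝ} (hS : IsStochastic P ν) {F : X → ℝ → ℝ}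
    (hFm : ∀ x, Measurable (F x)) {M : ℝ} (hM : ∀ x u, |F x u| ≤ M) :
    (∀ x, Measurable (Dm (fun b => -f b) (Pm (dualK P ν) F) x)) ∧
    ∀ x u, |Dm (fun b => -f b) (Pm (dualK P ν) F) x u| ≤ M := by
  have hD := dual_st hS
  constructor
  · intro x
    change Measurable fun v => (if 0 < v + -f x then ∑ x', dualK P ν x x' * F x' (v + -f x) else 0)
    refine Measurable.ite ?_ ?_ measurable_const
    · exact measurableSet_lt measurable_const (measurable_id.add_const _)
    · exact Finset.measurable_sum _ fun x' _ =>
        ((hFm x').comp (measurable_id.add_const _)).const_mul _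
  · intro x u
    change |(if 0 < u + -f x then ∑ x', dualK P ν x x' * F x' (u + -f x) else 0)| ≤ M
    split_ifs
    · calc |∑ x', dualK P ν x x' * F x' (u + -f x)| ≤ ∑ x', dualK P ν x x' * M := by
            refine (Finset.abs_sum_le_sum_abs _ _).trans (Finset.sum_le_sum fun x' _ => ?_)
            rw [abs_mul, abs_of_nonneg (hD.nonneg _ _)]
            exact mul_le_mul_of_nonneg_left (hM _ _) (hD.nonneg _ _)
        _ = M := by rw [← Finset.sum_mul, hD.rowSum, one_mul]
    · simpa using (abs_nonneg _).trans (hM x 0)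

lemma pairn {P : X → X → ℝ} {ν f : X → ℝ} (hS : IsStochastic P ν) (n : ℕ) {F G : X → ℝ → ℝ}
    (hFm : ∀ x, Measurable (F x)) {M : ℝ} (hM : ∀ x u, |F x u| ≤ M)
    (hG : ∀ x, IntegrableOn (G x) (Set.Ioi 0)) :
    ∑ x, ν x * ∫ u in Set.Ioi 0, F x u * (KS P f ^ n) G x u =
    ∑ x, ν x * ∫ v in Set.Ioi 0,
      ((Dm (fun b => -f b) * Pm (dualK P ν)) ^ n) F x v * G x v := by
  induction n generalizing F with
  | zero => rfl
  | succ n ih =>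
    have e : ∀ x u, (KS P f ^ (n + 1)) G x u = KS P f ((KS P f ^ n) G) x u := by
      intro x u; rw [pow_succ']; rfl
    simp only [e]
    rw [pair1 hS hFm hM (fun x => KS_intble P f n hG x), ih (Kd_bd hS hFm hM).1 (Kd_bd hS hFm hM).2]
    rw [pow_succ]
    rfl

lemma pow_flip {R : Type*} [Monoid R] (a b : R) (k : ℕ) : (a * b) ^ (k + 1) = a * (b * a) ^ k * b := by
  induction k with
  | zero => simp
  | succ k ih => rw [pow_succ, ih, pow_succ (b * a)]; simp only [mul_assoc]

/-- the window function -/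
noncomputable def win (ψ : X → ℝ) (z b : ℝ) : X → ℝ → ℝ :=
  fun x v => ψ x * (Set.Icc z b).indicator 1 v

lemma win_meas (ψ : X → ℝ) (z b : ℝ) (x : X) : Measurable (win ψ z b x) :=
  (measurable_one.indicator measurableSet_Icc).const_mul _

lemma win_int (ψ : X → ℝ) (z b : ℝ) (x : X) : IntegrableOn (win ψ z b x) (Set.Ioi 0) := by
  refine (Integrable.const_mul ?_ _).integrableOn
  refine (integrable_indicator_iff measurableSet_Icc).2 ?_
  exact integrableOn_const (by simp)

lemma win_nonneg {ψ : X → ℝ} (hψ : ∀ x, 0 ≤ ψ x) (z b : ℝ) (x : X) (v : ℝ) : 0 ≤ win ψ z b x v :=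
  mul_nonneg (hψ x) (Set.indicator_nonneg (fun _ _ => zero_le_one) _)

lemma dual_rep {P : X → X → ℝ} {ν f : X → ℝ} (hS : IsStochastic P ν) (k : ℕ) (w : X)
    {h : ℝ → ℝ} (hm : Measurable h) {M : ℝ} (hM : ∀ u, |h u| ≤ M) (ψ : X → ℝ) {z b : ℝ}
    (hz : 0 ≤ z) (hzb : z ≤ b) :
    ν w * ∫ u in Set.Ioi 0, h u * (KS P f ^ (k + 1)) (win ψ z b) w u =
    ∑ x, ν x * ψ x * ∫ v in z..b, if 0 < v - f x then
      (KS (dualK P ν) (fun c => -f c) ^ k) (fun x' u => dualK P ν x' w * h u) x (v - f x) else 0 := by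
  have h1 := pairn (f := f) hS (k + 1) (F := fun x u => if x = w then h u else 0) (G := win ψ z b)
    (fun x => by split_ifs; exacts [hm, measurable_const]) (M := M)
    (fun x u => by
      split_ifs
      · exact hM u
      · simpa using (abs_nonneg _).trans (hM 0)) (win_int ψ z b)
  have e1 : ∑ x, ν x * ∫ u in Set.Ioi 0, (fun x u => if x = w then h u else 0) x u *
      (KS P f ^ (k + 1)) (win ψ z b) x u =
      ν w * ∫ u in Set.Ioi 0, h u * (KS P f ^ (k + 1)) (win ψ z b) w u := by
    rw [Finset.sum_eq_single w]
    · simp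
    · intro x _ hx; simp [hx]
    · simp
  rw [e1] at h1
  rw [h1, pow_flip]
  refine Finset.sum_congr rfl fun x _ => ?_
  rw [mul_assoc (ν x) (ψ x)]
  congr 1
  have e2 : Pm (dualK P ν) (fun x u => if x = w then h u else 0) =
      fun x' u => dualK P ν x' w * h u := by
    ext x' u
    change ∑ x'', dualK P ν x' x'' * (if x'' = w then h u else 0) = _
    simp
  set Q := fun v => if 0 < v - f x then
      (KS (dualK P ν) (fun c => -f c) ^ k) (fun x' u => dualK P ν x' w * h u) x (v - f x) else 0
    with hQ
  have e3 : ∀ v, (Dm (fun c => -f c) * (Pm (dualK P ν) * Dm (fun c => -f c)) ^ k * Pm (dualK P ν))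
      (fun x u => if x = w then h u else 0) x v = Q v := by
    intro v
    simp only [Module.End.mul_apply, e2, hQ, sub_eq_add_neg]
    rfl
  have e4 : ∫ v in Set.Ioi 0, (Dm (fun c => -f c) * (Pm (dualK P ν) * Dm (fun c => -f c)) ^ k *
      Pm (dualK P ν)) (fun x u => if x = w then h u else 0) x v * win ψ z b x v =
      ∫ v in Set.Ioi 0, Q v * win ψ z b x v :=
    integral_congr_ae (Eventually.of_forall fun v => congrArg (· * win ψ z b x v) (e3 v))
  rw [e4, intervalIntegral.integral_of_le hzb, ← integral_indicator measurableSet_Ioi,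
    ← integral_indicator measurableSet_Ioc, ← integral_const_mul]
  refine integral_congr_ae ?_
  have : ∀ᵐ v : ℝ, v ≠ z := by simp [ae_iff, measure_singleton]
  filter_upwards [this] with v hv
  simp only [Set.indicator_apply, win, Set.mem_Ioi, Set.mem_Icc, Set.mem_Ioc, Pi.one_apply]
  by_cases h3 : z < v ∧ v ≤ b
  · rw [if_pos h3, if_pos (by linarith [h3.1]), if_pos ⟨h3.1.le, h3.2⟩]
    ring
  · rw [if_neg h3, if_neg (c := z ≤ v ∧ v ≤ b)]
    · simp
    · rintro ⟨h4, h5⟩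
      exact h3 ⟨lt_of_le_of_ne h4 (Ne.symm hv), h5⟩

end PartG2


section PartG3
variable [Fintype X] [DecidableEq X] [Nonempty X]

lemma st_le_one {P : X → X → ℝ} {ν : X → ℝ} (hS : IsStochastic P ν) (x x' : X) : P x x' ≤ 1 := by
  rw [← hS.rowSum x]
  exact Finset.single_le_sum (f := fun x' => P x x') (fun i _ => hS.nonneg x i) (Finset.mem_univ x')

lemma dual_bd {P : X → X → ℝ} {ν f : X → ℝ} (hS : IsStochastic P ν) {ψ : X → ℝ}
    (hψ : ∀ x, 0 ≤ ψ x) {z b : ℝ} (hz : 0 ≤ z) (hzb : z ≤ b) {R : ℝ} (hR : ∀ x, b - f x ≤ R) :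
    ∃ C : ℝ, 0 < C ∧ ∀ (k : ℕ) (w : X) (h : ℝ → ℝ) (M Bv : ℝ), Measurable h → (∀ u, |h u| ≤ M) →
      0 ≤ Bv → (∀ x v, 0 < v → v ≤ R →
        |(KS (dualK P ν) (fun c => -f c) ^ k) (fun x' u => dualK P ν x' w * h u) x v| ≤ Bv) →
      |∫ u in Set.Ioi 0, h u * (KS P f ^ (k + 1)) (win ψ z b) w u| ≤ C * Bv := by
  obtain ⟨C, hC⟩ := exists_bd (fun w => (∑ x, ν x * ψ x * (b - z)) / ν w)
  refine ⟨C + 1, ?_, fun k w h M Bv hm hM hB H => ?_⟩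
  · have := (abs_nonneg _).trans (hC (Classical.arbitrary X)); linarith
  have h1 := dual_rep (f := f) hS k w hm hM ψ hz hzb
  have hw := hS.nuPos w
  have h2 : |ν w * ∫ u in Set.Ioi 0, h u * (KS P f ^ (k + 1)) (win ψ z b) w u| ≤
      (∑ x, ν x * ψ x * (b - z)) * Bv := by
    rw [h1, Finset.sum_mul]
    refine (Finset.abs_sum_le_sum_abs _ _).trans (Finset.sum_le_sum fun x _ => ?_)
    have hn : 0 ≤ ν x * ψ x := mul_nonneg (hS.nuPos x).le (hψ x)
    rw [abs_mul, abs_of_nonneg hn, mul_assoc (ν x * ψ x) (b - z) Bv]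
    refine mul_le_mul_of_nonneg_left ?_ hn
    have := intervalIntegral.norm_integral_le_of_norm_le_const (a := z) (b := b) (C := Bv)
      (f := fun v => if 0 < v - f x then
      (KS (dualK P ν) (fun c => -f c) ^ k) (fun x' u => dualK P ν x' w * h u) x (v - f x) else 0)
      (fun v hv => by
        rw [Set.uIoc_of_le hzb] at hv
        split_ifs with hp
        · exact H x _ hp (by linarith [hR x, hv.2])
        · simpa using hB)
    rw [abs_of_nonneg (by linarith : 0 ≤ b - z)] at this
    rw [mul_comm]
    exact this
  rw [abs_mul, abs_of_pos hw, ← le_div_iff₀' hw] at h2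
  have h3 := (le_abs_self _).trans (hC w)
  calc _ ≤ _ := h2
    _ = (∑ x, ν x * ψ x * (b - z)) / ν w * Bv := by ring
    _ ≤ (C + 1) * Bv := by gcongr; linarith

lemma exists_R (f : X → ℝ) (b : ℝ) : ∃ R : ℝ, 0 ≤ R ∧ ∀ x, b - f x ≤ R := by
  obtain ⟨B, hB⟩ := exists_bd f
  refine ⟨|b| + B, ?_, fun x => ?_⟩
  · have := (abs_nonneg _).trans (hB (Classical.arbitrary X)); positivity
  · linarith [hB x, le_abs_self b, neg_abs_le (f x)]

lemma dual_KS_le {P : X → X → ℝ} {ν f : X → ℝ} (hS : IsStochastic P ν) (k : ℕ) (w : X)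
    {h : ℝ → ℝ} (hh : ∀ u, 0 ≤ h u) (x : X) (v : ℝ) :
    |(KS (dualK P ν) (fun c => -f c) ^ k) (fun x' u => dualK P ν x' w * h u) x v| ≤
      (KS (dualK P ν) (fun c => -f c) ^ k) (fun x' u => h u) x v := by
  have hD := dual_st hS
  refine KS_abs hD.nonneg _ k x v fun x' u _ => ?_
  rw [abs_mul, abs_of_nonneg (hD.nonneg _ _), abs_of_nonneg (hh u)]
  exact mul_le_of_le_one_left (hh u) (st_le_one hD _ _)

lemma H_mass {P : X → X → ℝ} {ν f : X → ℝ} (hG : Good P ν f) {Vs : X → ℝ → ℝ}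
    (hVs : HasV (dualK P ν) ν (fun c => -f c) Vs) {ψ : X → ℝ} (hψ : ∀ x, 0 ≤ ψ x) {z b : ℝ}
    (hz : 0 ≤ z) (hzb : z ≤ b) :
    ∃ C : ℝ, 0 < C ∧ ∀ (k : ℕ) (w : X),
      ∫ u in Set.Ioi 0, (KS P f ^ (k + 1)) (win ψ z b) w u ≤ C / √((k:ℝ) + 1) := by
  obtain ⟨R, hR0, hR⟩ := exists_R f b
  obtain ⟨C, hC, H⟩ := dual_bd hG.st hψ hz hzb hR
  obtain ⟨C1, hC1, H1⟩ := surv (dual_good hG) hVs R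
  refine ⟨C * C1, by positivity, fun k w => ?_⟩
  have := H k w (fun _ => 1) 1 (C1 / √((k:ℝ) + 1)) measurable_const (by simp) (by positivity)
    (fun x v _ hv => (dual_KS_le hG.st k w (fun _ => zero_le_one) x v).trans (H1 k x v hv))
  simp only [one_mul] at this
  refine ((le_abs_self _).trans this).trans (le_of_eq (by ring))

lemma H_loc {P : X → X → ℝ} {ν f : X → ℝ} (hG : Good P ν f) {Vs : X → ℝ → ℝ}
    (hVs : HasV (dualK P ν) ν (fun c => -f c) Vs) {ψ : X → ℝ} (hψ : ∀ x, 0 ≤ ψ x) {z b : ℝ}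
    (hz : 0 ≤ z) (hzb : z ≤ b) :
    ∃ C : ℝ, 0 < C ∧ ∀ (U : ℝ), 1 ≤ U → ∀ (k : ℕ) (w : X),
      ∫ u in Set.Ioi 0, 1 / (U ^ 2 + u ^ 2) * (KS P f ^ (k + 1)) (win ψ z b) w u ≤
        C / (U * (k + 1)) := by
  obtain ⟨R, hR0, hR⟩ := exists_R f b
  obtain ⟨C, hC, H⟩ := dual_bd hG.st hψ hz hzb hR
  obtain ⟨C1, hC1, H1⟩ := loc (dual_good hG) hVs R
  refine ⟨C * C1, by positivity, fun U hU k w => ?_⟩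
  have hU0 : 0 < U := by linarith
  have := H k w (fun u => 1 / (U ^ 2 + u ^ 2)) 1 (C1 / (U * (k + 1))) (by fun_prop)
    (fun u => by
      rw [abs_of_nonneg (by positivity), div_le_one (by positivity)]
      nlinarith) (by positivity)
    (fun x v _ hv => (dual_KS_le hG.st k w (fun _ => by positivity) x v).trans (H1 U hU k x v hv))
  refine ((le_abs_self _).trans this).trans (le_of_eq (by ring))

/-- sine transform of the backward density -/
noncomputable def Bt (P : X → X → ℝ) (f ψ : X → ℝ) (z b : ℝ) (k : ℕ) (t : ℝ) (w : X) : ℝ :=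
  ∫ u in Set.Ioi 0, Real.sin (t * u) * (KS P f ^ (k + 1)) (win ψ z b) w u

lemma B_bd {P : X → X → ℝ} {ν f : X → ℝ} (hG : Good P ν f) {Vs : X → ℝ → ℝ}
    (hVs : HasV (dualK P ν) ν (fun c => -f c) Vs) {ψ : X → ℝ} (hψ : ∀ x, 0 ≤ ψ x) {z b : ℝ}
    (hz : 0 ≤ z) (hzb : z ≤ b) (K : ℝ) :
    ∃ C : ℝ, 0 < C ∧ ∀ t ∈ Set.Icc 0 K, ∀ (k : ℕ) (w : X),
      |Bt P f ψ z b k t w| ≤ C * t / (1 + k * t ^ 2) := by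
  obtain ⟨R, hR0, hR⟩ := exists_R f b
  obtain ⟨C, hC, H⟩ := dual_bd hG.st hψ hz hzb hR
  obtain ⟨C1, hC1, H1⟩ := F4 (dual_good hG) hVs K R
  refine ⟨C * C1, by positivity, fun t ht k w => ?_⟩
  have hD := dual_st hG.st
  have ht0 : 0 ≤ t := ht.1
  have := H k w (fun u => Real.sin (t * u)) 1 (C1 * t / (1 + k * t ^ 2)) (by fun_prop)
    (fun u => Real.abs_sin_le_one _) (by positivity)
    (fun x v hv0 hv => by
      have := H1 t ht k (fun x' => dualK P ν x' w) 1 (fun x' => by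
        rw [abs_of_nonneg (hD.nonneg _ _)]; exact st_le_one hD _ _) 0 (by simp) x v
        (by rwa [abs_of_pos hv0])
      simpa using this)
  refine this.trans (le_of_eq (by ring))

/-- limiting constant -/
noncomputable def Cst (ν f ψ : X → ℝ) (Vs : X → ℝ → ℝ) (z b : ℝ) : ℝ :=
  ∑ x, ν x * ψ x * ∫ v in z..b, if 0 < v - f x then Vs x (v - f x) else 0

lemma B_lim {P : X → X → ℝ} {ν f : X → ℝ} (hG : Good P ν f) {Vs : X → ℝ → ℝ}
    (hVs : HasV (dualK P ν) ν (fun c => -f c) Vs) {ψ : X → ℝ} (hψ : ∀ x, 0 ≤ ψ x) {z b : ℝ}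
    (hz : 0 ≤ z) (hzb : z ≤ b) {k : ℕ → ℕ} {t : ℕ → ℝ} {θ : ℝ}
    (hk : Tendsto k atTop atTop) (ht0 : ∀ n, 0 ≤ t n) (htp : ∀ᶠ n in atTop, 0 < t n)
    (ht : Tendsto t atTop (𝓝 0)) (hkt : Tendsto (fun n => k n * t n ^ 2) atTop (𝓝 θ)) (w : X) :
    Tendsto (fun n => Bt P f ψ z b (k n) (t n) w / t n) atTop
      (𝓝 (Real.exp (-(sigma2 P ν f * θ / 2)) * Cst ν f ψ Vs z b)) := by
  obtain ⟨R, hR0, hR⟩ := exists_R f b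
  obtain ⟨C1, hC1, H1⟩ := F4 (dual_good hG) hVs 1 R
  have hD := dual_st hG.st
  have hw := hG.st.nuPos w
  have hDw : ∀ x', |dualK P ν x' w| ≤ 1 := fun x' => by
    rw [abs_of_nonneg (hD.nonneg _ _)]; exact st_le_one hD _ _
  set E := Real.exp (-(sigma2 P ν f * θ / 2)) with hE
  have hav : av ν (fun x' => dualK P ν x' w) = ν w := by
    unfold av
    simp only [mul_comm _ (ν _)]
    exact hD.nuInv w
  have key : ∀ x, Tendsto (fun n => ∫ v in z..b, if 0 < v - f x then
      (KS (dualK P ν) (fun c => -f c) ^ k n)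
        (fun x' u => dualK P ν x' w * Real.sin (t n * u)) x (v - f x) / t n else 0) atTop
      (𝓝 (∫ v in z..b, ν w * E * if 0 < v - f x then Vs x (v - f x) else 0)) := by
    intro x
    refine intervalIntegral.tendsto_integral_filter_of_dominated_convergence (fun _ => C1) ?_ ?_
      intervalIntegrable_const ?_
    · refine Eventually.of_forall fun n => Measurable.aestronglyMeasurable ?_
      refine Measurable.ite (measurableSet_lt measurable_const (measurable_id.sub_const _)) ?_
        measurable_const
      refine Measurable.div_const ?_ _
      exact (KS_meas (dualK P ν) _ (k n) _ (fun x' => by fun_prop) x).comp (measurable_id.sub_const _)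
    · filter_upwards [htp, ht.eventually_le_const zero_lt_one] with n hn0 hn1
      refine Eventually.of_forall fun v hv => ?_
      rw [Set.uIoc_of_le hzb] at hv
      split_ifs with hp
      · have := H1 (t n) ⟨hn0.le, hn1⟩ (k n) (fun x' => dualK P ν x' w) 1 hDw 0 (by simp) x (v - f x)
          (by rw [abs_of_pos hp]; linarith [hR x, hv.2])
        simp only [add_zero, mul_one] at this
        rw [norm_div, Real.norm_eq_abs, Real.norm_eq_abs, abs_of_pos hn0, div_le_iff₀ hn0]
        refine this.trans (div_le_self (by positivity) ?_)
        have : (0:ℝ) ≤ k n * t n ^ 2 := by positivity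
        linarith
      · simpa using hC1.le
    · refine Eventually.of_forall fun v _ => ?_
      split_ifs with hp
      · have := F5' (dual_good hG) hVs (V_lim (dual_good hG) hVs x (v - f x)) hk ht0 htp ht hkt
          (φ := fun _ x' => dualK P ν x' w) (φ' := fun x' => dualK P ν x' w)
          (fun _ => tendsto_const_nhds) (e := 0) (by simp)
        rw [hav, dual_sigma hG] at this
        simpa only [add_zero] using this
      · simp
  have h2 : ∀ n, Bt P f ψ z b (k n) (t n) w / t n = (ν w)⁻¹ * ∑ x, ν x * ψ x *
      ∫ v in z..b, if 0 < v - f x then (KS (dualK P ν) (fun c => -f c) ^ k n)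
        (fun x' u => dualK P ν x' w * Real.sin (t n * u)) x (v - f x) / t n else 0 := by
    intro n
    have := dual_rep (f := f) hG.st (k n) w (h := fun u => Real.sin (t n * u)) (by fun_prop)
      (fun u => Real.abs_sin_le_one _) ψ hz hzb
    have e : ∀ x v, (if 0 < v - f x then (KS (dualK P ν) (fun c => -f c) ^ k n)
        (fun x' u => dualK P ν x' w * Real.sin (t n * u)) x (v - f x) / t n else 0) =
        (if 0 < v - f x then (KS (dualK P ν) (fun c => -f c) ^ k n)
        (fun x' u => dualK P ν x' w * Real.sin (t n * u)) x (v - f x) else 0) / t n := by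
      intro x v; split_ifs <;> simp
    simp only [e, intervalIntegral.integral_div, ← mul_div_assoc]
    rw [← Finset.sum_div, ← this, Bt]
    field_simp
  simp only [h2]
  have h3 := (tendsto_finsetSum Finset.univ
    (fun x _ => (key x).const_mul (ν x * ψ x))).const_mul (ν w)⁻¹
  convert h3 using 2
  unfold Cst
  simp only [intervalIntegral.integral_const_mul]
  rw [Finset.mul_sum, Finset.mul_sum]
  refine Finset.sum_congr rfl fun x _ => ?_
  field_simp

lemma Vs_meas {P : X → X → ℝ} {ν f : X → ℝ} {V : X → ℝ → ℝ}
    (hV : HasV P ν f V) (x : X) : Measurable (V x) := by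
  refine measurable_of_tendsto_metrizable
    (f := fun (n : ℕ) y => √(sigma2 P ν f) * √(2 * π * n) / 2 * Tn P f n x y) (fun n => ?_)
    (tendsto_pi_nhds.2 fun y => hV x y)
  exact (KS_meas P f n _ (fun _ => measurable_const) x).const_mul _

lemma Vs_bd {P : X → X → ℝ} {ν f : X → ℝ} (hG : Good P ν f) {V : X → ℝ → ℝ}
    (hV : HasV P ν f V) (R : ℝ) : ∃ C : ℝ, ∀ x y, y ≤ R → |V x y| ≤ C := by
  obtain ⟨C, hC, H⟩ := surv hG hV R
  refine ⟨√(sigma2 P ν f) * √(2 * π) / 2 * C, fun x y hy => ?_⟩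
  refine le_of_tendsto (hV x y).abs (Eventually.of_forall fun n => ?_)
  have hT := Tn_nonneg hG.st f n x y
  rw [abs_of_nonneg (by positivity), Real.sqrt_mul (by positivity)]
  have h1 : √(n:ℝ) * Tn P f n x y ≤ C := by
    calc √(n:ℝ) * Tn P f n x y ≤ √((n:ℝ) + 1) * (C / √((n:ℝ) + 1)) := by
          gcongr
          · linarith
          · exact H n x y hy
      _ = C := by field_simp
  calc _ = √(sigma2 P ν f) * √(2 * π) / 2 * (√(n:ℝ) * Tn P f n x y) := by ring
    _ ≤ _ := by gcongr

lemma Cst_int {P : X → X → ℝ} {ν f : X → ℝ} (hG : Good P ν f) {Vs : X → ℝ → ℝ}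
    (hVs : HasV (dualK P ν) ν (fun c => -f c) Vs) (z b : ℝ) (x : X) :
    IntervalIntegrable (fun v => if 0 < v - f x then Vs x (v - f x) else 0) volume z b := by
  obtain ⟨C, hC⟩ := Vs_bd (dual_good hG) hVs (max z b - f x)
  rw [intervalIntegrable_iff]
  refine Measure.integrableOn_of_bounded (M := max C 0) (by simp [Set.uIoc]) ?_ ?_
  · refine Measurable.aestronglyMeasurable ?_
    exact Measurable.ite (measurableSet_lt measurable_const (measurable_id.sub_const _))
      ((Vs_meas hVs x).comp (measurable_id.sub_const _)) measurable_const
  · refine (ae_restrict_iff' measurableSet_uIoc).2 (Eventually.of_forall fun v hv => ?_)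
    split_ifs
    · exact (hC x _ (by linarith [hv.2])).trans (le_max_left _ _)
    · simp

lemma Cst_cont {P : X → X → ℝ} {ν f : X → ℝ} (hG : Good P ν f) {Vs : X → ℝ → ℝ}
    (hVs : HasV (dualK P ν) ν (fun c => -f c) Vs) (ψ : X → ℝ) (z : ℝ) :
    Continuous (fun b => Cst ν f ψ Vs z b) := by
  unfold Cst
  refine continuous_finsetSum _ fun x _ => Continuous.mul continuous_const ?_
  exact intervalIntegral.continuous_primitive (fun a b => Cst_int hG hVs a b x) z

end PartG3


section PartG4
variable [Fintype X] [DecidableEq X] [Nonempty X]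

lemma KS_mono' {P : X → X → ℝ} (hP : ∀ x x', 0 ≤ P x x') (f : X → ℝ) (n : ℕ) {F G : X → ℝ → ℝ}
    (h : ∀ x u, 0 < u → F x u ≤ G x u) (x : X) (y : ℝ) :
    (KS P f ^ (n + 1)) F x y ≤ (KS P f ^ (n + 1)) G x y := by
  rw [KS_succ, KS_succ]
  refine Finset.sum_le_sum fun x' _ => mul_le_mul_of_nonneg_left ?_ (hP _ _)
  split_ifs with hp
  · refine KS_mono hP f n x' _ fun w u hu => h w u ?_
    rcases hu with hu | hu
    · exact hu
    · rw [hu]; exact hp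
  · exact le_rfl

lemma KS_abs' {P : X → X → ℝ} (hP : ∀ x x', 0 ≤ P x x') (f : X → ℝ) (n : ℕ) {F G : X → ℝ → ℝ}
    (h : ∀ x u, 0 < u → |F x u| ≤ G x u) (x : X) (y : ℝ) :
    |(KS P f ^ (n + 1)) F x y| ≤ (KS P f ^ (n + 1)) G x y := by
  rw [abs_le]
  constructor
  · have h1 : (KS P f ^ (n + 1)) (fun x u => (-1) * G x u) x y ≤ (KS P f ^ (n + 1)) F x y :=
      KS_mono' hP f n (fun x u hu => by linarith [neg_abs_le (F x u), h x u hu]) x y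
    rw [KS_smul] at h1
    linarith
  · exact KS_mono' hP f n (fun x u hu => (le_abs_self _).trans (h x u hu)) x y

/-- first block length -/
def mm (n : ℕ) : ℕ := n / 2
/-- second block length -/
def kk (n : ℕ) : ℕ := n - 1 - n / 2

lemma mm_lim : Tendsto mm atTop atTop :=
  Tendsto.comp (f := fun n : ℕ => n) (g := fun n => n / 2)
    (Nat.tendsto_div_const_atTop (by norm_num)) tendsto_id

lemma kk_ge (n : ℕ) : mm n - 1 ≤ kk n := by unfold mm kk; omega

lemma kk_lim : Tendsto kk atTop atTop :=
  tendsto_atTop_mono kk_ge ((tendsto_sub_atTop_nat 1).comp mm_lim)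

lemma mk_sum {n : ℕ} (hn : 1 ≤ n) : n = mm n + (kk n + 1) := by unfold mm kk; omega

lemma mm_low {n : ℕ} (hn : 4 ≤ n) : (n:ℝ) / 4 ≤ mm n := by
  have : n ≤ 4 * mm n := by unfold mm; omega
  have : (n:ℝ) ≤ 4 * (mm n : ℝ) := by exact_mod_cast this
  linarith

lemma kk_low {n : ℕ} (hn : 4 ≤ n) : (n:ℝ) / 4 ≤ kk n := by
  have : n ≤ 4 * kk n := by unfold kk; omega
  have : (n:ℝ) ≤ 4 * (kk n : ℝ) := by exact_mod_cast this
  linarith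

lemma half_lim {q : ℕ → ℕ} {c : ℝ} (h : ∀ n, |(q n : ℝ) - n / 2| ≤ c) {s : ℝ} :
    Tendsto (fun n : ℕ => (q n : ℝ) * (s / √(n:ℝ)) ^ 2) atTop (𝓝 (s ^ 2 / 2)) := by
  have h1 : Tendsto (fun n : ℕ => s ^ 2 * (((q n : ℝ) - n / 2) / n)) atTop (𝓝 (s ^ 2 * 0)) := by
    refine Tendsto.const_mul _ ?_
    refine squeeze_zero_norm (a := fun n : ℕ => c / n) (fun n => ?_)
      (tendsto_const_div_atTop_nhds_zero_nat c)
    rw [norm_div, Real.norm_eq_abs, Real.norm_natCast]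
    gcongr
    exact h n
  have h2 := h1.add (tendsto_const_nhds (x := s ^ 2 / 2))
  rw [mul_zero, zero_add] at h2
  refine h2.congr' ?_
  filter_upwards [eventually_gt_atTop 0] with n hn
  have : (0:ℝ) < n := by exact_mod_cast hn
  rw [div_pow, Real.sq_sqrt this.le]
  field_simp
  ring

lemma mm_abs (n : ℕ) : |(mm n : ℝ) - n / 2| ≤ 2 := by
  have h1 : 2 * mm n ≤ n := by unfold mm; omega
  have h2 : n ≤ 2 * mm n + 1 := by unfold mm; omega
  have h3 : 2 * (mm n : ℝ) ≤ n := by exact_mod_cast h1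
  have h4 : (n:ℝ) ≤ 2 * mm n + 1 := by exact_mod_cast h2
  rw [abs_le]; constructor <;> linarith

lemma kk_abs (n : ℕ) : |(kk n : ℝ) - n / 2| ≤ 2 := by
  have h1 : 2 * kk n ≤ n := by unfold kk; omega
  have h2 : n ≤ 2 * kk n + 2 := by unfold kk; omega
  have h3 : 2 * (kk n : ℝ) ≤ n := by exact_mod_cast h1
  have h4 : (n:ℝ) ≤ 2 * kk n + 2 := by exact_mod_cast h2
  rw [abs_le]; constructor <;> linarith

lemma Bt_cont (P : X → X → ℝ) (f ψ : X → ℝ) (z b : ℝ) (k : ℕ) (w : X) :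
    Continuous (fun t => Bt P f ψ z b k t w) := by
  have hi := KS_intble P f (k + 1) (win_int ψ z b) w
  have hm := KS_meas P f (k + 1) _ (win_meas ψ z b) w
  unfold Bt
  refine continuous_of_dominated (bound := fun u => |(KS P f ^ (k + 1)) (win ψ z b) w u|) ?_ ?_
    hi.abs ?_
  · intro t
    exact (Measurable.mul (by fun_prop) hm).aestronglyMeasurable
  · intro t
    refine Eventually.of_forall fun u => ?_
    rw [norm_mul]
    exact mul_le_of_le_one_left (abs_nonneg _) (Real.abs_sin_le_one _)
  · exact Eventually.of_forall fun u => by fun_prop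

/-- The smoothing of H splits into main and reflected part. -/
lemma split_id {P : X → X → ℝ} {f ψ : X → ℝ} {z b : ℝ} {D : ℝ} (hD : 0 < D) {q κ : ℝ → ℝ}
    (hq : Continuous q) (hκ : ∀ u, κ u = ∫ t in (0:ℝ)..D, q t * Real.cos (t * u)) {Cκ : ℝ}
    (hκb : ∀ u, |κ u| ≤ Cκ * (1 + u ^ 2)⁻¹) (k : ℕ) (w : X) (u : ℝ) :
    ∫ v in Set.Ioi 0, (KS P f ^ (k + 1)) (win ψ z b) w v * κ (u - v) =
    (∫ t in (0:ℝ)..D, 2 * q t * (Bt P f ψ z b k t w * Real.sin (t * u))) +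
    ∫ v in Set.Ioi 0, (KS P f ^ (k + 1)) (win ψ z b) w v * κ (u + v) := by
  have hi := KS_intble P f (k + 1) (win_int ψ z b) w
  have hm := KS_meas P f (k + 1) _ (win_meas ψ z b) w
  set H := (KS P f ^ (k + 1)) (win ψ z b) w with hH
  have hκc : Continuous κ := by
    have : κ = fun u => ∫ t in (0:ℝ)..D, q t * Real.cos (t * u) := funext hκ
    rw [this]
    exact intervalIntegral.continuous_parametric_intervalIntegral_of_continuous' (by fun_prop) 0 D
  have hC0 : ∀ u, |κ u| ≤ Cκ := fun u => by
    refine (hκb u).trans ?_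
    have hc : 0 ≤ Cκ := by
      have := (abs_nonneg _).trans (hκb 0)
      simpa using this
    exact mul_le_of_le_one_right hc (inv_le_one_of_one_le₀ (by nlinarith [sq_nonneg u]))
  have i1 : IntegrableOn (fun v => H v * κ (u - v)) (Set.Ioi 0) :=
    hi.mul_bdd (c := Cκ) (hκc.comp (by fun_prop)).aestronglyMeasurable
      (Eventually.of_forall fun v => hC0 _)
  have i2 : IntegrableOn (fun v => H v * κ (u + v)) (Set.Ioi 0) :=
    hi.mul_bdd (c := Cκ) (hκc.comp (by fun_prop)).aestronglyMeasurable
      (Eventually.of_forall fun v => hC0 _)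
  rw [← sub_eq_iff_eq_add, ← integral_sub i1 i2]
  have e1 : ∀ v, H v * κ (u - v) - H v * κ (u + v) =
      ∫ t in Set.Ioc 0 D, 2 * q t * (Real.sin (t * v) * H v * Real.sin (t * u)) := by
    intro v
    rw [← mul_sub, hκ, hκ, ← intervalIntegral.integral_sub
      (Continuous.intervalIntegrable (by fun_prop) _ _)
      (Continuous.intervalIntegrable (by fun_prop) _ _), ← intervalIntegral.integral_of_le hD.le,
      ← intervalIntegral.integral_const_mul]
    refine intervalIntegral.integral_congr fun t _ => ?_
    simp only [mul_sub, mul_add, Real.cos_sub, Real.cos_add]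
    ring
  simp only [e1]
  rw [integral_integral_swap, intervalIntegral.integral_of_le hD.le]
  · refine integral_congr_ae (Eventually.of_forall fun t => ?_)
    simp only [Bt]
    rw [integral_const_mul, integral_mul_const]
  · have hq1 : IntegrableOn (fun t => 2 * q t * Real.sin (t * u)) (Set.Ioc 0 D) :=
      (Continuous.integrableOn_Icc (by fun_prop)).mono_set Set.Ioc_subset_Icc_self
    have h1 := Integrable.mul_prod hi hq1
    have h2 := h1.bdd_mul (c := 1) (f := fun p : ℝ × ℝ => Real.sin (p.2 * p.1))
      (Continuous.aestronglyMeasurable (by fun_prop))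
      (Eventually.of_forall fun p => Real.abs_sin_le_one _)
    refine h2.congr (Eventually.of_forall fun p => ?_)
    simp only [Function.uncurry]
    ring

end PartG4


section PartG5
variable [Fintype X] [DecidableEq X] [Nonempty X]

lemma main_lim {P : X → X → ℝ} {ν f : X → ℝ} (hG : Good P ν f) {V Vs : X → ℝ → ℝ}
    (hV : HasV P ν f V) (hVs : HasV (dualK P ν) ν (fun c => -f c) Vs) {ψ : X → ℝ}
    (hψ : ∀ x, 0 ≤ ψ x) {z b : ℝ} (hz : 0 ≤ z) (hzb : z ≤ b) {D : ℝ} (hD : 0 < D) {q : ℝ → ℝ}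
    (hq : Continuous q) {e : ℝ} (he : |e| ≤ 1) (x : X) (y : ℝ) :
    Tendsto (fun n : ℕ => (n:ℝ) * √n * ∫ t in (0:ℝ)..D, q t * (KS P f ^ mm n)
      (fun w u => Bt P f ψ z b (kk n) t w * Real.sin (t * (u + e))) x y) atTop
      (𝓝 (q 0 * Cst ν f ψ Vs z b * V x y *
        ∫ s in Set.Ioi 0, s ^ 2 * Real.exp (-(sigma2 P ν f / 2) * s ^ 2))) := by
  obtain ⟨C1, hC1, H1⟩ := F4 hG hV D |y|
  obtain ⟨C2, hC2, H2⟩ := B_bd hG hVs hψ hz hzb D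
  obtain ⟨K, hK⟩ := (isCompact_Icc (a := (0:ℝ)) (b := D)).exists_bound_of_continuousOn hq.continuousOn
  have hK0 : 0 ≤ K := (norm_nonneg _).trans (hK 0 ⟨le_rfl, hD.le⟩)
  have hsq : Tendsto (fun n : ℕ => √(n:ℝ)) atTop atTop :=
    Real.tendsto_sqrt_atTop.comp tendsto_natCast_atTop_atTop
  rw [← integral_const_mul]
  refine scale_lim hD (r := fun n => (n:ℝ)) (Bd := fun s => 16 * (K * C1 * C2) * (1 + s ^ 2)⁻¹)
    ?_ (integrable_inv_one_add_sq.const_mul _).integrableOn (fun s => by positivity) ?_ ?_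
  · intro n
    obtain ⟨c, w, u, H⟩ := KS_sum P f (mm n) x y
    simp only [H]
    have := fun w => Bt_cont P f ψ z b (kk n) w
    refine Continuous.measurable (hq.mul (continuous_finsetSum _ fun p _ => ?_))
    exact continuous_const.mul ((this _).mul (by fun_prop))
  · filter_upwards [eventually_ge_atTop 4] with n hn t t0 tD
    have hn0 : (0:ℝ) < n := by exact_mod_cast (by omega : 0 < n)
    have b1 := H1 t ⟨t0.le, tD⟩ (mm n) (Bt P f ψ z b (kk n) t) _
      (H2 t ⟨t0.le, tD⟩ (kk n)) e he x y le_rfl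
    have b2 := hK t ⟨t0.le, tD⟩
    rw [Real.norm_eq_abs] at b2
    rw [abs_mul, abs_mul, abs_of_pos hn0]
    have m1 := mm_low hn
    have k1 := kk_low hn
    have l1 : 1 + n / 4 * t ^ 2 ≤ 1 + (mm n : ℝ) * t ^ 2 := by gcongr
    have l2 : 1 + n / 4 * t ^ 2 ≤ 1 + (kk n : ℝ) * t ^ 2 := by gcongr
    have e1 : (√(n:ℝ) * t) ^ 2 = n * t ^ 2 := by rw [mul_pow, Real.sq_sqrt hn0.le]
    rw [e1]
    calc (n:ℝ) * (|q t| * |(KS P f ^ mm n)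
            (fun w u => Bt P f ψ z b (kk n) t w * Real.sin (t * (u + e))) x y|)
        ≤ n * (K * (C1 * t / (1 + n / 4 * t ^ 2) * (C2 * t / (1 + n / 4 * t ^ 2)))) := by
          gcongr
          refine b1.trans ?_
          gcongr
      _ = (K * C1 * C2) * ((n * t ^ 2) / (1 + n / 4 * t ^ 2) ^ 2) := by
          field_simp
      _ ≤ (K * C1 * C2) * (16 * (1 + n * t ^ 2)⁻¹) := by
          gcongr
          rw [← div_eq_mul_inv, div_le_div_iff₀ (by positivity) (by positivity)]
          have : 0 ≤ n * t ^ 2 := by positivity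
          nlinarith
      _ = _ := by ring
  · intro s hs
    have ht : Tendsto (fun n : ℕ => s / √(n:ℝ)) atTop (𝓝 0) := hsq.const_div_atTop s
    have htp : ∀ᶠ n : ℕ in atTop, 0 < s / √(n:ℝ) := by
      filter_upwards [eventually_gt_atTop 0] with n hn
      have : (0:ℝ) < n := by exact_mod_cast hn
      positivity
    have ht0 : ∀ n : ℕ, 0 ≤ s / √(n:ℝ) := fun n => by positivity
    have hB := fun w => B_lim hG hVs hψ hz hzb kk_lim ht0 htp ht (half_lim kk_abs) w
    set E := Real.exp (-(sigma2 P ν f * (s ^ 2 / 2) / 2)) with hE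
    have h5 := F5' hG hV (V_lim hG hV x y) (m := mm) (t := fun n : ℕ => s / √(n:ℝ))
      (φ := fun n w => Bt P f ψ z b (kk n) (s / √(n:ℝ)) w / (s / √(n:ℝ)))
      (φ' := fun _ => E * Cst ν f ψ Vs z b) mm_lim ht0 htp ht (half_lim mm_abs) hB he
    have hav : av ν (fun _ => E * Cst ν f ψ Vs z b) = E * Cst ν f ψ Vs z b := by
      unfold av; rw [← Finset.mul_sum, hG.st.nuSum, mul_one]
    rw [hav] at h5
    have hq0 : Tendsto (fun n : ℕ => q (s / √(n:ℝ))) atTop (𝓝 (q 0)) :=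
      (hq.tendsto 0).comp ht
    have h6 := (hq0.mul h5).const_mul (s ^ 2)
    have eE : Real.exp (-(sigma2 P ν f / 2) * s ^ 2) = E * E := by
      rw [hE, ← Real.exp_add]; congr 1; ring
    rw [eE]
    refine (h6.congr' ?_).trans (le_of_eq ?_)
    · filter_upwards [eventually_gt_atTop 0] with n hn
      have hn0 : (0:ℝ) < n := by exact_mod_cast hn
      have hsn : 0 < √(n:ℝ) := Real.sqrt_pos.2 hn0
      have e3 : (fun w u => Bt P f ψ z b (kk n) (s / √(n:ℝ)) w / (s / √(n:ℝ)) *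
          Real.sin (s / √(n:ℝ) * (u + e))) = fun w u => (s / √(n:ℝ))⁻¹ *
          (Bt P f ψ z b (kk n) (s / √(n:ℝ)) w * Real.sin (s / √(n:ℝ) * (u + e))) := by
        ext w u; ring
      rw [e3, KS_smul]
      have e4 : (n:ℝ) = √(n:ℝ) ^ 2 := (Real.sq_sqrt hn0.le).symm
      set A := (KS P f ^ mm n) (fun w u => Bt P f ψ z b (kk n) (s / √(n:ℝ)) w *
        Real.sin (s / √(n:ℝ) * (u + e))) x y
      calc _ = √(n:ℝ) ^ 2 * (q (s / √(n:ℝ)) * A) := by field_simp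
        _ = _ := by rw [← e4]
    · congr 1; ring

lemma refl_small {P : X → X → ℝ} {ν f : X → ℝ} (hG : Good P ν f) {V Vs : X → ℝ → ℝ}
    (hV : HasV P ν f V) (hVs : HasV (dualK P ν) ν (fun c => -f c) Vs) {ψ : X → ℝ}
    (hψ : ∀ x, 0 ≤ ψ x) {z b : ℝ} (hz : 0 ≤ z) (hzb : z ≤ b) {κ : ℝ → ℝ} (hκc : Continuous κ)
    {Cκ : ℝ} (hκb : ∀ u, |κ u| ≤ Cκ * (1 + u ^ 2)⁻¹) {e : ℝ} (he : |e| ≤ 1) (x : X) (y : ℝ) :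
    Tendsto (fun n : ℕ => (n:ℝ) * √n * (KS P f ^ mm n) (fun w u => ∫ v in Set.Ioi 0,
      (KS P f ^ (kk n + 1)) (win ψ z b) w v * κ (u + e + v)) x y) atTop (𝓝 0) := by
  obtain ⟨C1, hC1, H1⟩ := loc hG hV y
  obtain ⟨C2, hC2, H2⟩ := H_mass hG hVs hψ hz hzb
  obtain ⟨C3, hC3, H3⟩ := H_loc hG hVs hψ hz hzb
  have hCκ : 0 ≤ Cκ := by
    have := (abs_nonneg _).trans (hκb 0)
    simpa using this
  have hU : Tendsto (fun n : ℕ => √√(n:ℝ)) atTop atTop :=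
    Real.tendsto_sqrt_atTop.comp (Real.tendsto_sqrt_atTop.comp tendsto_natCast_atTop_atTop)
  set Ct := 4 * Cκ * (32 * C3 * C1 + 8 * C2 * C1) with hCt
  refine squeeze_zero_norm' (a := fun n : ℕ => Ct / √√(n:ℝ)) ?_ (hU.const_div_atTop Ct)
  filter_upwards [eventually_ge_atTop 4, hU.eventually_ge_atTop 1] with n hn hU1
  have hn0 : (0:ℝ) < n := by exact_mod_cast (by omega : 0 < n)
  set U := √√(n:ℝ) with hUd
  have hU0 : 0 < U := by linarith
  have hU2 : U ^ 2 = √(n:ℝ) := Real.sq_sqrt (by positivity)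
  have hU4 : (n:ℝ) = (U ^ 2) ^ 2 := by rw [hU2, Real.sq_sqrt hn0.le]
  set k := kk n with hk
  have hk4 : (n:ℝ) / 4 ≤ (k:ℝ) + 1 := by linarith [kk_low hn]
  have hm4 : (n:ℝ) / 4 ≤ (mm n:ℝ) + 1 := by linarith [mm_low hn]
  have hHn : ∀ w v, 0 ≤ (KS P f ^ (k + 1)) (win ψ z b) w v := fun w v =>
    KS_nonneg hG.st.nonneg f (k + 1) w v (fun w u _ => win_nonneg hψ z b w u)
  have hHi := fun w => KS_intble P f (k + 1) (win_int ψ z b) w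
  set α := C3 / (U * (k + 1)) with hα
  set β := C2 / √((k:ℝ) + 1) with hβ
  have pt : ∀ w u, 0 < u → |∫ v in Set.Ioi 0, (KS P f ^ (k + 1)) (win ψ z b) w v * κ (u + e + v)| ≤
      4 * Cκ * (2 * U ^ 2 * α) * (1 / (1 ^ 2 + u ^ 2)) + 4 * Cκ * β * (1 / (U ^ 2 + u ^ 2)) := by
    intro w u hu
    have i1 : IntegrableOn (fun v => 1 / (U ^ 2 + v ^ 2) * (KS P f ^ (k + 1)) (win ψ z b) w v)
        (Set.Ioi 0) := by
      refine (hHi w).bdd_mul (c := 1) (Measurable.aestronglyMeasurable (by fun_prop))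
        (Eventually.of_forall fun v => ?_)
      rw [Real.norm_eq_abs, abs_of_nonneg (by positivity), div_le_one (by positivity)]
      nlinarith [sq_nonneg v]
    have step : |∫ v in Set.Ioi 0, (KS P f ^ (k + 1)) (win ψ z b) w v * κ (u + e + v)| ≤
        ∫ v in Set.Ioi 0, ((4 * Cκ * (2 * U ^ 2) * (1 / (1 ^ 2 + u ^ 2))) *
          (1 / (U ^ 2 + v ^ 2) * (KS P f ^ (k + 1)) (win ψ z b) w v) +
          (4 * Cκ * (1 / (U ^ 2 + u ^ 2))) * (KS P f ^ (k + 1)) (win ψ z b) w v) := by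
      rw [← Real.norm_eq_abs]
      refine norm_integral_le_of_norm_le ((i1.const_mul _).add ((hHi w).const_mul _)) ?_
      refine (ae_restrict_iff' measurableSet_Ioi).2 (Eventually.of_forall fun v hv => ?_)
      have hv0 : 0 < v := hv
      rw [norm_mul, Real.norm_eq_abs, Real.norm_eq_abs, abs_of_nonneg (hHn w v)]
      have h1 : |κ (u + e + v)| ≤ 4 * Cκ * (1 / (1 + (u + v) ^ 2)) := by
        refine (hκb _).trans ?_
        rw [mul_comm 4 Cκ, mul_assoc]
        refine mul_le_mul_of_nonneg_left ?_ hCκ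
        rw [inv_eq_one_div, mul_one_div, div_le_div_iff₀ (by positivity) (by positivity)]
        have h2 : e ^ 2 ≤ 1 := by rw [← sq_abs]; nlinarith [abs_nonneg e]
        nlinarith [sq_nonneg (u + v + 2 * e)]
      have h2 : 1 / (1 + (u + v) ^ 2) ≤ (2 * U ^ 2) * (1 / (1 ^ 2 + u ^ 2)) * (1 / (U ^ 2 + v ^ 2)) +
          1 / (U ^ 2 + u ^ 2) := by
        rcases le_total v U with h | h
        · have : 1 / (1 + (u + v) ^ 2) ≤
              (2 * U ^ 2) * (1 / (1 ^ 2 + u ^ 2)) * (1 / (U ^ 2 + v ^ 2)) := by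
            rw [mul_one_div, mul_one_div, div_div, div_le_div_iff₀ (by positivity) (by positivity)]
            have a1 : U ^ 2 + v ^ 2 ≤ 2 * U ^ 2 := by nlinarith
            have a2 : 1 ^ 2 + u ^ 2 ≤ 1 + (u + v) ^ 2 := by nlinarith
            rw [one_mul, mul_comm]
            exact mul_le_mul a1 a2 (by positivity) (by positivity)
          have : 0 ≤ 1 / (U ^ 2 + u ^ 2) := by positivity
          linarith
        · have : 1 / (1 + (u + v) ^ 2) ≤ 1 / (U ^ 2 + u ^ 2) :=
            one_div_le_one_div_of_le (by positivity) (by nlinarith)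
          have : 0 ≤ (2 * U ^ 2) * (1 / (1 ^ 2 + u ^ 2)) * (1 / (U ^ 2 + v ^ 2)) := by positivity
          linarith
      calc (KS P f ^ (k + 1)) (win ψ z b) w v * |κ (u + e + v)|
          ≤ (KS P f ^ (k + 1)) (win ψ z b) w v * (4 * Cκ * ((2 * U ^ 2) * (1 / (1 ^ 2 + u ^ 2)) *
            (1 / (U ^ 2 + v ^ 2)) + 1 / (U ^ 2 + u ^ 2))) := by
            refine mul_le_mul_of_nonneg_left (h1.trans ?_) (hHn w v)
            exact mul_le_mul_of_nonneg_left h2 (by positivity)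
        _ = _ := by ring
    refine step.trans ?_
    rw [integral_add (i1.const_mul _) ((hHi w).const_mul _), integral_const_mul, integral_const_mul]
    have h3 := H3 U hU1 k w
    have h2 := H2 k w
    calc _ ≤ (4 * Cκ * (2 * U ^ 2) * (1 / (1 ^ 2 + u ^ 2))) * α +
          (4 * Cκ * (1 / (U ^ 2 + u ^ 2))) * β := by gcongr
      _ = _ := by ring
  obtain ⟨m', hm'⟩ : ∃ m', mm n = m' + 1 := ⟨mm n - 1, by unfold mm; omega⟩
  have hb := KS_abs' hG.st.nonneg f m' pt x y
  rw [← hm', KS_addf, KS_smul, KS_smul] at hb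
  have l1 := H1 1 le_rfl (mm n) x y le_rfl
  have l2 := H1 U hU1 (mm n) x y le_rfl
  rw [norm_mul, Real.norm_eq_abs, Real.norm_eq_abs, abs_of_nonneg (by positivity)]
  have a1 : α ≤ C3 / (U * (n / 4)) := by rw [hα]; gcongr
  have a2 : β ≤ C2 / (U ^ 2 / 2) := by
    rw [hβ]
    gcongr
    rw [hU2]
    have : √((n:ℝ) / 4) = √(n:ℝ) / 2 := by
      rw [Real.sqrt_div hn0.le, show (4:ℝ) = 2 ^ 2 by norm_num, Real.sqrt_sq (by norm_num)]
    rw [← this]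
    exact Real.sqrt_le_sqrt hk4
  have a3 : C1 / (1 * ((mm n : ℝ) + 1)) ≤ C1 / (n / 4) := by
    rw [one_mul]; gcongr
  have a4 : C1 / (U * ((mm n : ℝ) + 1)) ≤ C1 / (U * (n / 4)) := by gcongr
  have hα0 : 0 ≤ α := by positivity
  have hβ0 : 0 ≤ β := by positivity
  calc _ ≤ (n:ℝ) * √n * (4 * Cκ * (2 * U ^ 2 * (C3 / (U * (n / 4)))) * (C1 / (n / 4)) +
        4 * Cκ * (C2 / (U ^ 2 / 2)) * (C1 / (U * (n / 4)))) := by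
        refine mul_le_mul_of_nonneg_left (hb.trans ?_) (by positivity)
        refine add_le_add ?_ ?_
        · refine (mul_le_mul_of_nonneg_left (l1.trans a3) (by positivity)).trans ?_
          gcongr
        · refine (mul_le_mul_of_nonneg_left (l2.trans a4) (by positivity)).trans ?_
          gcongr
    _ = Ct / U := by
        rw [← hU2, hU4, hCt]
        field_simp
        ring

lemma W_lim {P : X → X → ℝ} {ν f : X → ℝ} (hG : Good P ν f) {V Vs : X → ℝ → ℝ}
    (hV : HasV P ν f V) (hVs : HasV (dualK P ν) ν (fun c => -f c) Vs) {ψ : X → ℝ}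
    (hψ : ∀ x, 0 ≤ ψ x) {z b : ℝ} (hz : 0 ≤ z) (hzb : z ≤ b) {D : ℝ} (hD : 0 < D) {q κ : ℝ → ℝ}
    (hq : Continuous q) (hκ : ∀ u, κ u = ∫ t in (0:ℝ)..D, q t * Real.cos (t * u)) {Cκ : ℝ}
    (hκb : ∀ u, |κ u| ≤ Cκ * (1 + u ^ 2)⁻¹) {e : ℝ} (he : |e| ≤ 1) (x : X) (y : ℝ) :
    Tendsto (fun n : ℕ => (n:ℝ) * √n * (KS P f ^ mm n) (fun w u => ∫ v in Set.Ioi 0,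
      (KS P f ^ (kk n + 1)) (win ψ z b) w v * κ (u + e - v)) x y) atTop
      (𝓝 (2 * q 0 * Cst ν f ψ Vs z b * V x y *
        ∫ s in Set.Ioi 0, s ^ 2 * Real.exp (-(sigma2 P ν f / 2) * s ^ 2))) := by
  have hκc : Continuous κ := by
    have : κ = fun u => ∫ t in (0:ℝ)..D, q t * Real.cos (t * u) := funext hκ
    rw [this]
    exact intervalIntegral.continuous_parametric_intervalIntegral_of_continuous' (by fun_prop) 0 D
  have h1 := main_lim hG hV hVs hψ hz hzb hD (q := fun t => 2 * q t) (by fun_prop) he x y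
  have h2 := refl_small hG hV hVs hψ hz hzb hκc hκb he x y
  have h3 := h1.add h2
  rw [add_zero] at h3
  refine h3.congr fun n => ?_
  simp only [split_id hD hq hκ hκb]
  rw [KS_addf, mul_add]
  congr 2
  have hBc := fun w => Bt_cont P f ψ z b (kk n) w
  have := (KS_integral (volume.restrict (Set.Ioc 0 D)) P f (mm n)
    (φ := fun t w u => 2 * q t * (Bt P f ψ z b (kk n) t w * Real.sin (t * (u + e))))
    (fun w u => by
      refine (Continuous.integrableOn_Icc ?_).mono_set Set.Ioc_subset_Icc_self
      exact (continuous_const.mul hq).mul ((hBc w).mul (by fun_prop))) x y).2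
  simp only [intervalIntegral.integral_of_le hD.le]
  rw [this]
  simp only [KS_smul]

end PartG5


section PartG6
variable [Fintype X] [DecidableEq X] [Nonempty X]

lemma win_shift {ψ : X → ℝ} (hψ : ∀ x, 0 ≤ ψ x) (z b d r : ℝ) (hd : 0 ≤ d) (hr : d ≤ r) (x : X)
    (u : ℝ) : win ψ z b x u ≤ win ψ z (b + r) x (u + d) := by
  unfold win
  refine mul_le_mul_of_nonneg_left ?_ (hψ x)
  by_cases h : u ∈ Set.Icc z b
  · have h' : u + d ∈ Set.Icc z (b + r) := ⟨by linarith [h.1], by linarith [h.2]⟩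
    rw [Set.indicator_of_mem h, Set.indicator_of_mem h']
    rfl
  · rw [Set.indicator_of_notMem h]
    exact Set.indicator_nonneg (fun _ _ => zero_le_one) _

lemma upper_pt {P : X → X → ℝ} (hP : ∀ x x', 0 ≤ P x x') (f : X → ℝ) {ψ : X → ℝ}
    (hψ : ∀ x, 0 ≤ ψ x) (z b : ℝ) (k : ℕ) {δ ε : ℝ} (hδ : 0 < δ) (hε : 0 < ε) (w : X) (u : ℝ)
    (hu : 0 < u) :
    (π * δ - 4 / ε) * (KS P f ^ k) (win ψ z b) w u ≤
      ∫ v in Set.Ioi 0, (KS P f ^ k) (win ψ z (b + 2 * ε)) w v * Fd δ (u + ε - v) := by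
  have hH0 : ∀ v, 0 ≤ (KS P f ^ k) (win ψ z (b + 2 * ε)) w v := fun v =>
    KS_nonneg hP f k w v (fun w u _ => win_nonneg hψ z _ w u)
  have hH0' : 0 ≤ (KS P f ^ k) (win ψ z b) w u :=
    KS_nonneg hP f k w u (fun w u _ => win_nonneg hψ z _ w u)
  have hIntg : IntegrableOn (fun v => (KS P f ^ k) (win ψ z (b + 2 * ε)) w v * Fd δ (u + ε - v))
      (Set.Ioi 0) := by
    refine (KS_intble P f k (win_int ψ z (b + 2 * ε)) w).mul_bdd (c := δ ^ 2 / 2)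
      (((Fd_cont δ).comp (by fun_prop : Continuous fun v => u + ε - v)).aestronglyMeasurable)
      (Eventually.of_forall fun v => ?_)
    rw [Real.norm_eq_abs, abs_of_nonneg (Fd_nonneg _ _ hδ.le)]
    exact Fd_le _ _ hδ.le
  have hsub : Set.Ioc u (u + 2 * ε) ⊆ Set.Ioi 0 := fun v hv => hu.trans hv.1
  calc (π * δ - 4 / ε) * (KS P f ^ k) (win ψ z b) w u
      ≤ (∫ s in (-ε)..ε, Fd δ s) * (KS P f ^ k) (win ψ z b) w u :=
        mul_le_mul_of_nonneg_right (Fd_window δ ε hδ hε) hH0'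
    _ = ∫ v in u..(u + 2 * ε), (KS P f ^ k) (win ψ z b) w u * Fd δ (u + ε - v) := by
        rw [intervalIntegral.integral_const_mul,
          intervalIntegral.integral_comp_sub_left (fun v => Fd δ v), mul_comm]
        congr 2 <;> ring
    _ = ∫ v in Set.Ioc u (u + 2 * ε), (KS P f ^ k) (win ψ z b) w u * Fd δ (u + ε - v) := by
        rw [intervalIntegral.integral_of_le (by linarith)]
    _ ≤ ∫ v in Set.Ioc u (u + 2 * ε), (KS P f ^ k) (win ψ z (b + 2 * ε)) w v *
          Fd δ (u + ε - v) := by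
        refine setIntegral_mono_on ?_ (hIntg.mono_set hsub) measurableSet_Ioc fun v hv => ?_
        · refine (Continuous.integrableOn_Icc ?_).mono_set Set.Ioc_subset_Icc_self
          exact continuous_const.mul ((Fd_cont δ).comp (by fun_prop))
        · refine mul_le_mul_of_nonneg_right ?_ (Fd_nonneg _ _ hδ.le)
          have := KS_mono_start hP f k (F := win ψ z b) (G := win ψ z (b + 2 * ε))
            (fun x u => win_nonneg hψ z _ x u) (v - u) (by linarith [hv.1])
            (fun x u' => win_shift hψ z b (v - u) (2 * ε) (by linarith [hv.1])
              (by linarith [hv.2]) x u') w u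
          rwa [show u + (v - u) = v by ring] at this
    _ ≤ _ := by
        refine setIntegral_mono_set hIntg ?_ (LE.le.eventuallyLE hsub)
        exact Eventually.of_forall fun v => mul_nonneg (hH0 v) (Fd_nonneg _ _ hδ.le)

/-- lower kernel -/
noncomputable def Lk (δ ε u : ℝ) : ℝ := Fd δ u - (1 + π / ε) ^ 2 * Gk u

lemma Lk_le (δ ε u : ℝ) : Lk δ ε u ≤ Fd δ u := by
  unfold Lk
  have := Gk_nonneg u
  have : 0 ≤ (1 + π / ε) ^ 2 * Gk u := by positivity
  linarith

lemma Lk_neg {δ ε u : ℝ} (hε : 0 < ε) (h : ε ≤ |u|) : Lk δ ε u ≤ 0 := by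
  have hp := Real.pi_pos
  have hu : 0 < |u| := hε.trans_le h
  have h1 := Fd_le2 δ u
  have h2 := Gk_low u
  have h3 : |u| + π ≤ (1 + π / ε) * |u| := by
    have : π ≤ π / ε * |u| := by
      rw [div_mul_eq_mul_div, le_div_iff₀ hε]; gcongr
    linarith
  have h4 : (|u| + π) ^ 2 ≤ (1 + π / ε) ^ 2 * u ^ 2 := by
    rw [← sq_abs u, ← mul_pow]; gcongr
  have h5 := mul_le_mul_of_nonneg_left h4 (Gk_nonneg u)
  have h6 : 0 < u ^ 2 := by rw [← sq_abs]; positivity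
  unfold Lk
  by_contra hc
  push Not at hc
  have := mul_pos hc h6
  nlinarith

lemma Lk_rep {δ : ℝ} (hδ : 1 ≤ δ) (ε u : ℝ) : Lk δ ε u = ∫ t in (0:ℝ)..δ,
    ((δ - t) - (1 + π / ε) ^ 2 * (max (1 - t) 0 * (1 + Real.cos (π * t)))) * Real.cos (t * u) := by
  have h1 : Gk u = ∫ t in (0:ℝ)..δ, max (1 - t) 0 * (1 + Real.cos (π * t)) * Real.cos (t * u) := by
    rw [← intervalIntegral.integral_add_adjacent_intervals (b := 1)
      (Continuous.intervalIntegrable (by fun_prop) _ _)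
      (Continuous.intervalIntegrable (by fun_prop) _ _)]
    have e1 : ∫ t in (1:ℝ)..δ, max (1 - t) 0 * (1 + Real.cos (π * t)) * Real.cos (t * u) = 0 := by
      refine Eq.trans (intervalIntegral.integral_congr (g := fun _ => (0:ℝ)) fun t ht => ?_)
        intervalIntegral.integral_zero
      rw [Set.uIcc_of_le hδ] at ht
      rw [max_eq_right (by linarith [ht.1])]
      simp
    rw [e1, add_zero]
    unfold Gk
    refine intervalIntegral.integral_congr fun t ht => ?_
    rw [Set.uIcc_of_le zero_le_one] at ht
    rw [max_eq_left (by linarith [ht.2])]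
  unfold Lk Fd
  rw [h1, ← intervalIntegral.integral_const_mul,
    ← intervalIntegral.integral_sub (Continuous.intervalIntegrable (by fun_prop) _ _)
    (Continuous.intervalIntegrable (by fun_prop) _ _)]
  refine intervalIntegral.integral_congr fun t _ => ?_
  ring

lemma Lk_bd {δ : ℝ} (hδ : 0 ≤ δ) (ε : ℝ) : ∃ C, ∀ u, |Lk δ ε u| ≤ C * (1 + u ^ 2)⁻¹ := by
  obtain ⟨C, hC, H⟩ := Gk_bd
  refine ⟨(δ ^ 2 / 2 + 2) + (1 + π / ε) ^ 2 * C, fun u => ?_⟩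
  unfold Lk
  refine (abs_sub _ _).trans ?_
  rw [abs_mul, abs_of_nonneg (sq_nonneg (1 + π / ε)), add_mul, mul_assoc]
  exact add_le_add (Fd_bd δ u hδ) (mul_le_mul_of_nonneg_left (H u) (sq_nonneg _))

lemma lower_pt {P : X → X → ℝ} (hP : ∀ x x', 0 ≤ P x x') (f : X → ℝ) {ψ : X → ℝ}
    (hψ : ∀ x, 0 ≤ ψ x) (z b : ℝ) (k : ℕ) {δ ε : ℝ} (hδ : 0 < δ) (hε : 0 < ε) (w : X) (u : ℝ) :
    ∫ v in Set.Ioi 0, (KS P f ^ k) (win ψ z (b - 2 * ε)) w v * Lk δ ε (u + -ε - v) ≤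
    π * δ * (KS P f ^ k) (win ψ z b) w u := by
  have hH0 : ∀ v, 0 ≤ (KS P f ^ k) (win ψ z (b - 2 * ε)) w v := fun v =>
    KS_nonneg hP f k w v (fun w u _ => win_nonneg hψ z _ w u)
  have hH0' : 0 ≤ (KS P f ^ k) (win ψ z b) w u :=
    KS_nonneg hP f k w u (fun w u _ => win_nonneg hψ z _ w u)
  have hFi : Integrable (fun v => Fd δ (u + -ε - v)) := (Fd_int δ hδ.le).comp_sub_left (u + -ε)
  have hπ := Real.pi_pos
  by_cases hIntg : IntegrableOn (fun v => (KS P f ^ k) (win ψ z (b - 2 * ε)) w v *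
    Lk δ ε (u + -ε - v)) (Set.Ioi 0)
  swap
  · rw [integral_undef hIntg]; positivity
  calc _ ≤ ∫ v in Set.Ioi 0, (KS P f ^ k) (win ψ z b) w u * Fd δ (u + -ε - v) := by
        refine setIntegral_mono_on hIntg (hFi.const_mul _).integrableOn measurableSet_Ioi
          fun v _ => ?_
        have hF := Fd_nonneg δ (u + -ε - v) hδ.le
        rcases le_total ε |u + -ε - v| with h | h
        · exact (mul_nonpos_of_nonneg_of_nonpos (hH0 v) (Lk_neg hε h)).trans (mul_nonneg hH0' hF)
        · refine (mul_le_mul_of_nonneg_left (Lk_le _ _ _) (hH0 v)).trans ?_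
          refine mul_le_mul_of_nonneg_right ?_ hF
          rw [abs_le] at h
          have := KS_mono_start hP f k (F := win ψ z (b - 2 * ε)) (G := win ψ z b)
            (fun x u => win_nonneg hψ z _ x u) (u - v) (by linarith [h.1])
            (fun x u' => by
              have := win_shift hψ z (b - 2 * ε) (u - v) (2 * ε) (by linarith [h.1])
                (by linarith [h.2]) x u'
              rwa [sub_add_cancel] at this) w v
          rwa [show v + (u - v) = u by ring] at this
    _ ≤ ∫ v, (KS P f ^ k) (win ψ z b) w u * Fd δ (u + -ε - v) :=
        setIntegral_le_integral (hFi.const_mul _)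
          (Eventually.of_forall fun v => mul_nonneg hH0' (Fd_nonneg _ _ hδ.le))
    _ = _ := by
        rw [integral_const_mul, integral_sub_left_eq_self (fun v => Fd δ v) volume (u + -ε),
          Fd_integral δ hδ, mul_comm]

lemma gauss_int {s : ℝ} (hs : 0 < s) :
    ∫ t in Set.Ioi 0, t ^ 2 * Real.exp (-(s / 2) * t ^ 2) = √(2 * π) / (2 * √s ^ 3) := by
  have h := integral_rpow_mul_exp_neg_mul_rpow (p := 2) (q := 2) (b := s / 2) (by norm_num)
    (by norm_num) (by positivity)
  have e : ∀ t : ℝ, t ^ (2:ℝ) = t ^ 2 := fun t => by norm_cast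
  simp only [e] at h
  rw [h]
  have hG : Real.Gamma ((2 + 1) / 2) = √π / 2 := by
    rw [show ((2:ℝ) + 1) / 2 = 1 / 2 + 1 by norm_num, Real.Gamma_add_one (by norm_num),
      Real.Gamma_one_half_eq]
    ring
  rw [hG]
  have hb : (s / 2) ^ (-(2 + 1) / 2 : ℝ) = (√(s / 2) ^ 3)⁻¹ := by
    rw [show (-(2 + 1) / 2 : ℝ) = -((1/2) * (3:ℕ)) by norm_num, Real.rpow_neg (by positivity),
      Real.rpow_mul (by positivity), ← Real.sqrt_eq_rpow, Real.rpow_natCast]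
  rw [hb, Real.sqrt_div hs.le, Real.sqrt_mul (by norm_num)]
  have h2 : √2 ^ 2 = (2:ℝ) := Real.sq_sqrt (by norm_num)
  have hs0 : 0 < √s := Real.sqrt_pos.2 hs
  have h20 : 0 < √(2:ℝ) := Real.sqrt_pos.2 (by norm_num)
  field_simp
  linear_combination h2

lemma core {P : X → X → ℝ} {ν f : X → ℝ} (hG : Good P ν f) {V Vs : X → ℝ → ℝ}
    (hV : HasV P ν f V) (hVs : HasV (dualK P ν) ν (fun c => -f c) Vs) {ψ : X → ℝ}
    (hψ : ∀ x, 0 ≤ ψ x) {z b : ℝ} (hz : 0 ≤ z) (hzb : z < b) (x : X) (y : ℝ) :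
    Tendsto (fun n : ℕ => (n:ℝ) * √n * (KS P f ^ n) (win ψ z b) x y) atTop
      (𝓝 (2 / π * (Cst ν f ψ Vs z b * V x y *
        ∫ s in Set.Ioi 0, s ^ 2 * Real.exp (-(sigma2 P ν f / 2) * s ^ 2)))) := by
  set I := ∫ s in Set.Ioi 0, s ^ 2 * Real.exp (-(sigma2 P ν f / 2) * s ^ 2) with hI
  have hπ := Real.pi_gt_three
  have hP := hG.st.nonneg
  have hCc := Cst_cont hG hVs ψ z
  have key : ∀ n : ℕ, 4 ≤ n → ∃ m', mm n = m' + 1 ∧ ∀ b', (KS P f ^ n) (win ψ z b') =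
      (KS P f ^ (m' + 1)) ((KS P f ^ (kk n + 1)) (win ψ z b')) := by
    intro n hn
    obtain ⟨m', hm'⟩ : ∃ m', mm n = m' + 1 := ⟨mm n - 1, by unfold mm; omega⟩
    refine ⟨m', hm', fun b' => ?_⟩
    rw [← KS_add, ← hm', ← mk_sum (by omega)]
  have lims : Tendsto (fun ε : ℝ => ε) (𝓝[>] 0) (𝓝 0) := tendsto_nhdsWithin_of_tendsto_nhds tendsto_id
  have pos : ∀ᶠ ε : ℝ in 𝓝[>] 0, 0 < ε := self_mem_nhdsWithin
  rw [tendsto_order]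
  constructor
  · intro c hc
    have g : Tendsto (fun ε : ℝ => (2 / π) * ((1 - 2 * (ε * (ε + π) ^ 2)) *
        (Cst ν f ψ Vs z (b - 2 * ε) * V x y * I))) (𝓝[>] 0)
        (𝓝 ((2 / π) * (Cst ν f ψ Vs z b * V x y * I))) := by
      refine tendsto_nhdsWithin_of_tendsto_nhds ?_
      have hc' : Continuous (fun ε : ℝ => (2 / π) * ((1 - 2 * (ε * (ε + π) ^ 2)) *
        (Cst ν f ψ Vs z (b - 2 * ε) * V x y * I))) :=
        continuous_const.mul ((by fun_prop : Continuous fun ε : ℝ => (1 - 2 * (ε * (ε + π) ^ 2))).mul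
          (((hCc.comp (by fun_prop : Continuous fun ε : ℝ => b - 2 * ε)).mul continuous_const).mul
            continuous_const))
      have := hc'.tendsto 0
      simpa using this
    obtain ⟨ε, h1, hε, h3, h4⟩ := ((g.eventually (lt_mem_nhds hc)).and (pos.and
      ((lims.eventually (gt_mem_nhds (zero_lt_one))).and
        (lims.eventually (gt_mem_nhds (by linarith : (0:ℝ) < (b - z) / 2)))))).exists
    set δ := (ε ^ 3)⁻¹ with hδ
    have hδ1 : 1 ≤ δ := by
      rw [hδ]; exact (one_le_inv₀ (by positivity)).2 (pow_le_one₀ hε.le h3.le)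
    have hδ0 : 0 < δ := by linarith
    obtain ⟨Cκ, hCκ⟩ := Lk_bd hδ0.le ε
    have W := W_lim hG hV hVs hψ (b := b - 2 * ε) hz (by linarith) hδ0
      (q := fun t => (δ - t) - (1 + π / ε) ^ 2 * (max (1 - t) 0 * (1 + Real.cos (π * t))))
      (κ := Lk δ ε) (by fun_prop) (Lk_rep hδ1 ε) hCκ (e := -ε)
      (by rw [abs_neg, abs_of_pos hε]; exact h3.le) x y
    have W2 := W.const_mul ((π * δ)⁻¹)
    have e : (π * δ)⁻¹ * (2 * ((δ - 0) - (1 + π / ε) ^ 2 * (max (1 - 0) 0 *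
        (1 + Real.cos (π * 0)))) * Cst ν f ψ Vs z (b - 2 * ε) * V x y * I) =
        (2 / π) * ((1 - 2 * (ε * (ε + π) ^ 2)) * (Cst ν f ψ Vs z (b - 2 * ε) * V x y * I)) := by
      rw [max_eq_left (by norm_num), mul_zero, Real.cos_zero, hδ]
      field_simp
      ring
    rw [e] at W2
    filter_upwards [W2.eventually (lt_mem_nhds h1), eventually_ge_atTop 4] with n hn hn4
    refine hn.trans_le ?_
    obtain ⟨m', hm', hk⟩ := key n hn4
    rw [hk b, hm', inv_mul_le_iff₀ (by positivity)]
    have := KS_mono' hP f m' (fun w u (_ : 0 < u) =>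
      lower_pt hP f hψ z b (kk n + 1) hδ0 hε w u) x y
    rw [KS_smul] at this
    calc _ ≤ (n:ℝ) * √n * (π * δ * (KS P f ^ (m' + 1)) ((KS P f ^ (kk n + 1)) (win ψ z b)) x y) :=
          mul_le_mul_of_nonneg_left this (by positivity)
      _ = _ := by ring
  · intro c hc
    have g : Tendsto (fun ε : ℝ => (2 / (π - 4 * ε)) *
        (Cst ν f ψ Vs z (b + 2 * ε) * V x y * I)) (𝓝[>] 0)
        (𝓝 ((2 / π) * (Cst ν f ψ Vs z b * V x y * I))) := by
      refine tendsto_nhdsWithin_of_tendsto_nhds ?_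
      have hc' : ContinuousAt (fun ε : ℝ => (2 / (π - 4 * ε)) *
        (Cst ν f ψ Vs z (b + 2 * ε) * V x y * I)) 0 := by
        refine ContinuousAt.mul ?_ ?_
        · refine ContinuousAt.div continuousAt_const (by fun_prop) ?_
          simp [Real.pi_ne_zero]
        · exact (((hCc.comp (by fun_prop : Continuous fun ε : ℝ => b + 2 * ε)).mul
            continuous_const).mul continuous_const).continuousAt
      have := hc'.tendsto
      simpa using this
    obtain ⟨ε, h1, hε, h3⟩ := ((g.eventually (gt_mem_nhds hc)).and (pos.and
      (lims.eventually (gt_mem_nhds (by norm_num : (0:ℝ) < 1 / 2))))).exists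
    set δ := (ε ^ 2)⁻¹ with hδ
    have hδ0 : 0 < δ := by positivity
    have hπε : 0 < π - 4 * ε := by linarith
    have W := W_lim hG hV hVs hψ (b := b + 2 * ε) hz (by linarith) hδ0
      (q := fun t => δ - t) (κ := Fd δ) (by fun_prop) (fun u => rfl)
      (fun u => Fd_bd δ u hδ0.le) (e := ε) (by rw [abs_of_pos hε]; linarith) x y
    have W2 := W.const_mul ((π * δ - 4 / ε)⁻¹)
    have ed : π * δ - 4 / ε = (π - 4 * ε) / ε ^ 2 := by rw [hδ]; field_simp
    have e : (π * δ - 4 / ε)⁻¹ * (2 * (δ - 0) * Cst ν f ψ Vs z (b + 2 * ε) * V x y * I) =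
        (2 / (π - 4 * ε)) * (Cst ν f ψ Vs z (b + 2 * ε) * V x y * I) := by
      rw [ed, hδ]
      field_simp
      ring
    rw [e] at W2
    filter_upwards [W2.eventually (gt_mem_nhds h1), eventually_ge_atTop 4] with n hn hn4
    refine lt_of_le_of_lt ?_ hn
    obtain ⟨m', hm', hk⟩ := key n hn4
    have hpos : 0 < π * δ - 4 / ε := by rw [ed]; positivity
    rw [hk b, hm', le_inv_mul_iff₀ hpos]
    have := KS_mono' hP f m' (fun w u (hu : 0 < u) =>
      upper_pt hP f hψ z b (kk n + 1) hδ0 hε w u hu) x y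
    rw [KS_smul] at this
    calc _ = (n:ℝ) * √n * ((π * δ - 4 / ε) *
          (KS P f ^ (m' + 1)) ((KS P f ^ (kk n + 1)) (win ψ z b)) x y) := by ring
      _ ≤ _ := mul_le_mul_of_nonneg_left this (by positivity)

end PartG6

/-- Theorem 2.5, part 1: conditioned local limit theorem with
fixed target. -/
theorem conditioned_local_limit_theorem [Fintype X] [DecidableEq X] [Nonempty X]
    (P : X → X → ℝ) (ν f : X → ℝ) (hS : IsStochastic P ν)
    (h1 : Primitive P) (h2 : ∑ x, f x * ν x = 0) (h3 : NonLattice P f)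
    (V : X → ℝ → ℝ)
    (hV : ∀ (x : X) (y : ℝ),
      Tendsto (fun n : ℕ =>
          Real.sqrt (sigma2 P ν f) * Real.sqrt (2 * π * n) / 2 *
            Ex P x n (fun ω => ind (survives f y n ω)))
        atTop (nhds (V x y)))
    (Vs : X → ℝ → ℝ)
    (hVs : ∀ (x : X) (z : ℝ),
      Tendsto (fun n : ℕ =>
          Real.sqrt (sigma2 P ν f) * Real.sqrt (2 * π * n) / 2 *
            Ex (dualK P ν) x n (fun ω => ind (survives (fun b => -f b) z n ω)))
        atTop (nhds (Vs x z))) :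
    ∀ ψ : X → ℝ, (∀ b, 0 ≤ ψ b) → ∀ a : ℝ, 0 < a → ∀ x : X, ∀ y : ℝ, ∀ z : ℝ, 0 ≤ z →
      Tendsto (fun n : ℕ => (n : ℝ) ^ (3 / 2 : ℝ) *
          Ex P x n (fun ω =>
            ψ (ω n) * ind (y + Spath f ω n ∈ Set.Icc z (z + a) ∧ survives f y n ω)))
        atTop
        (nhds (2 * V x y / (Real.sqrt (2 * π) * Real.sqrt (sigma2 P ν f) ^ 3) *
          ∫ z' in z..(z + a), ∑ b, ν b *
            Ex (dualK P ν) b 1 (fun ωs =>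
              ψ (ωs 1) * Vs (ωs 1) (z' + Spath (fun u => -f u) ωs 1) *
                ind (survives (fun u => -f u) z' 1 ωs)))) := by
  intro ψ hψ a ha x y z hz
  have hG : Good P ν f := ⟨hS, h1, h2, h3⟩
  have hσ := sigma_pos hG
  have hV' : HasV P ν f V := by
    intro x y
    refine (hV x y).congr fun n => ?_
    unfold Tn
    rw [KS_repr]
    simp only [one_mul]
  have hVs' : HasV (dualK P ν) ν (fun c => -f c) Vs := by
    intro x y
    rw [dual_sigma hG]
    refine (hVs x y).congr fun n => ?_
    unfold Tn
    rw [KS_repr]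
    simp only [one_mul]
  have hc := core hG hV' hVs' hψ hz (by linarith : z < z + a) x y
  have hC : (∫ z' in z..(z + a), ∑ b, ν b *
      Ex (dualK P ν) b 1 (fun ωs =>
        ψ (ωs 1) * Vs (ωs 1) (z' + Spath (fun u => -f u) ωs 1) *
          ind (survives (fun u => -f u) z' 1 ωs))) = Cst ν f ψ Vs z (z + a) := by
    have hpt : ∀ z', ∑ b, ν b * Ex (dualK P ν) b 1 (fun ωs =>
        ψ (ωs 1) * Vs (ωs 1) (z' + Spath (fun u => -f u) ωs 1) *
          ind (survives (fun u => -f u) z' 1 ωs)) =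
        ∑ b, ν b * ψ b * (if 0 < z' - f b then Vs b (z' - f b) else 0) := by
      intro z'
      have h : ∀ b, Ex (dualK P ν) b 1 (fun ωs =>
        ψ (ωs 1) * Vs (ωs 1) (z' + Spath (fun u => -f u) ωs 1) *
          ind (survives (fun u => -f u) z' 1 ωs)) = ∑ b', dualK P ν b b' *
            (ψ b' * (if 0 < z' - f b' then Vs b' (z' - f b') else 0)) := by
        intro b
        have := KS_repr (dualK P ν) (fun u => -f u) 1 (fun b u => ψ b * Vs b u) b z'
        rw [← this, pow_one, KS_apply]
        refine Finset.sum_congr rfl fun b' _ => ?_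
        rw [← sub_eq_add_neg]
        split_ifs <;> simp
      simp only [h, Finset.mul_sum]
      rw [Finset.sum_comm]
      refine Finset.sum_congr rfl fun b' _ => ?_
      simp only [← mul_assoc]
      rw [← Finset.sum_mul, ← Finset.sum_mul, (dual_st hS).nuInv]
    simp only [hpt]
    rw [intervalIntegral.integral_finsetSum]
    · simp only [intervalIntegral.integral_const_mul]
      rfl
    · intro b _
      exact (Cst_int hG hVs' z (z + a) b).const_mul _
  rw [hC]
  have hlim : 2 / π * (Cst ν f ψ Vs z (z + a) * V x y *
      ∫ s in Set.Ioi 0, s ^ 2 * Real.exp (-(sigma2 P ν f / 2) * s ^ 2)) =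
      2 * V x y / (Real.sqrt (2 * π) * Real.sqrt (sigma2 P ν f) ^ 3) *
        Cst ν f ψ Vs z (z + a) := by
    rw [gauss_int hσ]
    have h0 : 0 < √(2 * π) := Real.sqrt_pos.2 (by positivity)
    have hs0 : 0 < √(sigma2 P ν f) := Real.sqrt_pos.2 hσ
    have h2' : √(2 * π) ^ 2 = 2 * π := Real.sq_sqrt (by positivity)
    field_simp
    rw [h2']
    ring
  rw [← hlim]
  refine hc.congr fun n => ?_
  have hn : (n:ℝ) ^ (3 / 2 : ℝ) = n * √n := by
    rcases Nat.eq_zero_or_pos n with h | h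
    · subst h; norm_num
    · have : (0:ℝ) < n := by exact_mod_cast h
      rw [show (3 / 2 : ℝ) = 1 + 1 / 2 by norm_num, Real.rpow_add this, Real.rpow_one,
        Real.sqrt_eq_rpow]
  rw [hn, KS_repr]
  congr 2
  ext ω
  unfold win
  rw [mul_assoc]
  congr 1
  by_cases hs : survives f y n ω
  · by_cases hw : y + Spath f ω n ∈ Set.Icc z (z + a)
    · rw [Set.indicator_of_mem hw, ind_true hs, ind_true ⟨hw, hs⟩]; simp
    · rw [Set.indicator_of_notMem hw, zero_mul]
      exact (ind_false (fun h => hw h.1)).symm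
  · rw [ind_false hs, ind_false (fun h => hs h.2), mul_zero]
end CLLT
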